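/- Let u_ε be a sequence of solutions of (E_ε) with ε → 0. If u_ε → 0 almost everywhere in Ω∖Z as ε → 0 (i.e. the sequence is topological), then for all sufficiently small ε > 0 the solution u_ε is strictly stable, i.e. the first eigenvalue μ_ε of the linearized operator is strictly positive. -/

import Mathlib

open MeasureTheory Real Filter Set Metric Topology

noncomputable section

/-- The Euclidean plane `ℝ²`. -/
abbrev Pl := EuclideanSpace ℝ (Fin 2)

/-- The unit lattice `ℤ² ⊆ ℝ²`; the flat 2-torus `Ω` is its quotient, which we model by
working with doubly periodic functions on the plane. -/
def unitLattice : Set Pl :=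
  {v | ∃ a b : ℤ, v = (a : ℝ) • EuclideanSpace.single 0 (1:ℝ) +
      (b : ℝ) • EuclideanSpace.single 1 (1:ℝ)}

/-- A fundamental domain for the torus `Ω` (of total area `|Ω| = 1`). -/
def fund : Set Pl := {x | x 0 ∈ Ico (0:ℝ) 1 ∧ x 1 ∈ Ico (0:ℝ) 1}

/-- A doubly periodic function on the plane, i.e. a function on the torus `Ω`. -/
def Periodic2 (u : Pl → ℝ) : Prop := ∀ x : Pl, ∀ v ∈ unitLattice, u (x + v) = u x

/-- Partial derivative in the `i`-th coordinate direction. -/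
def pd (u : Pl → ℝ) (i : Fin 2) : Pl → ℝ :=
  fun x => lineDeriv ℝ u x (EuclideanSpace.single i (1:ℝ))

/-- The Laplacian `Δu`. -/
def lap (u : Pl → ℝ) (x : Pl) : ℝ := pd (pd u 0) 0 x + pd (pd u 1) 1 x

/-- `|∇u|²`. -/
def gradSq (u : Pl → ℝ) (x : Pl) : ℝ := (pd u 0 x) ^ 2 + (pd u 1 x) ^ 2

/-- The nonlinearity `f_τ(t) = e^t (1 − e^t) / (τ + e^t)³`. -/
def fτ (τ t : ℝ) : ℝ := exp t * (1 - exp t) / (τ + exp t) ^ 3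

/-- `f_τ'(t) = e^t (τ − 2(τ+1) e^t + e^{2t}) / (τ + e^t)⁴`. -/
def fτ' (τ t : ℝ) : ℝ := exp t * (τ - 2 * (τ + 1) * exp t + exp (2 * t)) / (τ + exp t) ^ 4

/-- The antiderivative `F_{2,τ}(t) = e^t ((1−τ) e^t + 2τ) / (2τ² (τ+e^t)²)` of `f_τ`. -/
def F2τ (τ t : ℝ) : ℝ := exp t * ((1 - τ) * exp t + 2 * τ) / (2 * τ ^ 2 * (τ + exp t) ^ 2)

/-- `u − 2a ln‖· − p‖` extends smoothly across `p`: this encodes the distributional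
equation `Δu = 4πa δ_p + (smooth)` near `p`. -/
def LogSing (u : Pl → ℝ) (p : Pl) (a : ℝ) : Prop :=
  ∃ r > 0, ∃ v : Pl → ℝ, ContDiffOn ℝ (⊤ : ℕ∞) v (ball p r) ∧
    ∀ x ∈ ball p r, x ≠ p → u x = 2 * a * Real.log ‖x - p‖ + v x

/-- The vortex data: distinct points `p_{j,1}` (`1 ≤ j ≤ d₁`), `p_{j,2}` (`1 ≤ j ≤ d₂`)
of the torus with multiplicities `m_{j,1} ≥ 0`, `m_{j,2} ≥ 0`. -/
structure VortexData where
  d₁ : ℕ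
  d₂ : ℕ
  p₁ : Fin d₁ → Pl
  p₂ : Fin d₂ → Pl
  m₁ : Fin d₁ → ℝ
  m₂ : Fin d₂ → ℝ
  m₁_nonneg : ∀ j, 0 ≤ m₁ j
  m₂_nonneg : ∀ j, 0 ≤ m₂ j
  distinct : ∀ i j : Fin d₁ ⊕ Fin d₂, i ≠ j → ∀ v ∈ unitLattice,
      Sum.elim p₁ p₂ i ≠ Sum.elim p₁ p₂ j + v

namespace VortexData
variable (V : VortexData)

/-- The set `Z₁` of vortex points `p_{j,1}` (viewed in the plane: all lattice translates). -/
def Z1 : Set Pl := {x | ∃ j v, v ∈ unitLattice ∧ x = V.p₁ j + v}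

/-- The set `Z₂` of vortex points `p_{j,2}` (viewed in the plane: all lattice translates). -/
def Z2 : Set Pl := {x | ∃ j v, v ∈ unitLattice ∧ x = V.p₂ j + v}

/-- The full vortex set `Z = Z₁ ∪ Z₂`. -/
def Z : Set Pl := V.Z1 ∪ V.Z2

/-- `N₁ = Σ_j m_{j,1}`. -/
def N1 : ℝ := ∑ j, V.m₁ j

/-- `N₂ = Σ_j m_{j,2}`. -/
def N2 : ℝ := ∑ j, V.m₂ j

end VortexData

/-- `u` is a solution of `(E_ε)`:
`Δu + ε⁻² f_τ(u) = 4π Σ_j m_{j,1} δ_{p_{j,1}} − 4π Σ_j m_{j,2} δ_{p_{j,2}}` on `Ω`,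
formulated classically: `u` is doubly periodic, smooth away from `Z`, solves the PDE
classically off `Z`, and has the prescribed logarithmic singularities at the vortices. -/
structure IsSolution (V : VortexData) (τ ε : ℝ) (u : Pl → ℝ) : Prop where
  periodic : Periodic2 u
  smooth : ContDiffOn ℝ (⊤ : ℕ∞) u (V.Z)ᶜ
  pde : ∀ x ∉ V.Z, lap u x + (ε ^ 2)⁻¹ * fτ τ (u x) = 0
  sing₁ : ∀ j, LogSing u (V.p₁ j) (V.m₁ j)
  sing₂ : ∀ j, LogSing u (V.p₂ j) (-(V.m₂ j))

/-- The quadratic form `∫_Ω |∇φ|² − ε⁻² f_τ'(u) φ²` of the linearized operator at `u`. -/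
def QuadForm (τ ε : ℝ) (u φ : Pl → ℝ) : ℝ :=
  ∫ x in fund, (gradSq φ x - (ε ^ 2)⁻¹ * fτ' τ (u x) * (φ x) ^ 2)

/-- `u` is a stable solution: the first eigenvalue `μ_ε` of the linearized operator is
nonnegative, i.e. the quadratic form is nonnegative on all (smooth, doubly periodic)
test functions. -/
def Stable (τ ε : ℝ) (u : Pl → ℝ) : Prop :=
  ∀ φ : Pl → ℝ, ContDiff ℝ (⊤ : ℕ∞) φ → Periodic2 φ → 0 ≤ QuadForm τ ε u φ

/-- `u` is strictly stable: the first eigenvalue `μ_ε` of the linearized operator is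
strictly positive. -/
def StrictlyStable (τ ε : ℝ) (u : Pl → ℝ) : Prop :=
  ∃ μ > 0, ∀ φ : Pl → ℝ, ContDiff ℝ (⊤ : ℕ∞) φ → Periodic2 φ →
    μ * (∫ x in fund, (φ x) ^ 2) ≤ QuadForm τ ε u φ

/-! ### Basic calculus of partial derivatives -/

/-- The coordinate vectors. -/
abbrev ee (i : Fin 2) : Pl := EuclideanSpace.single i (1:ℝ)

lemma pd_eq_fderiv {f : Pl → ℝ} {x : Pl} (h : DifferentiableAt ℝ f x) (i : Fin 2) :
    pd f i x = fderiv ℝ f x (ee i) := h.lineDeriv_eq_fderiv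

lemma pd_congr {f g : Pl → ℝ} {x : Pl} (h : f =ᶠ[𝓝 x] g) (i : Fin 2) :
    pd f i x = pd g i x := Filter.EventuallyEq.lineDeriv_eq h

lemma pd_congr' {f g : Pl → ℝ} {x : Pl} (h : f =ᶠ[𝓝 x] g) (i : Fin 2) :
    pd f i =ᶠ[𝓝 x] pd g i := by
  filter_upwards [h.eventuallyEq_nhds] with y hy using pd_congr hy i

lemma lap_congr {f g : Pl → ℝ} {x : Pl} (h : f =ᶠ[𝓝 x] g) : lap f x = lap g x := by
  unfold lap
  rw [pd_congr (pd_congr' h 0) 0, pd_congr (pd_congr' h 1) 1]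

lemma pd_eq_fderiv_ev {f : Pl → ℝ} {x : Pl} (h : ContDiffAt ℝ 1 f x) (i : Fin 2) :
    pd f i =ᶠ[𝓝 x] fun y => fderiv ℝ f y (ee i) := by
  filter_upwards [h.eventually (by simp)] with y hy
  exact pd_eq_fderiv (hy.differentiableAt (by simp)) i

lemma ContDiffAt.pd' {f : Pl → ℝ} {x : Pl} {m n : WithTop ℕ∞} (h : ContDiffAt ℝ n f x)
    (hmn : m + 1 ≤ n) (i : Fin 2) : ContDiffAt ℝ m (pd f i) x := by
  have h1 : ContDiffAt ℝ 1 f x := h.of_le (le_trans (by simp) hmn)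
  have h2 := h.fderiv_right hmn
  exact (h2.clm_apply contDiffAt_const).congr_of_eventuallyEq (pd_eq_fderiv_ev h1 i)

lemma pd_comm {f : Pl → ℝ} {x : Pl} (h : ContDiffAt ℝ 2 f x) (i j : Fin 2) :
    pd (pd f i) j x = pd (pd f j) i x := by
  have h1 : ContDiffAt ℝ 1 f x := h.of_le (by norm_num)
  have key : ∀ i j : Fin 2, pd (pd f i) j x = fderiv ℝ (fderiv ℝ f) x (ee j) (ee i) := by
    intro i j
    have h2 : ContDiffAt ℝ 1 (fderiv ℝ f) x := h.fderiv_right (by norm_num)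
    have h3 := h2.differentiableAt (by simp)
    rw [pd_congr (pd_eq_fderiv_ev h1 i) j, pd_eq_fderiv (h3.clm_apply (by fun_prop))]
    rw [fderiv_clm_apply h3 (by fun_prop)]
    simp
  rw [key, key]
  have := h.isSymmSndFDerivAt (by simp)
  exact this _ _

lemma pd_add {f g : Pl → ℝ} {x : Pl} (hf : DifferentiableAt ℝ f x) (hg : DifferentiableAt ℝ g x)
    (i : Fin 2) : pd (fun y => f y + g y) i x = pd f i x + pd g i x := by
  rw [pd_eq_fderiv hf, pd_eq_fderiv hg, pd_eq_fderiv (hf.fun_add hg), fderiv_fun_add hf hg]; rfl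

lemma pd_sub {f g : Pl → ℝ} {x : Pl} (hf : DifferentiableAt ℝ f x) (hg : DifferentiableAt ℝ g x)
    (i : Fin 2) : pd (fun y => f y - g y) i x = pd f i x - pd g i x := by
  rw [pd_eq_fderiv hf, pd_eq_fderiv hg, pd_eq_fderiv (hf.fun_sub hg), fderiv_fun_sub hf hg]; rfl

lemma pd_mul {f g : Pl → ℝ} {x : Pl} (hf : DifferentiableAt ℝ f x) (hg : DifferentiableAt ℝ g x)
    (i : Fin 2) : pd (fun y => f y * g y) i x = f x * pd g i x + g x * pd f i x := by
  rw [pd_eq_fderiv hf, pd_eq_fderiv hg, pd_eq_fderiv (hf.fun_mul hg), fderiv_fun_mul hf hg]; rfl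

lemma pd_comp {f : Pl → ℝ} {β : ℝ → ℝ} {b : ℝ} {x : Pl} (hβ : HasDerivAt β b (f x))
    (hf : DifferentiableAt ℝ f x) (i : Fin 2) : pd (fun y => β (f y)) i x = b * pd f i x := by
  have h := hβ.comp_hasFDerivAt x hf.hasFDerivAt
  have h' : HasFDerivAt (fun y => β (f y)) (b • fderiv ℝ f x) x := h
  rw [pd_eq_fderiv hf, pd_eq_fderiv h'.differentiableAt, h'.fderiv]; rfl

lemma pd_const (c : ℝ) (i : Fin 2) (x : Pl) : pd (fun _ => c) i x = 0 := by
  rw [pd_eq_fderiv (by fun_prop)]; simp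

lemma pd_const_mul {f : Pl → ℝ} {x : Pl} (c : ℝ) (hf : DifferentiableAt ℝ f x)
    (i : Fin 2) : pd (fun y => c * f y) i x = c * pd f i x := by
  rw [pd_mul (by fun_prop) hf, pd_const]; simp

lemma pd_neg (f : Pl → ℝ) (x : Pl) (i : Fin 2) : pd (fun y => - f y) i x = - pd f i x := by
  unfold pd lineDeriv
  exact deriv.fun_neg

lemma lap_neg (f : Pl → ℝ) (x : Pl) : lap (fun y => - f y) x = - lap f x := by
  have h : ∀ i, pd (fun y => - f y) i = fun y => - pd f i y := fun i => funext fun y => pd_neg f y i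
  unfold lap
  rw [h, h, pd_neg, pd_neg]; ring

lemma pd_coord (i j : Fin 2) (x : Pl) (c : ℝ) :
    pd (fun y : Pl => y j - c) i x = if i = j then 1 else 0 := by
  have : HasFDerivAt (fun y : Pl => y j - c) (EuclideanSpace.proj j : Pl →L[ℝ] ℝ) x :=
    (EuclideanSpace.proj j : Pl →L[ℝ] ℝ).hasFDerivAt.sub_const c
  rw [pd_eq_fderiv this.differentiableAt, this.fderiv]
  fin_cases i <;> fin_cases j <;> simp

lemma diff_coord (j : Fin 2) (c : ℝ) : ContDiff ℝ (⊤ : ℕ∞) (fun y : Pl => y j - c) := by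
  have : ContDiff ℝ (⊤ : ℕ∞) (fun y : Pl => (EuclideanSpace.proj j : Pl →L[ℝ] ℝ) y - c) := by
    fun_prop
  exact this

lemma evdiff {f : Pl → ℝ} {x : Pl} (h : ContDiffAt ℝ 2 f x) : ∀ᶠ y in 𝓝 x, DifferentiableAt ℝ f y := by
  have h1 : ContDiffAt ℝ 1 f x := h.of_le (by norm_num)
  filter_upwards [h1.eventually (by simp)] with y hy using hy.differentiableAt (by simp)

lemma d1 {f : Pl → ℝ} {x : Pl} (h : ContDiffAt ℝ 2 f x) : DifferentiableAt ℝ f x :=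
  h.differentiableAt (by simp)

lemma d2 {f : Pl → ℝ} {x : Pl} (h : ContDiffAt ℝ 2 f x) (i : Fin 2) :
    DifferentiableAt ℝ (pd f i) x :=
  (h.pd' (m := 1) (by norm_num) i).differentiableAt (by simp)

lemma lap_add {f g : Pl → ℝ} {x : Pl} (hf : ContDiffAt ℝ 2 f x) (hg : ContDiffAt ℝ 2 g x) :
    lap (fun y => f y + g y) x = lap f x + lap g x := by
  have h : ∀ i, pd (fun y => f y + g y) i =ᶠ[𝓝 x] fun y => pd f i y + pd g i y := by
    intro i
    filter_upwards [evdiff hf, evdiff hg] with y h1 h2 using pd_add h1 h2 i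
  unfold lap
  rw [pd_congr (h 0), pd_congr (h 1), pd_add (d2 hf 0) (d2 hg 0), pd_add (d2 hf 1) (d2 hg 1)]
  ring

lemma lap_const_mul {f : Pl → ℝ} {x : Pl} (c : ℝ) (hf : ContDiffAt ℝ 2 f x) :
    lap (fun y => c * f y) x = c * lap f x := by
  have h : ∀ i, pd (fun y => c * f y) i =ᶠ[𝓝 x] fun y => c * pd f i y := by
    intro i
    filter_upwards [evdiff hf] with y h1 using pd_const_mul c h1 i
  unfold lap
  rw [pd_congr (h 0), pd_congr (h 1), pd_const_mul c (d2 hf 0), pd_const_mul c (d2 hf 1)]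
  ring

lemma lap_const (c : ℝ) (x : Pl) : lap (fun _ => c) x = 0 := by
  have h : ∀ i, pd (fun _ : Pl => c) i = fun y => (0:ℝ) := fun i => funext fun y => pd_const c i y
  unfold lap
  rw [h, h, pd_const, pd_const]; ring

lemma lap_sub {f g : Pl → ℝ} {x : Pl} (hf : ContDiffAt ℝ 2 f x) (hg : ContDiffAt ℝ 2 g x) :
    lap (fun y => f y - g y) x = lap f x - lap g x := by
  have := lap_add hf hg.neg
  simp only [← sub_eq_add_neg] at this
  rw [this]
  have h2 := lap_neg g x
  change _ + lap (fun y => - g y) x = _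
  rw [h2]; ring

lemma lap_mul {f g : Pl → ℝ} {x : Pl} (hf : ContDiffAt ℝ 2 f x) (hg : ContDiffAt ℝ 2 g x) :
    lap (fun y => f y * g y) x = f x * lap g x + g x * lap f x +
      2 * (pd f 0 x * pd g 0 x + pd f 1 x * pd g 1 x) := by
  have h : ∀ i, pd (fun y => f y * g y) i =ᶠ[𝓝 x] fun y => f y * pd g i y + g y * pd f i y := by
    intro i
    filter_upwards [evdiff hf, evdiff hg] with y h1 h2 using pd_mul h1 h2 i
  unfold lap
  have k : ∀ i, pd (pd (fun y => f y * g y) i) i x =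
      f x * pd (pd g i) i x + g x * pd (pd f i) i x + 2 * (pd f i x * pd g i x) := by
    intro i
    rw [pd_congr (h i), pd_add ((d1 hf).fun_mul (d2 hg i)) ((d1 hg).fun_mul (d2 hf i)),
      pd_mul (d1 hf) (d2 hg i), pd_mul (d1 hg) (d2 hf i)]
    ring
  rw [k, k]; ring

lemma lap_comp {f : Pl → ℝ} {β β1 : ℝ → ℝ} {b : ℝ} {x : Pl} (hβ : ∀ t, HasDerivAt β (β1 t) t)
    (hβ1 : HasDerivAt β1 b (f x)) (hf : ContDiffAt ℝ 2 f x) :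
    lap (fun y => β (f y)) x = b * gradSq f x + β1 (f x) * lap f x := by
  have h : ∀ i, pd (fun y => β (f y)) i =ᶠ[𝓝 x] fun y => β1 (f y) * pd f i y := by
    intro i
    filter_upwards [evdiff hf] with y h1 using pd_comp (hβ _) h1 i
  have hd : DifferentiableAt ℝ (fun y => β1 (f y)) x :=
    (hβ1.comp_hasFDerivAt x (d1 hf).hasFDerivAt).differentiableAt
  unfold lap gradSq
  rw [pd_congr (h 0), pd_congr (h 1), pd_mul hd (d2 hf 0), pd_mul hd (d2 hf 1),
    pd_comp hβ1 (d1 hf), pd_comp hβ1 (d1 hf)]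
  ring

/-- affine rescaling -/
lemma pd_scale (f : Pl → ℝ) (z : Pl) (c : ℝ) (i : Fin 2) (x : Pl) :
    pd (fun y => f (z + c • (y - z))) i x = c * pd f i (z + c • (x - z)) := by
  unfold pd lineDeriv
  have h : (fun t : ℝ => f (z + c • (x + t • EuclideanSpace.single i (1:ℝ) - z))) =
      fun t : ℝ => (fun s : ℝ => f (z + c • (x - z) + s • EuclideanSpace.single i (1:ℝ))) (c * t) := by
    funext t
    congr 1
    module
  rw [h]
  have h2 := deriv_comp_mul_left c
    (fun s : ℝ => f (z + c • (x - z) + s • EuclideanSpace.single i (1:ℝ))) 0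
  rw [h2]
  simp

lemma lap_scale (f : Pl → ℝ) (z : Pl) (c : ℝ) (x : Pl) :
    lap (fun y => f (z + c • (y - z))) x = c ^ 2 * lap f (z + c • (x - z)) := by
  have h : ∀ i, pd (fun y => f (z + c • (y - z))) i = fun y => c * pd f i (z + c • (y - z)) :=
    fun i => funext fun y => pd_scale f z c i y
  have hc : ∀ (g : Pl → ℝ) (i : Fin 2) (x : Pl), pd (fun y => c * g y) i x = c * pd g i x := by
    intro g i x
    unfold pd lineDeriv
    exact deriv_const_mul_field c
  unfold lap
  rw [h, h, hc, hc, pd_scale (pd f 0), pd_scale (pd f 1)]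
  ring

/-- translation -/
lemma pd_trans (f : Pl → ℝ) (v : Pl) (i : Fin 2) (x : Pl) :
    pd (fun y => f (y + v)) i x = pd f i (x + v) := by
  unfold pd lineDeriv
  congr 1
  funext t
  rw [add_right_comm]

lemma second_deriv_max {g : ℝ → ℝ} (hm : IsLocalMax g 0) (hc : ContinuousAt g 0) :
    deriv (deriv g) 0 ≤ 0 := by
  by_contra hpos
  push Not at hpos
  have h0 : deriv g 0 = 0 := hm.deriv_eq_zero
  have hmin := isLocalMin_of_deriv_deriv_pos hpos h0 hc
  have hconst : g =ᶠ[𝓝 0] fun _ => g 0 := by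
    filter_upwards [hm, hmin] with y h1 h2 using le_antisymm h1 h2
  have h1 : deriv g =ᶠ[𝓝 0] fun _ => 0 := by
    have := hconst.deriv
    simpa using this
  have h2 := h1.deriv_eq
  simp at h2
  linarith

lemma pdpd_max {f : Pl → ℝ} {x : Pl} (hf : ContinuousAt f x) (hm : IsLocalMax f x) (i : Fin 2) :
    pd (pd f i) i x ≤ 0 := by
  set g : ℝ → ℝ := fun t => f (x + t • ee i) with hg
  have hcont : ContinuousAt (fun t : ℝ => x + t • ee i) 0 := by fun_prop
  have hx : x + (0:ℝ) • ee i = x := by simp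
  have hgm : IsLocalMax g 0 := by
    have : Tendsto (fun t : ℝ => x + t • ee i) (𝓝 0) (𝓝 x) := by
      have := hcont.tendsto
      rwa [hx] at this
    have h2 := this.eventually hm
    filter_upwards [h2] with t ht
    simpa [hg] using ht
  have hgc : ContinuousAt g 0 := ContinuousAt.comp (by rw [hx]; exact hf) hcont
  have h1 : ∀ t, deriv g t = pd f i (x + t • ee i) := by
    intro t
    have : (fun s : ℝ => f (x + t • ee i + s • ee i)) = fun s => g (s + t) := by
      funext s; simp only [hg]; congr 1; module
    unfold pd lineDeriv
    change _ = deriv (fun s : ℝ => f (x + t • ee i + s • ee i)) 0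
    rw [this, deriv_comp_add_const]; simp
  have h2 : pd (pd f i) i x = deriv (deriv g) 0 := by
    have : deriv g = fun t => pd f i (x + t • ee i) := funext h1
    rw [this]; rfl
  rw [h2]
  exact second_deriv_max hgm hgc

lemma lap_max {f : Pl → ℝ} {x : Pl} (hf : ContinuousAt f x) (hm : IsLocalMax f x) :
    lap f x ≤ 0 := add_nonpos (pdpd_max hf hm 0) (pdpd_max hf hm 1)

lemma lap_min {f : Pl → ℝ} {x : Pl} (hf : ContinuousAt f x) (hm : IsLocalMin f x) :
    0 ≤ lap f x := by
  have := lap_max hf.neg hm.neg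
  have h2 : lap (-f) x = - lap f x := lap_neg f x
  linarith

/-! ### explicit functions -/

/-- squared distance -/
def nsq (z x : Pl) : ℝ := (x 0 - z 0) ^ 2 + (x 1 - z 1) ^ 2

lemma nsq_eq (z x : Pl) : nsq z x = ‖x - z‖ ^ 2 := by
  rw [EuclideanSpace.norm_sq_eq]
  simp [nsq]

lemma nsq_smooth (z : Pl) : ContDiff ℝ (⊤ : ℕ∞) (nsq z) := by
  unfold nsq
  exact ((diff_coord 0 _).pow 2).add ((diff_coord 1 _).pow 2)

lemma pd_nsq (z x : Pl) (i : Fin 2) : pd (nsq z) i x = 2 * (x i - z i) := by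
  have h0 := fun j => ((diff_coord j (z j)).differentiable (by simp) x)
  have : nsq z = fun y => (y 0 - z 0) * (y 0 - z 0) + (y 1 - z 1) * (y 1 - z 1) := by
    funext y; unfold nsq; ring
  rw [this, pd_add ((h0 0).fun_mul (h0 0)) ((h0 1).fun_mul (h0 1)), pd_mul (h0 0) (h0 0),
    pd_mul (h0 1) (h0 1), pd_coord, pd_coord]
  fin_cases i <;> simp <;> ring

lemma lap_nsq (z x : Pl) : lap (nsq z) x = 4 := by
  have h : ∀ i, pd (nsq z) i = fun y => 2 * (y i - z i) := fun i => funext fun y => pd_nsq z y i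
  have h0 := fun j => ((diff_coord j (z j)).differentiable (by simp) x)
  unfold lap
  rw [h, h, pd_const_mul _ (h0 0), pd_const_mul _ (h0 1), pd_coord, pd_coord]
  norm_num

lemma nsq_pos {z x : Pl} (h : x ≠ z) : 0 < nsq z x := by
  rw [nsq_eq]
  have := norm_pos_iff.2 (sub_ne_zero.2 h)
  positivity

lemma log_norm_eq (z x : Pl) : Real.log ‖x - z‖ = (1/2) * Real.log (nsq z x) := by
  rw [nsq_eq, Real.log_pow]; push_cast; ring

lemma log_smooth {z x : Pl} (h : x ≠ z) :
    ContDiffAt ℝ (⊤ : ℕ∞) (fun y : Pl => Real.log ‖y - z‖) x := by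
  have : (fun y : Pl => Real.log ‖y - z‖) = fun y => (1/2) * Real.log (nsq z y) :=
    funext fun y => log_norm_eq z y
  rw [this]
  exact contDiffAt_const.mul ((nsq_smooth z).contDiffAt.log (nsq_pos h).ne')

lemma pd_log {z x : Pl} (h : x ≠ z) (i : Fin 2) :
    pd (fun y : Pl => Real.log ‖y - z‖) i x = (x i - z i) * (nsq z x)⁻¹ := by
  have : (fun y : Pl => Real.log ‖y - z‖) = fun y => (1/2) * Real.log (nsq z y) :=
    funext fun y => log_norm_eq z y
  have hn := nsq_pos h
  have hd : DifferentiableAt ℝ (nsq z) x := (nsq_smooth z).differentiable (by simp) x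
  rw [this, pd_const_mul _ (hd.log hn.ne'), pd_comp (Real.hasDerivAt_log hn.ne') hd, pd_nsq]
  ring

lemma lap_log {z x : Pl} (h : x ≠ z) : lap (fun y : Pl => Real.log ‖y - z‖) x = 0 := by
  have hev : ∀ i, pd (fun y : Pl => Real.log ‖y - z‖) i =ᶠ[𝓝 x]
      fun y => (y i - z i) * (nsq z y)⁻¹ := by
    intro i
    filter_upwards [isOpen_ne.mem_nhds h] with y hy using pd_log hy i
  have hn := nsq_pos h
  have hd : DifferentiableAt ℝ (nsq z) x := (nsq_smooth z).differentiable (by simp) x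
  have h0 := fun j => ((diff_coord j (z j)).differentiable (by simp) x)
  unfold lap
  rw [pd_congr (hev 0), pd_congr (hev 1), pd_mul (h0 0) (hd.fun_inv hn.ne'),
    pd_mul (h0 1) (hd.fun_inv hn.ne'), pd_coord, pd_coord, pd_comp (hasDerivAt_inv hn.ne') hd,
    pd_comp (hasDerivAt_inv hn.ne') hd, pd_nsq, pd_nsq]
  have : nsq z x = (x 0 - z 0) ^ 2 + (x 1 - z 1) ^ 2 := rfl
  field_simp
  rw [this]; simp; ring

/-! ### Abstract setting and maximum principle estimates -/

/-- A lattice invariant, uniformly separated set of vortex points. -/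
structure GoodZ (Z : Set Pl) (ρ0 : ℝ) : Prop where
  pos : 0 < ρ0
  per : ∀ x ∈ Z, ∀ v ∈ unitLattice, x + v ∈ Z
  sep : ∀ z ∈ Z, ∀ z' ∈ Z, z ≠ z' → ρ0 ≤ dist z z'

/-- Abstract version of the solutions, stable under `u ↦ -u`. -/
structure ASol (Z : Set Pl) (A : ℝ) (F : ℝ → ℝ) (k : ℝ) (u : Pl → ℝ) : Prop where
  per : Periodic2 u
  sm : ∀ x ∉ Z, ContDiffAt ℝ (⊤ : ℕ∞) u x
  pde : ∀ x ∉ Z, lap u x = - (k * F (u x))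
  sing : ∀ z ∈ Z, ∃ a, |a| ≤ A ∧ LogSing u z a

lemma GoodZ.notMem {Z : Set Pl} {ρ0 : ℝ} (hZ : GoodZ Z ρ0) {z x : Pl} (hz : z ∈ Z) (hx : x ≠ z)
    (h : dist x z < ρ0) : x ∉ Z := fun hxZ => not_le.2 h (hZ.sep x hxZ z hz hx)

lemma two_le_top : (2 : WithTop ℕ∞) ≤ ((⊤ : ℕ∞) : WithTop ℕ∞) := 
  WithTop.coe_le_coe.2 (le_top : (2 : ℕ∞) ≤ ⊤)

lemma top_c2 {f : Pl → ℝ} {x : Pl} (h : ContDiffAt ℝ (⊤ : ℕ∞) f x) : ContDiffAt ℝ 2 f x :=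
  h.of_le two_le_top

lemma ASol.ext {Z : Set Pl} {ρ0 A k a : ℝ} {F : ℝ → ℝ} {u : Pl → ℝ} (hZ : GoodZ Z ρ0)
    (hu : ASol Z A F k u) {z : Pl} (hz : z ∈ Z) (ha : LogSing u z a) :
    ∃ v : Pl → ℝ, (∀ x, dist x z < ρ0 → ContDiffAt ℝ (⊤ : ℕ∞) v x) ∧
      ∀ x, x ≠ z → u x = 2 * a * Real.log ‖x - z‖ + v x := by
  obtain ⟨r, hr, v0, hv0, huv⟩ := ha
  refine ⟨fun x => if x = z then v0 z else u x - 2 * a * Real.log ‖x - z‖, ?_, ?_⟩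
  · intro x hx
    by_cases hxz : x = z
    · subst hxz
      have h1 : ContDiffAt ℝ (⊤ : ℕ∞) v0 x := hv0.contDiffAt (ball_mem_nhds x hr)
      refine h1.congr_of_eventuallyEq ?_
      filter_upwards [ball_mem_nhds x hr] with y hy
      by_cases hyx : y = x
      · simp [hyx]
      · simp only [hyx, if_false]
        rw [huv y hy hyx]; ring
    · have h1 := hu.sm x (hZ.notMem hz hxz hx)
      have h2 : ContDiffAt ℝ (⊤ : ℕ∞) (fun y => u y - 2 * a * Real.log ‖y - z‖) x :=
        h1.sub (contDiffAt_const.mul (log_smooth hxz))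
      refine h2.congr_of_eventuallyEq ?_
      filter_upwards [isOpen_ne.mem_nhds hxz] with y hy
      have : y ≠ z := hy
      simp [this]
  · intro x hx
    simp [hx]

lemma tendsto_log_dist (z : Pl) :
    Tendsto (fun y : Pl => Real.log ‖y - z‖) (𝓝[≠] z) atBot := by
  refine Real.tendsto_log_nhdsNE_zero.comp ?_
  refine tendsto_nhdsWithin_iff.2 ⟨?_, ?_⟩
  · have : Tendsto (fun y : Pl => ‖y - z‖) (𝓝 z) (𝓝 ‖z - z‖) := by
      apply Continuous.tendsto; fun_prop
    simp at this
    exact this.mono_left nhdsWithin_le_nhds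
  · filter_upwards [self_mem_nhdsWithin] with y hy
    have : y ≠ z := hy
    simp [sub_ne_zero, this]

lemma ASol.lower {Z : Set Pl} {ρ0 A k a : ℝ} {F : ℝ → ℝ} {u : Pl → ℝ} (hZ : GoodZ Z ρ0)
    (hu : ASol Z A F k u) (hk : 0 < k) (hF : ∀ t < 0, 0 < F t) {z : Pl} (hz : z ∈ Z)
    (ha : LogSing u z a) {ρ S : ℝ} (hρ : ρ < ρ0) (hS : 0 ≤ S)
    (hb : ∀ y, dist y z = ρ → - S ≤ u y) :
    ∀ y, y ≠ z → dist y z ≤ ρ → - S - 2 * max a 0 * Real.log (ρ / ‖y - z‖) ≤ u y := by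
  obtain ⟨v, hv, huv⟩ := hu.ext hZ hz ha
  -- the perturbed statement
  have key : ∀ κ > 0, ∀ y, y ≠ z → dist y z ≤ ρ →
      0 ≤ u y + S + 2 * (max a 0 + κ) * (Real.log ρ - Real.log ‖y - z‖) := by
    intro κ hκ y0 hy0 hy0ρ
    by_contra hneg
    push Not at hneg
    set w : Pl → ℝ := fun y => u y + S + 2 * (max a 0 + κ) * (Real.log ρ - Real.log ‖y - z‖) with hw
    have hρpos : 0 < ρ := lt_of_lt_of_le (dist_pos.2 hy0) hy0ρ
    have hwev : ∀ᶠ y in 𝓝[≠] z, 0 < w y := by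
      have h1 : Tendsto v (𝓝[≠] z) (𝓝 (v z)) :=
        ((hv z (by simp [hZ.pos])).continuousAt.tendsto).mono_left nhdsWithin_le_nhds
      have hc : 2 * (a - max a 0 - κ) < 0 := by
        have := le_max_left a 0
        linarith
      have h2 : Tendsto (fun y : Pl => 2 * (a - max a 0 - κ) * Real.log ‖y - z‖ +
          (v y + (S + 2 * (max a 0 + κ) * Real.log ρ))) (𝓝[≠] z) atTop :=
        ((tendsto_log_dist z).const_mul_atBot_of_neg hc).atTop_add (h1.add_const _)
      filter_upwards [h2.eventually_gt_atTop 0, self_mem_nhdsWithin] with y hy hyz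
      have : y ≠ z := hyz
      simp only [hw]
      rw [huv y this]
      linarith
    obtain ⟨ρ', hρ', hsub⟩ := Metric.mem_nhdsWithin_iff.1 hwev
    have hsub' : ∀ y, y ≠ z → dist y z < ρ' → 0 < w y := fun y h1 h2 => hsub ⟨h2, h1⟩
    have hy0ρ' : ρ' ≤ dist y0 z := by
      by_contra h
      push Not at h
      have := hsub' y0 hy0 h
      linarith
    set C : Set Pl := {y | ρ' / 2 ≤ dist y z ∧ dist y z ≤ ρ} with hC
    have hdist : Continuous fun y : Pl => dist y z := by fun_prop
    have hCc : IsCompact C := by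
      apply Metric.isCompact_of_isClosed_isBounded
      · exact (isClosed_le continuous_const hdist).inter
          (isClosed_le hdist continuous_const)
      · exact (Metric.isBounded_closedBall (x := z) (r := ρ)).subset fun y hy => hy.2
    have hne : ∀ y, 0 < dist y z → y ≠ z := fun y hy => dist_pos.1 hy
    have hZC : ∀ y, 0 < dist y z → dist y z ≤ ρ → y ∉ Z := fun y h1 h2 =>
      hZ.notMem hz (hne y h1) (lt_of_le_of_lt h2 hρ)
    have hws : ∀ y, 0 < dist y z → dist y z ≤ ρ → ContDiffAt ℝ (⊤ : ℕ∞) w y := by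
      intro y h1 h2
      exact ((hu.sm y (hZC y h1 h2)).add contDiffAt_const).add
        (contDiffAt_const.mul (contDiffAt_const.sub (log_smooth (hne y h1))))
    obtain ⟨y1, hy1, hmin⟩ := hCc.exists_isMinOn ⟨y0, by constructor <;> linarith⟩
      (f := w) (fun y hy => (hws y (by linarith [hy.1]) hy.2).continuousAt.continuousWithinAt)
    have hw1 : w y1 < 0 := lt_of_le_of_lt (hmin ⟨by linarith, hy0ρ⟩) hneg
    have hd1 : 0 < dist y1 z := by linarith [hy1.1]
    have h1 : ρ' / 2 < dist y1 z := by
      by_contra h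
      push Not at h
      have := hsub' y1 (hne y1 hd1) (by linarith)
      linarith
    have hlogn : Real.log ‖y1 - z‖ ≤ Real.log ρ := by
      rw [← dist_eq_norm]; exact Real.log_le_log hd1 hy1.2
    have hcoef : 0 ≤ 2 * (max a 0 + κ) := by
      have := le_max_right a 0
      linarith
    have h2 : dist y1 z < ρ := by
      rcases hy1.2.lt_or_eq with h | h
      · exact h
      · have := hb y1 h
        have h3 : 0 ≤ 2 * (max a 0 + κ) * (Real.log ρ - Real.log ‖y1 - z‖) :=
          mul_nonneg hcoef (by linarith)
        simp only [hw] at hw1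
        linarith
    have hloc : IsLocalMin w y1 := by
      apply hmin.isLocalMin
      have hc : ContinuousAt (fun y => dist y z) y1 := by fun_prop
      filter_upwards [hc.eventually (lt_mem_nhds h1), hc.eventually (gt_mem_nhds h2)] with y h3 h4
        using ⟨h3.le, h4.le⟩
    have hlap := lap_min (hws y1 hd1 hy1.2).continuousAt hloc
    have hu1 := top_c2 (hu.sm y1 (hZC y1 hd1 hy1.2))
    have hl1 := top_c2 (log_smooth (hne y1 hd1))
    have hcalc : lap w y1 = lap u y1 := by
      simp only [hw]
      rw [lap_add (hu1.add contDiffAt_const) (contDiffAt_const.mul (contDiffAt_const.sub hl1)),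
        lap_add hu1 contDiffAt_const, lap_const, lap_const_mul _ (contDiffAt_const.sub hl1),
        lap_sub contDiffAt_const hl1, lap_const, lap_log (hne y1 hd1)]
      ring
    have hun : u y1 < 0 := by
      have h3 : 0 ≤ 2 * (max a 0 + κ) * (Real.log ρ - Real.log ‖y1 - z‖) :=
          mul_nonneg hcoef (by linarith)
      simp only [hw] at hw1
      linarith
    have := hu.pde y1 (hZC y1 hd1 hy1.2)
    have hpos := mul_pos hk (hF _ hun)
    linarith
  intro y hy hyρ
  have hd : 0 < ‖y - z‖ := norm_pos_iff.2 (sub_ne_zero.2 hy)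
  have hρpos : 0 < ρ := lt_of_lt_of_le (dist_pos.2 hy) hyρ
  rw [Real.log_div hρpos.ne' hd.ne']
  have hL : 0 ≤ Real.log ρ - Real.log ‖y - z‖ := by
    have : Real.log ‖y - z‖ ≤ Real.log ρ := by
      rw [dist_eq_norm] at hyρ; exact Real.log_le_log hd hyρ
    linarith
  set L := Real.log ρ - Real.log ‖y - z‖
  have hlim : Tendsto (fun κ : ℝ => u y + S + 2 * (max a 0 + κ) * L) (𝓝[>] 0)
      (𝓝 (u y + S + 2 * (max a 0 + 0) * L)) := by
    apply Tendsto.mono_left _ nhdsWithin_le_nhds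
    apply Continuous.tendsto; fun_prop
  have := ge_of_tendsto hlim (b := 0) (by
    filter_upwards [self_mem_nhdsWithin] with κ hκ using key κ hκ y hy hyρ)
  simp at this
  linarith

lemma decay {F : ℝ → ℝ} {k c η0 η ρ : ℝ} {u : Pl → ℝ} {x0 : Pl} (hk : 0 < k) (hc : 0 < c)
    (hF : ∀ t, 0 < t → t ≤ η0 → F t ≤ - c * t) (hη : 0 < η) (hη0 : η ≤ η0) (hρ : 0 < ρ)
    (hsm : ∀ x ∈ closedBall x0 ρ, ContDiffAt ℝ 2 u x)
    (hpde : ∀ x ∈ closedBall x0 ρ, lap u x = - (k * F (u x)))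
    (hb : ∀ x ∈ closedBall x0 ρ, u x ≤ η) : u x0 ≤ 4 * η / (k * c * ρ ^ 2) := by
  by_contra hcon
  push Not at hcon
  set κ := 4 * η / (k * c * ρ ^ 2) with hκ
  have hκpos : 0 < κ := by positivity
  set g : Pl → ℝ := fun x => u x - η / ρ ^ 2 * nsq x0 x with hg
  have hns : ∀ x, ContDiffAt ℝ 2 (nsq x0) x := fun x => top_c2 (nsq_smooth x0).contDiffAt
  have hgs : ∀ x ∈ closedBall x0 ρ, ContDiffAt ℝ 2 g x := fun x hx =>
    (hsm x hx).sub (contDiffAt_const.mul (hns x))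
  obtain ⟨x1, hx1, hmax⟩ := (isCompact_closedBall x0 ρ).exists_isMaxOn
    ⟨x0, by simp [hρ.le]⟩ (fun x hx => (hgs x hx).continuousAt.continuousWithinAt)
  have h0 : g x0 = u x0 := by simp [hg, nsq]
  have h1 : κ < g x1 := by
    have := hmax (show x0 ∈ closedBall x0 ρ by simp [hρ.le])
    simp only [mem_setOf_eq] at this
    linarith
  have hIntg : dist x1 x0 < ρ := by
    rcases (mem_closedBall.1 hx1).lt_or_eq with h | h
    · exact h
    · exfalso
      have h2 : nsq x0 x1 = ρ ^ 2 := by rw [nsq_eq, ← dist_eq_norm, h]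
      have h3 : g x1 = u x1 - η := by
        simp only [hg, h2]; field_simp
      have := hb x1 hx1
      linarith
  have hloc : IsLocalMax g x1 := hmax.isLocalMax (closedBall_mem_nhds_of_mem hIntg)
  have hlap := lap_max (hgs x1 hx1).continuousAt hloc
  have hcalc : lap g x1 = lap u x1 - η / ρ ^ 2 * 4 := by
    simp only [hg]
    rw [lap_sub (hsm x1 hx1) (contDiffAt_const.mul (hns x1)), lap_const_mul _ (hns x1), lap_nsq]
  have hn : 0 ≤ η / ρ ^ 2 * nsq x0 x1 := by rw [nsq_eq]; positivity
  have hu1 : κ < u x1 := by simp only [hg] at h1; linarith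
  have hFu := hF (u x1) (by linarith) (by linarith [hb x1 hx1])
  rw [hpde x1 hx1] at hcalc
  have h4 : k * F (u x1) ≤ k * (- c * u x1) := mul_le_mul_of_nonneg_left hFu hk.le
  have h5 : k * c * κ = η / ρ ^ 2 * 4 := by rw [hκ]; field_simp
  have h6 : k * c * κ < k * c * u x1 := mul_lt_mul_of_pos_left hu1 (by positivity)
  nlinarith

lemma deriv_nonneg_of_nonneg {h : ℝ → ℝ} {h' d : ℝ} (hd : 0 < d) (hder : HasDerivAt h h' 0)
    (h0 : h 0 = 0) (hpos : ∀ t, 0 < t → t ≤ d → 0 ≤ h t) : 0 ≤ h' := by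
  have h1 := hder.tendsto_slope_zero_right
  refine ge_of_tendsto h1 ?_
  filter_upwards [Ioc_mem_nhdsGT hd] with t ht
  simp only [zero_add, h0, sub_zero, smul_eq_mul]
  exact mul_nonneg (inv_nonneg.2 ht.1.le) (hpos t ht.1 ht.2)

/-- reflection -/
def refl' (x0 : Pl) (i : Fin 2) (x : Pl) : Pl := x - (2 * (x i - x0 i)) • ee i

lemma refl_smooth (x0 : Pl) (i : Fin 2) : ContDiff ℝ (⊤ : ℕ∞) (refl' x0 i) := by
  unfold refl'
  exact contDiff_id.sub ((contDiff_const.mul (diff_coord i _)).smul contDiff_const)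

lemma ee_apply (i j : Fin 2) : (ee i) j = if j = i then 1 else 0 := by
  simp [ee, PiLp.single_apply]

lemma pd_refl_same (f : Pl → ℝ) (x0 : Pl) (i : Fin 2) (x : Pl) :
    pd (fun y => f (refl' x0 i y)) i x = - pd f i (refl' x0 i x) := by
  unfold pd lineDeriv
  have : (fun t : ℝ => f (refl' x0 i (x + t • ee i))) =
      fun t : ℝ => (fun s : ℝ => f (refl' x0 i x + s • ee i)) (- t) := by
    funext t
    simp only [refl']
    congr 1
    have : (x + t • ee i) i = x i + t := by simp [ee_apply]
    rw [this]; module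
  change deriv (fun t : ℝ => f (refl' x0 i (x + t • ee i))) 0 = _
  rw [this]
  have h := deriv_comp_neg (fun s : ℝ => f (refl' x0 i x + s • ee i)) 0
  rw [h]; simp

lemma pd_refl_other (f : Pl → ℝ) (x0 : Pl) {i j : Fin 2} (hij : i ≠ j) (x : Pl) :
    pd (fun y => f (refl' x0 i y)) j x = pd f j (refl' x0 i x) := by
  unfold pd lineDeriv
  congr 1
  funext t
  simp only [refl']
  congr 1
  have : (x + t • EuclideanSpace.single j (1:ℝ)) i = x i := by
    have := ee_apply j i
    simp [ee] at this
    simp [this, hij]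
  rw [this]; abel

lemma lap_ij (f : Pl → ℝ) {i j : Fin 2} (hij : i ≠ j) (x : Pl) :
    lap f x = pd (pd f i) i x + pd (pd f j) j x := by
  unfold lap
  fin_cases i <;> fin_cases j <;> simp at hij ⊢
  ring

lemma lap_refl (f : Pl → ℝ) (x0 : Pl) {i j : Fin 2} (hij : i ≠ j) (x : Pl) :
    lap (fun y => f (refl' x0 i y)) x = lap f (refl' x0 i x) := by
  rw [lap_ij _ hij, lap_ij _ hij]
  have h1 : pd (fun y => f (refl' x0 i y)) i = fun y => - pd f i (refl' x0 i y) :=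
    funext fun y => pd_refl_same f x0 i y
  have h2 : pd (fun y => f (refl' x0 i y)) j = fun y => pd f j (refl' x0 i y) :=
    funext fun y => pd_refl_other f x0 hij y
  rw [h1, h2, pd_neg, pd_refl_same (pd f i), pd_refl_other (pd f j) x0 hij, neg_neg]

lemma nsq_ij (z x : Pl) {i j : Fin 2} (hij : i ≠ j) :
    nsq z x = (x i - z i) ^ 2 + (x j - z j) ^ 2 := by
  unfold nsq
  fin_cases i <;> fin_cases j <;> simp at hij ⊢
  ring

lemma grad_upper {u : Pl → ℝ} {x0 : Pl} {d M N : ℝ} {i j : Fin 2} (hij : i ≠ j) (hd : 0 < d)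
    (hM : 0 ≤ M) (hsm : ∀ x ∈ closedBall x0 (2 * d), ContDiffAt ℝ 2 u x)
    (hub : ∀ x ∈ closedBall x0 (2 * d), |u x| ≤ M)
    (hlap : ∀ x ∈ closedBall x0 (2 * d), |lap u x| < N) :
    pd u i x0 ≤ 2 * M / d + N * d / 2 := by
  have hN : 0 < N := lt_of_le_of_lt (abs_nonneg _) (hlap x0 (by simp [hd.le]))
  set D : Set Pl := {x | |x j - x0 j| ≤ d ∧ 0 ≤ x i - x0 i ∧ x i - x0 i ≤ d} with hD
  have hci : ∀ i : Fin 2, Continuous fun x : Pl => x i - x0 i := fun i => (diff_coord i _).continuous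
  have hsq : ∀ x : Pl, |x j - x0 j| ≤ d → |x i - x0 i| ≤ d → x ∈ closedBall x0 (2 * d) := by
    intro x h1 h2
    rw [mem_closedBall, dist_eq_norm]
    refine (sq_le_sq₀ (norm_nonneg _) (by positivity)).1 ?_
    rw [← nsq_eq, nsq_ij _ _ hij]
    have := sq_le_sq' (by linarith [neg_abs_le (x j - x0 j)]) ((le_abs_self _).trans h1)
    have := sq_le_sq' (by linarith [neg_abs_le (x i - x0 i)]) ((le_abs_self _).trans h2)
    nlinarith
  have hDb : ∀ x ∈ D, x ∈ closedBall x0 (2 * d) := fun x hx => hsq x hx.1 (by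
    rw [abs_of_nonneg hx.2.1]; exact hx.2.2)
  have hrefli : ∀ x, refl' x0 i x i - x0 i = - (x i - x0 i) := by
    intro x; simp [refl', ee_apply]; ring
  have hreflj : ∀ x, refl' x0 i x j = x j := by
    intro x; simp [refl', ee_apply, hij.symm]
  have hDr : ∀ x ∈ D, refl' x0 i x ∈ closedBall x0 (2 * d) := fun x hx => by
    apply hsq
    · rw [hreflj]; exact hx.1
    · rw [hrefli, abs_neg, abs_of_nonneg hx.2.1]; exact hx.2.2
  have hDc : IsCompact D := by
    apply Metric.isCompact_of_isClosed_isBounded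
    · exact (isClosed_le (hci j).abs continuous_const).inter
        ((isClosed_le continuous_const (hci i)).inter (isClosed_le (hci i) continuous_const))
    · exact isBounded_closedBall.subset hDb
  -- barrier
  set ψ : Pl → ℝ := fun x => (M / d ^ 2) * nsq x0 x + (- (2 * M / d ^ 2 + N / 2)) *
      ((x i - x0 i) * (x i - x0 i)) + (2 * M / d + N * d / 2) * (x i - x0 i) with hψ
  have hψs : ∀ x, ContDiffAt ℝ 2 ψ x := fun x => by
    have h1 := diff_coord i (x0 i)
    have : ContDiff ℝ (⊤ : ℕ∞) ψ := ((contDiff_const.mul (nsq_smooth x0)).add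
      (contDiff_const.mul (h1.mul h1))).add (contDiff_const.mul h1)
    exact top_c2 this.contDiffAt
  have hψl : ∀ x, lap ψ x = - N := by
    intro x
    have h1 : ContDiffAt ℝ 2 (fun y : Pl => y i - x0 i) x := top_c2 (diff_coord i (x0 i)).contDiffAt
    have h2 : ContDiffAt ℝ 2 (nsq x0) x := top_c2 (nsq_smooth x0).contDiffAt
    have hl : lap (fun y : Pl => y i - x0 i) x = 0 := by
      have h : ∀ l, pd (fun y : Pl => y i - x0 i) l = fun _ => if l = i then 1 else 0 :=
        fun l => funext fun y => pd_coord l i y _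
      unfold lap
      rw [h, h, pd_const, pd_const]; ring
    simp only [hψ]
    rw [lap_add ((contDiffAt_const.mul h2).add (contDiffAt_const.mul (h1.mul h1)))
      (contDiffAt_const.mul h1), lap_add (contDiffAt_const.mul h2) (contDiffAt_const.mul (h1.mul h1)),
      lap_const_mul _ h1, lap_const_mul _ h2, lap_const_mul _ (h1.mul h1), lap_mul h1 h1, hl, lap_nsq,
      pd_coord, pd_coord]
    have : ((if (0:Fin 2) = i then (1:ℝ) else 0) * (if (0:Fin 2) = i then (1:ℝ) else 0) +
      (if (1:Fin 2) = i then (1:ℝ) else 0) * (if (1:Fin 2) = i then (1:ℝ) else 0)) = 1 := by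
      fin_cases i <;> simp
    rw [this]; ring
  set φ : Pl → ℝ := fun x => (1/2) * (u x - u (refl' x0 i x)) with hφ
  have hur : ∀ x ∈ D, ContDiffAt ℝ 2 (fun y => u (refl' x0 i y)) x := fun x hx =>
    ContDiffAt.comp x (hsm _ (hDr x hx)) (contDiff_infty.1 (refl_smooth x0 i) 2).contDiffAt
  have hφs : ∀ x ∈ D, ContDiffAt ℝ 2 φ x := fun x hx =>
    contDiffAt_const.mul ((hsm x (hDb x hx)).sub (hur x hx))
  have hφl : ∀ x ∈ D, - N < lap φ x := by
    intro x hx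
    simp only [hφ]
    rw [lap_const_mul _ ((hsm x (hDb x hx)).sub (hur x hx)), lap_sub (hsm x (hDb x hx)) (hur x hx),
      lap_refl u x0 hij]
    have h1 := abs_lt.1 (hlap x (hDb x hx))
    have h2 := abs_lt.1 (hlap _ (hDr x hx))
    linarith
  have hcomp : ∀ x ∈ D, φ x ≤ ψ x := by
    intro y hy
    have hgs : ∀ x ∈ D, ContDiffAt ℝ 2 (fun x => φ x - ψ x) x := fun x hx => (hφs x hx).sub (hψs x)
    obtain ⟨x1, hx1, hmax⟩ := hDc.exists_isMaxOn ⟨y, hy⟩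
      (fun x hx => (hgs x hx).continuousAt.continuousWithinAt)
    suffices h : φ x1 - ψ x1 ≤ 0 by
      have := hmax hy
      simp only [mem_setOf_eq] at this
      linarith
    by_contra hpos
    push Not at hpos
    have hφM : φ x1 ≤ M := by
      have h1 := abs_le.1 (hub x1 (hDb x1 hx1))
      have h2 := abs_le.1 (hub _ (hDr x1 hx1))
      simp only [hφ]; linarith
    obtain ⟨hxj, hxi0, hxi1⟩ := hx1
    set X := x1 i - x0 i with hX
    set Y := x1 j - x0 j with hY
    have hψe : ψ x1 = (M / d ^ 2) * (Y ^ 2 + X * (2 * d - X)) + N / 2 * (X * (d - X)) := by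
      simp only [hψ]
      rw [nsq_ij _ _ hij, ← hX, ← hY]
      field_simp; ring
    have hnn : 0 ≤ N / 2 * (X * (d - X)) :=
      mul_nonneg (by positivity) (mul_nonneg hxi0 (by linarith))
    have hMd : 0 ≤ M / d ^ 2 := by positivity
    have hbig : d ^ 2 ≤ Y ^ 2 + X * (2 * d - X) → False := by
      intro h
      have h1 : M / d ^ 2 * d ^ 2 ≤ (M / d ^ 2) * (Y ^ 2 + X * (2 * d - X)) :=
        mul_le_mul_of_nonneg_left h hMd
      have h2 : M / d ^ 2 * d ^ 2 = M := by field_simp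
      linarith
    have i1 : 0 < X := by
      rcases hxi0.lt_or_eq with h | h
      · exact h
      · exfalso
        have : refl' x0 i x1 = x1 := by simp [refl', ← hX, ← h]
        have h2 : φ x1 = 0 := by simp [hφ, this]
        have h3 : 0 ≤ ψ x1 := by
          rw [hψe, ← h]
          simp; positivity
        linarith
    have i2 : X < d := by
      rcases hxi1.lt_or_eq with h | h
      · exact h
      · exfalso
        apply hbig
        rw [h]; nlinarith [sq_nonneg Y]
    have i3 : |Y| < d := by
      rcases hxj.lt_or_eq with h | h
      · exact h
      · exfalso
        apply hbig
        rw [← sq_abs Y, h]; nlinarith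
    have hloc : IsLocalMax (fun x => φ x - ψ x) x1 := by
      apply hmax.isLocalMax
      have c1 : ContinuousAt (fun x : Pl => x i - x0 i) x1 := (hci i).continuousAt
      have c2 : ContinuousAt (fun x : Pl => |x j - x0 j|) x1 := (hci j).abs.continuousAt
      filter_upwards [c1.eventually (lt_mem_nhds i1), c1.eventually (gt_mem_nhds i2),
        c2.eventually (gt_mem_nhds i3)] with y h3 h4 h5 using ⟨h5.le, h3.le, h4.le⟩
    have hx1D : x1 ∈ D := ⟨hxj, hxi0, hxi1⟩
    have h1 := lap_max (hgs x1 hx1D).continuousAt hloc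
    rw [lap_sub (hφs x1 hx1D) (hψs x1), hψl] at h1
    have := hφl x1 hx1D
    linarith
  -- derivative at the centre
  have hul : HasDerivAt (fun t : ℝ => u (x0 + t • ee i)) (pd u i x0) 0 :=
    ((d1 (hsm x0 (by simp [hd.le]))).lineDifferentiableAt (v := ee i)).hasLineDerivAt
  have hur' : HasDerivAt (fun t : ℝ => u (x0 + (-t) • ee i)) (- pd u i x0) 0 := by
    have h0 : HasDerivAt (fun t : ℝ => u (x0 + t • ee i)) (pd u i x0) (-0) := by simpa using hul
    have := h0.scomp (0:ℝ) (hasDerivAt_neg (0:ℝ))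
    simpa [Function.comp_def] using this
  have hψd : HasDerivAt (fun t : ℝ => (2 * M / d + N * d / 2) * t - (M / d ^ 2 + N / 2) * t ^ 2)
      (2 * M / d + N * d / 2) 0 := by
    have h1 := ((hasDerivAt_id (0:ℝ)).const_mul (2 * M / d + N * d / 2)).fun_sub
      ((hasDerivAt_pow 2 (0:ℝ)).const_mul (M / d ^ 2 + N / 2))
    refine h1.congr_deriv ?_
    simp
  have := deriv_nonneg_of_nonneg hd (hψd.sub ((hul.sub hur').const_mul (1/2))) (by simp) (by
    intro t ht htd
    have hti : (x0 + t • ee i) i - x0 i = t := by simp [ee_apply]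
    have htj : (x0 + t • ee i) j - x0 j = 0 := by simp [ee_apply, hij.symm]
    have hx : x0 + t • ee i ∈ D := by
      refine ⟨?_, ?_, ?_⟩
      · rw [htj]; simp [hd.le]
      · rw [hti]; exact ht.le
      · rw [hti]; exact htd
    have h1 := hcomp _ hx
    have h2 : refl' x0 i (x0 + t • ee i) = x0 + (-t) • ee i := by
      simp only [refl', hti]; module
    simp only [hφ, hψ, h2] at h1
    rw [nsq_ij _ _ hij, htj, hti] at h1
    simp only [Pi.sub_apply]
    have e : M / d ^ 2 * (t ^ 2 + 0 ^ 2) + -(2 * M / d ^ 2 + N / 2) * (t * t) =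
      - (M / d ^ 2 + N / 2) * t ^ 2 := by ring
    linarith)
  linarith

lemma grad_bound {u : Pl → ℝ} {x0 : Pl} {d M N : ℝ} (i : Fin 2) (hd : 0 < d)
    (hM : 0 ≤ M) (hsm : ∀ x ∈ closedBall x0 (2 * d), ContDiffAt ℝ 2 u x)
    (hub : ∀ x ∈ closedBall x0 (2 * d), |u x| ≤ M)
    (hlap : ∀ x ∈ closedBall x0 (2 * d), |lap u x| < N) :
    |pd u i x0| ≤ 2 * M / d + N * d / 2 := by
  obtain ⟨j, hij⟩ : ∃ j, i ≠ j := ⟨i + 1, by fin_cases i <;> simp⟩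
  rw [abs_le]
  constructor
  · have := grad_upper (u := fun y => - u y) hij hd hM (fun x hx => (hsm x hx).neg)
      (fun x hx => by rw [abs_neg]; exact hub x hx)
      (fun x hx => by rw [lap_neg, abs_neg]; exact hlap x hx)
    rw [pd_neg] at this
    linarith
  · exact grad_upper hij hd hM hsm hub hlap

/-! ### Integration by parts and the mean value inequality -/

lemma ibp {f g : Pl → ℝ} (i : Fin 2) (hf : Differentiable ℝ f) (hg : Differentiable ℝ g)
    (cf : Continuous (pd f i)) (cg : Continuous (pd g i)) (hs : HasCompactSupport f) :
    ∫ x, f x * pd g i x = - ∫ x, pd f i x * g x := by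
  have e1 : pd f i = fun x => fderiv ℝ f x (ee i) := funext fun x => pd_eq_fderiv (hf x) i
  have e2 : pd g i = fun x => fderiv ℝ g x (ee i) := funext fun x => pd_eq_fderiv (hg x) i
  have hs' : HasCompactSupport (pd f i) := by
    rw [e1]
    exact (hs.fderiv (𝕜 := ℝ)).comp_left (g := fun L : Pl →L[ℝ] ℝ => L (ee i)) (by simp)
  have i1 : Integrable (fun x => pd f i x * g x) :=
    (cf.mul hg.continuous).integrable_of_hasCompactSupport hs'.mul_right
  have i2 : Integrable (fun x => f x * pd g i x) :=
    (hf.continuous.mul cg).integrable_of_hasCompactSupport hs.mul_right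
  have i3 : Integrable (fun x => f x * g x) :=
    (hf.continuous.mul hg.continuous).integrable_of_hasCompactSupport hs.mul_right
  rw [e1] at i1 ⊢
  rw [e2] at i2 ⊢
  exact integral_mul_fderiv_eq_neg_fderiv_mul_of_integrable i1 i2 i3 (fun x _ => hf x)
    (fun x _ => hg x)

lemma hasDerivAt_mp (n : ℕ) (t : ℝ) :
    HasDerivAt (fun s : ℝ => (max s 0) ^ (n + 2)) ((n + 2 : ℕ) * (max t 0) ^ (n + 1)) t := by
  rcases lt_trichotomy t 0 with h | h | h
  · have h1 : HasDerivAt (fun _ : ℝ => (0:ℝ)) 0 t := hasDerivAt_const _ _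
    refine (h1.congr_of_eventuallyEq ?_).congr_deriv ?_
    · filter_upwards [gt_mem_nhds h] with s hs
      rw [max_eq_right hs.le]; simp
    · rw [max_eq_right h.le]; simp
  · subst h
    simp only [max_self]
    rw [hasDerivAt_iff_isLittleO]
    simp only [max_self, sub_zero, ne_eq, Nat.add_eq_zero_iff, OfNat.ofNat_ne_zero, and_false,
      not_false_eq_true, zero_pow, one_ne_zero, mul_zero, smul_zero]
    have h2 : (fun x : ℝ => x ^ (n + 2)) =o[𝓝 0] fun x => x := by
      simpa using (Asymptotics.isLittleO_pow_pow (𝕜 := ℝ) (m := 1) (n := n + 2) (by omega))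
    refine Asymptotics.IsBigO.trans_isLittleO ?_ h2
    refine Asymptotics.IsBigO.of_bound 1 (Eventually.of_forall fun x => ?_)
    rw [norm_pow, norm_pow, one_mul]
    apply pow_le_pow_left₀ (norm_nonneg _)
    rw [Real.norm_eq_abs, Real.norm_eq_abs, abs_of_nonneg (le_max_right _ _)]
    exact max_le (le_abs_self _) (abs_nonneg _)
  · have h1 := hasDerivAt_pow (n + 2) t
    refine (h1.congr_of_eventuallyEq ?_).congr_deriv ?_
    · filter_upwards [lt_mem_nhds h] with s hs
      rw [max_eq_left hs.le]
    · rw [max_eq_left h.le]; simp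

/-- The averaging kernel and its potential. -/
def kK (y : Pl) : ℝ := (max (1 - nsq 0 y) 0) ^ 3
def kk (y : Pl) : ℝ := (max (1 - nsq 0 y) 0) ^ 2

lemma kk_cont : Continuous kk := by
  have := (nsq_smooth 0).continuous
  unfold kk; fun_prop

lemma kK_cont : Continuous kK := by
  have := (nsq_smooth 0).continuous
  unfold kK; fun_prop

lemma nsq_zero (y : Pl) : nsq 0 y = ‖y‖ ^ 2 := by rw [nsq_eq, sub_zero]

lemma kk_zero {y : Pl} (h : 1 ≤ ‖y‖) : max (1 - nsq 0 y) 0 = 0 := by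
  rw [nsq_zero]; apply max_eq_right; nlinarith

lemma kk_supp : HasCompactSupport kk := by
  refine HasCompactSupport.of_support_subset_isCompact (isCompact_closedBall (0:Pl) 1) ?_
  intro y hy
  by_contra h
  rw [mem_closedBall_zero_iff, not_le] at h
  exact hy (by simp [kk, kk_zero h.le])

lemma kK_supp : HasCompactSupport kK := by
  refine HasCompactSupport.of_support_subset_isCompact (isCompact_closedBall (0:Pl) 1) ?_
  intro y hy
  by_contra h
  rw [mem_closedBall_zero_iff, not_le] at h
  exact hy (by simp [kK, kk_zero h.le])

lemma kk_nonneg (y : Pl) : 0 ≤ kk y := by unfold kk; positivity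
lemma kK_nonneg (y : Pl) : 0 ≤ kK y := by unfold kK; positivity
lemma kk_le (y : Pl) : kk y ≤ 1 := by
  unfold kk
  apply pow_le_one₀ (le_max_right _ _)
  rw [nsq_zero]
  exact max_le (by nlinarith [norm_nonneg y]) zero_le_one

lemma kk_int_pos : 0 < ∫ y, kk y := by
  refine kk_cont.integral_pos_of_hasCompactSupport_nonneg_nonzero kk_supp kk_nonneg (x := 0) ?_
  simp [kk, nsq]

lemma kK_diff : Differentiable ℝ kK := by
  intro y
  have h1 := hasDerivAt_mp 1 (1 - nsq 0 y)
  exact h1.differentiableAt.comp y ((differentiableAt_const _).sub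
    ((nsq_smooth 0).differentiable (by simp) y))

lemma pd_kK (y : Pl) (i : Fin 2) : pd kK i y = - 6 * y i * kk y := by
  have hd : DifferentiableAt ℝ (nsq 0) y := (nsq_smooth 0).differentiable (by simp) y
  have h1 := hasDerivAt_mp 1 (1 - nsq 0 y)
  have := pd_comp (f := fun y => 1 - nsq 0 y) h1 ((differentiableAt_const _).sub hd) i
  have e : pd (fun y => 1 - nsq 0 y) i y = - (2 * y i) := by
    rw [pd_sub (differentiableAt_const _) hd, pd_const, pd_nsq]; simp
  rw [e] at this
  unfold kK
  rw [this]
  simp only [kk]; push_cast; ring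

lemma mean_value {G : Pl → ℝ} (hG : ContDiff ℝ 2 G) {x0 : Pl} {r : ℝ} (hr : 0 < r)
    (hl : ∀ x ∈ ball x0 r, 0 ≤ lap G x) :
    G x0 * ∫ y, kk y ≤ ∫ y, G (x0 + r • y) * kk y := by
  have hGd : Differentiable ℝ G := hG.differentiable (by simp)
  have hpd : ∀ i, Continuous (pd G i) := fun i => continuous_iff_continuousAt.2 fun x =>
    ((hG.contDiffAt (x := x)).pd' (m := 1) (by norm_num) i).continuousAt
  have hpd1 : ∀ i, ContDiff ℝ 1 (pd G i) := fun i => contDiff_iff_contDiffAt.2 fun x =>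
    (hG.contDiffAt (x := x)).pd' (m := 1) (by norm_num) i
  have hfd : Continuous (fderiv ℝ G) := hG.continuous_fderiv (by simp)
  set M : ℝ → ℝ := fun s => ∫ y, G (x0 + s • y) * kk y with hM
  set M' : ℝ → ℝ := fun s => ∫ y, fderiv ℝ G (x0 + s • y) y * kk y with hM'
  have hder : ∀ s, HasDerivAt M (M' s) s := by
    intro s
    obtain ⟨C, hC⟩ := (isCompact_closedBall x0 (|s| + 1)).exists_bound_of_continuousOn
      hfd.continuousOn
    refine (hasDerivAt_integral_of_dominated_loc_of_deriv_le (bound := fun y => C * kk y)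
      (F' := fun s y => fderiv ℝ G (x0 + s • y) y * kk y)
      (ball_mem_nhds s one_pos) ?_ ?_ ?_ ?_ ?_ ?_).2
    · refine Eventually.of_forall fun t => Continuous.aestronglyMeasurable ?_
      have := hG.continuous; have := kk_cont; fun_prop
    · have h1 := hG.continuous; have h2 := kk_cont
      have : Continuous fun y => G (x0 + s • y) * kk y := by fun_prop
      exact this.integrable_of_hasCompactSupport kk_supp.mul_left
    · refine Continuous.aestronglyMeasurable ?_
      have := kk_cont; fun_prop
    · refine Eventually.of_forall fun y t ht => ?_
      rw [norm_mul, Real.norm_of_nonneg (kk_nonneg y)]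
      rcases le_or_gt 1 ‖y‖ with h | h
      · simp [kk, kk_zero h]
      · refine mul_le_mul_of_nonneg_right ?_ (kk_nonneg y)
        have h1 := hC (x0 + t • y) (by
          rw [mem_closedBall, dist_eq_norm, add_sub_cancel_left, norm_smul, Real.norm_eq_abs]
          have : |t| ≤ |s| + 1 := by
            have := mem_ball.1 ht
            rw [Real.dist_eq] at this
            have h3 : |t| ≤ |t - s| + |s| := by simpa using abs_add_le (t - s) s
            linarith
          nlinarith [abs_nonneg t, norm_nonneg y])
        calc _ ≤ ‖fderiv ℝ G (x0 + t • y)‖ * ‖y‖ := ContinuousLinearMap.le_opNorm _ _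
          _ ≤ C * 1 := mul_le_mul h1 h.le (norm_nonneg _) ((norm_nonneg _).trans h1)
          _ = C := mul_one _
    · exact (kk_cont.integrable_of_hasCompactSupport kk_supp).const_mul C
    · refine Eventually.of_forall fun y t _ => ?_
      have h1 : HasDerivAt (fun t : ℝ => x0 + t • y) y t := by
        simpa using ((hasDerivAt_id t).smul_const y).const_add x0
      exact ((hGd _).hasFDerivAt.comp_hasDerivAt t h1).mul_const _
  have hM'nn : ∀ s ∈ Ioo 0 r, 0 ≤ M' s := by
    intro s hs
    have hH : ∀ i, ContDiff ℝ 1 fun y : Pl => pd G i (x0 + s • y) := fun i =>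
      (hpd1 i).comp (contDiff_const.add (contDiff_const_smul s))
    have hpH : ∀ i y, pd (fun y : Pl => pd G i (x0 + s • y)) i y =
        s * pd (pd G i) i (x0 + s • y) := by
      intro i y
      have h1 : HasFDerivAt (fun y : Pl => x0 + s • y) (s • ContinuousLinearMap.id ℝ Pl) y :=
        ((hasFDerivAt_id y).const_smul s).const_add x0
      have h2 := ((hpd1 i).differentiable (by simp) (x0 + s • y)).hasFDerivAt.comp y h1
      have h3 : HasFDerivAt (fun y : Pl => pd G i (x0 + s • y)) _ y := h2
      rw [pd_eq_fderiv h3.differentiableAt, h3.fderiv,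
        pd_eq_fderiv ((hpd1 i).differentiable (by simp) (x0 + s • y))]
      simp
    have hcpH : ∀ i, Continuous (pd (fun y : Pl => pd G i (x0 + s • y)) i) := fun i =>
      continuous_iff_continuousAt.2 fun x =>
        (((hH i).contDiffAt (x := x)).pd' (m := 0) (by norm_num) i).continuousAt
    have hcpk : ∀ i, Continuous (pd kK i) := by
      intro i
      have : pd kK i = fun y => - 6 * y i * kk y := funext fun y => pd_kK y i
      rw [this]
      have := kk_cont; fun_prop
    have hI : ∀ i, ∫ y, kK y * (s * pd (pd G i) i (x0 + s • y)) =
        6 * ∫ y, y i * pd G i (x0 + s • y) * kk y := by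
      intro i
      have := ibp i kK_diff ((hH i).differentiable (by simp)) (hcpk i) (hcpH i) kK_supp
      simp only [hpH, pd_kK] at this
      rw [this, ← integral_neg, ← integral_const_mul]
      congr 1; ext y; ring
    have hIntg : ∀ i, Integrable fun y : Pl => y i * pd G i (x0 + s • y) * kk y := by
      intro i
      have h1 := kk_cont
      have h2 := hpd i
      have : Continuous fun y : Pl => y i * pd G i (x0 + s • y) * kk y := by fun_prop
      exact this.integrable_of_hasCompactSupport kk_supp.mul_left
    have hMprs : M' s = (∫ y, y 0 * pd G 0 (x0 + s • y) * kk y) +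
        ∫ y, y 1 * pd G 1 (x0 + s • y) * kk y := by
      rw [← integral_add (hIntg 0) (hIntg 1)]
      simp only [hM']
      congr 1; ext y
      have hy : y = y 0 • ee 0 + y 1 • ee 1 := by
        ext j; fin_cases j <;> simp
      rw [pd_eq_fderiv (hGd _), pd_eq_fderiv (hGd _)]
      have : fderiv ℝ G (x0 + s • y) y = fderiv ℝ G (x0 + s • y) (y 0 • ee 0 + y 1 • ee 1) := by
        rw [← hy]
      rw [this, map_add, map_smul, map_smul, smul_eq_mul, smul_eq_mul]
      ring
    have hIntg2 : ∀ i, Integrable fun y : Pl => kK y * (s * pd (pd G i) i (x0 + s • y)) := by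
      intro i
      have h1 := kK_cont
      have h2 := hcpH i
      have h3 : pd (fun y : Pl => pd G i (x0 + s • y)) i =
        fun y => s * pd (pd G i) i (x0 + s • y) := funext (hpH i)
      rw [h3] at h2
      exact (h1.mul h2).integrable_of_hasCompactSupport kK_supp.mul_right
    have h6 : 6 * M' s = ∫ y, (kK y * (s * pd (pd G 0) 0 (x0 + s • y)) +
        kK y * (s * pd (pd G 1) 1 (x0 + s • y))) := by
      rw [integral_add (hIntg2 0) (hIntg2 1), hI, hI, hMprs]; ring
    have h7 : 0 ≤ ∫ y, (kK y * (s * pd (pd G 0) 0 (x0 + s • y)) +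
        kK y * (s * pd (pd G 1) 1 (x0 + s • y))) := by
      apply integral_nonneg
      intro y
      show (0:ℝ) ≤ _
      rcases le_or_gt 1 ‖y‖ with h | h
      · simp [kK, kk_zero h]
      · have h1 := hl (x0 + s • y) (by
          rw [mem_ball, dist_eq_norm, add_sub_cancel_left, norm_smul, Real.norm_eq_abs,
            abs_of_pos hs.1]
          nlinarith [hs.1, hs.2, norm_nonneg y])
        unfold lap at h1
        have := mul_nonneg (mul_nonneg (kK_nonneg y) hs.1.le) h1
        linarith
    linarith
  have hmono : MonotoneOn M (Icc 0 r) := by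
    apply monotoneOn_of_deriv_nonneg (convex_Icc 0 r)
    · exact fun s _ => (hder s).continuousAt.continuousWithinAt
    · exact fun s _ => (hder s).differentiableAt.differentiableWithinAt
    · intro s hs
      rw [interior_Icc] at hs
      rw [(hder s).deriv]
      exact hM'nn s hs
  have := hmono ⟨le_refl _, hr.le⟩ ⟨hr.le, le_refl _⟩ hr.le
  simpa [hM, integral_const_mul] using this

lemma mean_value_local {g : Pl → ℝ} {x0 : Pl} {r : ℝ} (hr : 0 < r)
    (hg : ∀ x ∈ closedBall x0 (2 * r), ContDiffAt ℝ 2 g x)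
    (hl : ∀ x ∈ ball x0 r, 0 ≤ lap g x) :
    g x0 * ∫ y, kk y ≤ ∫ y, g (x0 + r • y) * kk y := by
  let χ : ContDiffBump x0 := ⟨r, 2 * r, hr, by linarith⟩
  set G : Pl → ℝ := fun x => χ x * g x with hGdef
  have hG : ContDiff ℝ 2 G := by
    rw [contDiff_iff_contDiffAt]
    intro x
    by_cases hx : x ∈ closedBall x0 (2 * r)
    · exact (χ.contDiff (n := 2)).contDiffAt.mul (hg x hx)
    · have h1 : ContDiffAt ℝ 2 (fun _ : Pl => (0:ℝ)) x := contDiffAt_const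
      refine h1.congr_of_eventuallyEq ?_
      filter_upwards [isClosed_closedBall.isOpen_compl.mem_nhds hx] with y hy
      have : χ y = 0 := χ.zero_of_le_dist (by
        have : ¬ dist y x0 ≤ 2 * r := hy
        exact (not_le.1 this).le)
      simp [hGdef, this]
  have hGe : ∀ x ∈ closedBall x0 r, G x = g x := by
    intro x hx
    have : χ x = 1 := χ.one_of_mem_closedBall hx
    simp [hGdef, this]
  have h := mean_value hG (x0 := x0) hr (by
    intro x hx
    have : G =ᶠ[𝓝 x] g := by
      filter_upwards [isOpen_ball.mem_nhds hx] with y hy using hGe y (ball_subset_closedBall hy)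
    rw [lap_congr this]
    exact hl x hx)
  rw [hGe x0 (by simp [hr.le])] at h
  refine h.trans (le_of_eq ?_)
  congr 1; ext y
  rcases le_or_gt 1 ‖y‖ with h | h
  · simp [kk, kk_zero h]
  · rw [hGe]
    rw [mem_closedBall, dist_eq_norm, add_sub_cancel_left, norm_smul, Real.norm_eq_abs,
      abs_of_pos hr]
    nlinarith

/-- The cube of the negative part. -/
def ng (t : ℝ) : ℝ := (max (-t) 0) ^ 3

lemma ng_deriv (t : ℝ) : HasDerivAt ng (-(3 * (max (-t) 0) ^ 2)) t := by
  have := (hasDerivAt_mp 1 (-t)).scomp t (hasDerivAt_neg t)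
  refine (show HasDerivAt ng _ t from this).congr_deriv ?_
  simp

lemma ng_deriv2 (t : ℝ) : HasDerivAt (fun t : ℝ => -(3 * (max (-t) 0) ^ 2)) (6 * max (-t) 0) t := by
  have := ((hasDerivAt_mp 0 (-t)).scomp t (hasDerivAt_neg t)).const_mul (-3)
  refine (this.congr_of_eventuallyEq ?_).congr_deriv ?_
  · filter_upwards with s
    simp
  · simp; ring

lemma ng_c2 : ContDiff ℝ 2 ng := by
  have e1 : deriv ng = fun t => -(3 * (max (-t) 0) ^ 2) := funext fun t => (ng_deriv t).deriv
  have e2 : deriv (fun t : ℝ => -(3 * (max (-t) 0) ^ 2)) = fun t => 6 * max (-t) 0 :=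
    funext fun t => (ng_deriv2 t).deriv
  rw [show (2 : WithTop ℕ∞) = 1 + 1 by norm_num, contDiff_succ_iff_deriv]
  refine ⟨fun t => (ng_deriv t).differentiableAt, by simp, ?_⟩
  rw [e1, contDiff_one_iff_deriv]
  refine ⟨fun t => (ng_deriv2 t).differentiableAt, ?_⟩
  rw [e2]; fun_prop

lemma ng_nonneg (t : ℝ) : 0 ≤ ng t := by unfold ng; positivity

lemma ng_le {t S : ℝ} (hS : 0 ≤ S) (h : -S ≤ t) : ng t ≤ S ^ 3 := by
  unfold ng
  exact pow_le_pow_left₀ (le_max_right _ _) (max_le (by linarith) hS) 3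

lemma mv_neg {u : Pl → ℝ} {x0 : Pl} {r : ℝ} (hr : 0 < r)
    (hu : ∀ x ∈ closedBall x0 (2 * r), ContDiffAt ℝ 2 u x)
    (hl : ∀ x ∈ ball x0 r, u x < 0 → lap u x ≤ 0) :
    ng (u x0) * ∫ y, kk y ≤ ∫ y, ng (u (x0 + r • y)) * kk y := by
  refine mean_value_local (g := fun x => ng (u x)) hr
    (fun x hx => ng_c2.contDiffAt.comp x (hu x hx)) ?_
  intro x hx
  have hx2 : x ∈ closedBall x0 (2 * r) := by
    rw [mem_closedBall]; have := mem_ball.1 hx; linarith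
  rw [lap_comp ng_deriv (ng_deriv2 _) (hu x hx2)]
  rcases lt_or_ge (u x) 0 with h | h
  · have := hl x hx h
    have h1 : 0 ≤ max (-u x) 0 := le_max_right _ _
    have h3 : 0 ≤ (max (-u x) 0) ^ 2 * (- lap u x) := mul_nonneg (by positivity) (by linarith)
    have h4 : 0 ≤ max (-u x) 0 * ((pd u 0 x) ^ 2 + (pd u 1 x) ^ 2) := mul_nonneg h1 (by positivity)
    unfold gradSq
    linarith
  · have : max (-u x) 0 = 0 := max_eq_right (by linarith)
    rw [this]; simp

lemma mv_est {u : Pl → ℝ} {x0 : Pl} {r S η : ℝ} (hr : 0 < r) (hS : 0 ≤ S) (hη : 0 ≤ η)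
    (hu : ∀ x ∈ closedBall x0 (2 * r), ContDiffAt ℝ 2 u x)
    (hl : ∀ x ∈ ball x0 r, u x < 0 → lap u x ≤ 0) (hlow : ∀ x ∈ ball x0 r, -S ≤ u x) :
    ng (u x0) * ∫ y, kk y ≤
      S ^ 3 * ((r ^ 2)⁻¹ * volume.real {x | x ∈ ball x0 r ∧ η ≤ |u x|}) +
        η ^ 3 * volume.real (ball (0:Pl) 1) := by
  refine (mv_neg hr hu hl).trans ?_
  set T : Set Pl := (fun y => x0 + r • y) ⁻¹' {x | x ∈ ball x0 r ∧ η ≤ |u x|} with hT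
  have hTv : volume T = ENNReal.ofReal ((r ^ 2)⁻¹) * volume {x | x ∈ ball x0 r ∧ η ≤ |u x|} := by
    have : T = (fun y : Pl => r • y) ⁻¹' ((fun y => x0 + y) ⁻¹' {x | x ∈ ball x0 r ∧ η ≤ |u x|}) :=
      rfl
    rw [this, Measure.addHaar_preimage_smul _ hr.ne', measure_preimage_add]
    simp [abs_of_pos (inv_pos.2 (pow_pos hr 2))]
  have hmemb : ∀ y : Pl, x0 + r • y ∈ ball x0 r ↔ ‖y‖ < 1 := by
    intro y
    rw [mem_ball, dist_eq_norm, add_sub_cancel_left, norm_smul, Real.norm_eq_abs,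
      abs_of_pos hr]
    constructor
    · intro h; by_contra h2; nlinarith
    · intro h; nlinarith
  have hTb : T ⊆ ball 0 1 := by
    intro y hy
    rw [mem_ball_zero_iff]
    exact (hmemb y).1 hy.1
  have hTfin : volume T ≠ ⊤ := ((measure_mono hTb).trans_lt measure_ball_lt_top).ne
  have hTr : volume.real T = (r ^ 2)⁻¹ * volume.real {x | x ∈ ball x0 r ∧ η ≤ |u x|} := by
    rw [Measure.real, hTv, ENNReal.toReal_mul, ENNReal.toReal_ofReal (by positivity)]; rfl
  set T' := toMeasurable volume T with hT'
  have hT'm : MeasurableSet T' := measurableSet_toMeasurable _ _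
  have hT'r : volume.real T' = volume.real T := by
    rw [Measure.real, Measure.real, measure_toMeasurable]
  have hT'fin : volume T' ≠ ⊤ := by rw [measure_toMeasurable]; exact hTfin
  rw [← hTr, ← hT'r]
  have i1 : Integrable (T'.indicator fun _ : Pl => S ^ 3) :=
    (integrable_indicator_iff hT'm).2 (integrableOn_const hT'fin)
  have i2 : Integrable ((ball (0:Pl) 1).indicator fun _ : Pl => η ^ 3) :=
    (integrable_indicator_iff measurableSet_ball).2 (integrableOn_const measure_ball_lt_top.ne)
  have e : S ^ 3 * volume.real T' + η ^ 3 * volume.real (ball (0:Pl) 1) =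
      ∫ y, (T'.indicator (fun _ : Pl => S ^ 3) y + (ball (0:Pl) 1).indicator (fun _ => η ^ 3) y) := by
    rw [integral_add i1 i2, integral_indicator_const _ hT'm, integral_indicator_const _ measurableSet_ball]
    simp [mul_comm]
  rw [e]
  apply integral_mono_of_nonneg
  · exact Eventually.of_forall fun y => mul_nonneg (ng_nonneg _) (kk_nonneg _)
  · exact i1.add i2
  · refine Eventually.of_forall fun y => ?_
    show ng (u (x0 + r • y)) * kk y ≤
      T'.indicator (fun _ : Pl => S ^ 3) y + (ball (0:Pl) 1).indicator (fun _ => η ^ 3) y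
    have n1 : 0 ≤ T'.indicator (fun _ : Pl => S ^ 3) y := indicator_nonneg (fun _ _ => by positivity) y
    have n2 : 0 ≤ (ball (0:Pl) 1).indicator (fun _ : Pl => η ^ 3) y :=
      indicator_nonneg (fun _ _ => by positivity) y
    rcases le_or_gt 1 ‖y‖ with h | h
    · simp only [kk, kk_zero h]
      linarith
    · have hb := (hmemb y).2 h
      refine (mul_le_of_le_one_right (ng_nonneg _) (kk_le y)).trans ?_
      by_cases hy : y ∈ T
      · rw [indicator_of_mem (show y ∈ T' from subset_toMeasurable _ _ hy)]
        have := ng_le hS (hlow _ hb)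
        linarith
      · have h3 : ¬ η ≤ |u (x0 + r • y)| := fun h4 => hy ⟨hb, h4⟩
        rw [indicator_of_mem (by rwa [mem_ball_zero_iff] : y ∈ ball (0:Pl) 1)]
        have := ng_le hη (t := u (x0 + r • y)) (by
          have := neg_abs_le (u (x0 + r • y)); linarith)
        linarith

/-! ### Lattice facts -/

lemma lat_mk (a b : ℤ) : (a : ℝ) • ee 0 + (b : ℝ) • ee 1 ∈ unitLattice := ⟨a, b, rfl⟩

lemma lat_neg {v : Pl} (hv : v ∈ unitLattice) : -v ∈ unitLattice := by
  obtain ⟨a, b, rfl⟩ := hv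
  refine ⟨-a, -b, ?_⟩
  push_cast; module

lemma lat_add {v w : Pl} (hv : v ∈ unitLattice) (hw : w ∈ unitLattice) : v + w ∈ unitLattice := by
  obtain ⟨a, b, rfl⟩ := hv
  obtain ⟨a', b', rfl⟩ := hw
  refine ⟨a + a', b + b', ?_⟩
  push_cast; module

lemma lat_zero : (0 : Pl) ∈ unitLattice := ⟨0, 0, by simp⟩

lemma lat_countable : unitLattice.Countable := by
  have : unitLattice = Set.range fun p : ℤ × ℤ => (p.1 : ℝ) • ee 0 + (p.2 : ℝ) • ee 1 := by
    ext v
    constructor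
    · rintro ⟨a, b, rfl⟩; exact ⟨(a, b), rfl⟩
    · rintro ⟨⟨a, b⟩, rfl⟩; exact ⟨a, b, rfl⟩
  rw [this]
  exact countable_range _

lemma exists_fund (x : Pl) : ∃ v ∈ unitLattice, x + v ∈ fund := by
  refine ⟨((-⌊x 0⌋ : ℤ) : ℝ) • ee 0 + ((-⌊x 1⌋ : ℤ) : ℝ) • ee 1, lat_mk _ _, ?_, ?_⟩
  · simp only [PiLp.add_apply, PiLp.smul_apply, smul_eq_mul, ee_apply]
    simp
    exact ⟨Int.floor_le _, by linarith [Int.lt_floor_add_one (x 0)]⟩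
  · simp only [PiLp.add_apply, PiLp.smul_apply, smul_eq_mul, ee_apply]
    simp
    exact ⟨Int.floor_le _, by linarith [Int.lt_floor_add_one (x 1)]⟩

/-- Closed unit square. -/
def cbox : Set Pl := {x | x 0 ∈ Icc (0:ℝ) 1 ∧ x 1 ∈ Icc (0:ℝ) 1}

lemma fund_sub : fund ⊆ cbox := fun _ hx => ⟨Ico_subset_Icc_self hx.1, Ico_subset_Icc_self hx.2⟩

lemma cbox_norm {x : Pl} (hx : x ∈ cbox) : ‖x‖ ≤ 2 := by
  obtain ⟨⟨a, b⟩, c, d⟩ := hx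
  refine (sq_le_sq₀ (norm_nonneg _) (by positivity)).1 ?_
  rw [← nsq_zero]
  simp only [nsq, PiLp.zero_apply, sub_zero]
  nlinarith

lemma cbox_compact : IsCompact cbox := by
  apply Metric.isCompact_of_isClosed_isBounded
  · have h0 : Continuous fun x : Pl => x 0 := by fun_prop
    have h1 : Continuous fun x : Pl => x 1 := by fun_prop
    exact (isClosed_Icc.preimage h0).inter (isClosed_Icc.preimage h1)
  · exact (Metric.isBounded_closedBall (x := (0:Pl)) (r := 2)).subset fun y hy => by
      rw [mem_closedBall_zero_iff]; exact cbox_norm hy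

/-- Complement of the `r`-neighbourhood of the vortex set. -/
def Dr (Z : Set Pl) (r : ℝ) : Set Pl := {x | ∀ z ∈ Z, r ≤ dist x z}

lemma Dr_closed (Z : Set Pl) (r : ℝ) : IsClosed (Dr Z r) := by
  have : Dr Z r = ⋂ z ∈ Z, {x | r ≤ dist x z} := by ext x; simp [Dr]
  rw [this]
  refine isClosed_biInter fun z _ => ?_
  have hdist : Continuous fun y : Pl => dist y z := by fun_prop
  exact isClosed_le continuous_const hdist

lemma Dr_notMem {Z : Set Pl} {r : ℝ} (hr : 0 < r) {x : Pl} (hx : x ∈ Dr Z r) : x ∉ Z := by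
  intro h
  have := hx x h
  rw [dist_self] at this
  linarith

lemma Dr_per {Z : Set Pl} {ρ0 r : ℝ} (hZ : GoodZ Z ρ0) {x v : Pl} (hx : x ∈ Dr Z r)
    (hv : v ∈ unitLattice) : x + v ∈ Dr Z r := by
  intro z hz
  have := hx _ (hZ.per z hz _ (lat_neg hv))
  rwa [dist_eq_norm, show x - (z + -v) = x + v - z by abel, ← dist_eq_norm] at this

/-! ### Uniform smallness away from the vortices -/

lemma ASol.aesm {Z : Set Pl} {A k : ℝ} {F : ℝ → ℝ} {u : Pl → ℝ} (hZc : Z.Countable)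
    (hu : ASol Z A F k u) : AEStronglyMeasurable u volume := by
  have hm : MeasurableSet Zᶜ := hZc.measurableSet.compl
  have h1 : ContinuousOn u Zᶜ := fun x hx => (hu.sm x hx).continuousAt.continuousWithinAt
  have h2 := h1.aestronglyMeasurable (μ := volume) hm
  have h3 : (volume : Measure Pl).restrict Zᶜ = volume := by
    apply Measure.restrict_eq_self_of_ae_mem
    exact (measure_eq_zero_iff_ae_notMem.1 (hZc.measure_zero volume))
  rwa [h3] at h2

lemma unif_lower {Z : Set Pl} {ρ0 A : ℝ} {F : ℝ → ℝ} {k : ℕ → ℝ} {u : ℕ → Pl → ℝ}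
    (hZ : GoodZ Z ρ0) (hZc : Z.Countable) (hA : 0 ≤ A) (hk : ∀ n, 0 < k n)
    (hF : ∀ t < 0, 0 < F t)
    (hu : ∀ n, ASol Z A F (k n) (u n)) (htop : ∀ᵐ x : Pl, Tendsto (fun n => u n x) atTop (𝓝 0))
    {r : ℝ} (hr : 0 < r) (hrρ : 2 * r < ρ0) (hr1 : r ≤ 1) {η : ℝ} (hη : 0 < η) :
    ∀ᶠ n in atTop, ∀ x ∈ Dr Z r, -η ≤ u n x := by
  set I := ∫ y, kk y with hI
  have hIpos : 0 < I := kk_int_pos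
  set V := volume.real (ball (0:Pl) 1) with hV
  have hVnn : 0 ≤ V := measureReal_nonneg
  set C : ℝ := 2 * A * Real.log 4 with hC
  have hCnn : 0 ≤ C := by have := Real.log_nonneg (show (1:ℝ) ≤ 4 by norm_num); positivity
  -- choose the small parameter
  obtain ⟨σ, hσ, hσV⟩ : ∃ σ > 0, σ ^ 3 * V ≤ I * η ^ 3 / 4 := by
    have h1 : Tendsto (fun σ : ℝ => σ ^ 3 * V) (𝓝[>] 0) (𝓝 ((0:ℝ) ^ 3 * V)) :=
      (Continuous.tendsto (by fun_prop) 0).mono_left nhdsWithin_le_nhds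
    rw [zero_pow (by norm_num), zero_mul] at h1
    have h2 := h1.eventually (gt_mem_nhds (show 0 < I * η ^ 3 / 4 by positivity))
    obtain ⟨σ, h3, h4⟩ := (h2.and self_mem_nhdsWithin).exists
    exact ⟨σ, h4, h3.le⟩
  set q := r / 4 with hq
  have hqpos : 0 < q := by positivity
  obtain ⟨θ, hθ, hθ1, hθ2⟩ : ∃ θ > 0, 4 * θ ≤ I / 2 ∧ 4 * θ * C ^ 3 ≤ I * η ^ 3 / 4 := by
    refine ⟨min (I / 8) (I * η ^ 3 / (16 * (C ^ 3 + 1))), by positivity, ?_, ?_⟩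
    · have := min_le_left (I / 8) (I * η ^ 3 / (16 * (C ^ 3 + 1))); linarith
    · have h1 := min_le_right (I / 8) (I * η ^ 3 / (16 * (C ^ 3 + 1)))
      have h2 : I * η ^ 3 / (16 * (C ^ 3 + 1)) * (16 * (C ^ 3 + 1)) = I * η ^ 3 := by
        field_simp
      have h3 : 0 ≤ C ^ 3 := by positivity
      have h4 : 0 ≤ I * η ^ 3 / (16 * (C ^ 3 + 1)) := by positivity
      have h5 := mul_le_mul_of_nonneg_right h1 h3
      nlinarith
  haveI : IsFiniteMeasure ((volume : Measure Pl).restrict (ball (0:Pl) 10)) :=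
    ⟨by rw [Measure.restrict_apply_univ]; exact measure_ball_lt_top⟩
  have hmeas := tendstoInMeasure_of_tendsto_ae (μ := volume.restrict (ball (0:Pl) 10)) (f := u)
    (g := fun _ => 0) (fun n => ((hu n).aesm hZc).restrict) (ae_restrict_of_ae htop)
  rw [tendstoInMeasure_iff_dist] at hmeas
  have hm2 := (hmeas σ hσ).eventually (gt_mem_nhds (show (0:ENNReal) < ENNReal.ofReal (q ^ 2 * θ) by
    rw [ENNReal.ofReal_pos]; positivity))
  filter_upwards [hm2] with n hn
  by_contra hcon
  push Not at hcon
  obtain ⟨x1, hx1, hx1u⟩ := hcon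
  have hcont : ContinuousOn (u n) (Dr Z r ∩ cbox) := fun x hx =>
    ((hu n).sm x (Dr_notMem hr hx.1)).continuousAt.continuousWithinAt
  have hcomp : IsCompact (Dr Z r ∩ cbox) := cbox_compact.inter_left (Dr_closed Z r)
  have hred : ∀ x ∈ Dr Z r, ∃ y ∈ Dr Z r ∩ cbox, u n y = u n x := by
    intro x hx
    obtain ⟨v, hv, hxv⟩ := exists_fund x
    exact ⟨x + v, ⟨Dr_per hZ hx hv, fund_sub hxv⟩, (hu n).per x v hv⟩
  obtain ⟨y1, hy1, hy1u⟩ := hred x1 hx1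
  obtain ⟨xs, hxs, hmin⟩ := hcomp.exists_isMinOn ⟨y1, hy1⟩ hcont
  have hmin' : ∀ x ∈ Dr Z r, u n xs ≤ u n x := by
    intro x hx
    obtain ⟨y, hy, hyx⟩ := hred x hx
    rw [← hyx]; exact hmin hy
  set U := - u n xs with hU
  have hUη : η < U := by have := hmin' x1 hx1; linarith
  -- the lower bound nearby
  have hlow : ∀ x ∈ closedBall xs (2 * q), x ∉ Z ∧ - (U + C) ≤ u n x := by
    intro x hx
    rw [mem_closedBall] at hx
    have hdz : ∀ z ∈ Z, r / 2 ≤ dist x z := by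
      intro z hz
      have h1 := hxs.1 z hz
      have h2 := dist_triangle xs x z
      rw [dist_comm xs x] at h2
      linarith
    have hxZ : x ∉ Z := Dr_notMem (half_pos hr) hdz
    refine ⟨hxZ, ?_⟩
    by_cases hxD : x ∈ Dr Z r
    · have := hmin' x hxD; linarith
    · simp only [Dr, mem_ofPred_eq, not_forall, not_le] at hxD
      obtain ⟨z, hz, hxz⟩ := hxD
      obtain ⟨a, haA, ha⟩ := (hu n).sing z hz
      have hne : x ≠ z := fun h => hxZ (h ▸ hz)
      have h1 := (hu n).lower hZ (hk n) hF hz ha (ρ := r) (S := U) (by linarith) (by linarith) (by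
        intro y hy
        have : u n xs ≤ u n y := hmin' y (by
          intro z' hz'
          by_cases hzz : z = z'
          · rw [← hzz, hy]
          · have h1 := hZ.sep z hz z' hz' hzz
            have h2 := dist_triangle z y z'
            rw [dist_comm z y] at h2
            linarith)
        linarith) x hne hxz.le
      have h2 : Real.log (r / ‖x - z‖) ≤ Real.log 4 := by
        rw [← dist_eq_norm]
        have h3 : 0 < dist x z := dist_pos.2 hne
        apply Real.log_le_log (by positivity)
        rw [div_le_iff₀ h3]
        linarith [hdz z hz]
      have h2' : 0 ≤ Real.log (r / ‖x - z‖) := by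
        rw [← dist_eq_norm]
        have h3 : 0 < dist x z := dist_pos.2 hne
        apply Real.log_nonneg
        rw [le_div_iff₀ h3]; linarith
      have h3 : max a 0 ≤ A := max_le ((le_abs_self a).trans haA) hA
      have h4 : max a 0 * Real.log (r / ‖x - z‖) ≤ A * Real.log 4 :=
        mul_le_mul h3 h2 h2' hA
      rw [hC]; linarith
  have hsub : ball xs q ⊆ closedBall xs (2 * q) := fun x hx => by
    rw [mem_closedBall]; have := mem_ball.1 hx; linarith
  have hest := mv_est (u := u n) (x0 := xs) (r := q) (S := U + C) (η := σ) hqpos (by linarith) hσ.le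
    (fun x hx => top_c2 ((hu n).sm x (hlow x hx).1))
    (fun x hx hneg => by
      rw [(hu n).pde x (hlow x (hsub hx)).1]
      have := mul_pos (hk n) (hF _ hneg); linarith)
    (fun x hx => (hlow x (hsub hx)).2)
  have hng : ng (u n xs) = U ^ 3 := by
    unfold ng; rw [max_eq_left (by linarith)]
  have hvol : volume.real {x | x ∈ ball xs q ∧ σ ≤ |u n x|} ≤ q ^ 2 * θ := by
    have hle : volume {x | x ∈ ball xs q ∧ σ ≤ |u n x|} ≤ ENNReal.ofReal (q ^ 2 * θ) := by
      refine le_trans ?_ hn.le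
      rw [Measure.restrict_apply' measurableSet_ball]
      apply measure_mono
      intro x hx
      refine ⟨?_, ?_⟩
      · show σ ≤ dist (u n x) 0
        rw [Real.dist_eq, sub_zero]; exact hx.2
      · rw [mem_ball_zero_iff]
        have h1 := cbox_norm hxs.2
        have h2 := hx.1
        rw [mem_ball, dist_eq_norm] at h2
        have h3 := norm_add_le (x - xs) xs
        rw [sub_add_cancel] at h3
        linarith
    exact ENNReal.toReal_le_of_le_ofReal (by positivity) hle
  rw [hng] at hest
  have h1 : (q ^ 2)⁻¹ * volume.real {x | x ∈ ball xs q ∧ σ ≤ |u n x|} ≤ θ := by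
    rw [inv_mul_le_iff₀ (by positivity)]; exact hvol
  have h2 : (U + C) ^ 3 * ((q ^ 2)⁻¹ * volume.real {x | x ∈ ball xs q ∧ σ ≤ |u n x|}) ≤
      (U + C) ^ 3 * θ := mul_le_mul_of_nonneg_left h1 (by
        have : 0 ≤ U + C := by linarith
        positivity)
  have h3 : (U + C) ^ 3 ≤ 4 * (U ^ 3 + C ^ 3) := by
    nlinarith [mul_nonneg (show 0 ≤ U + C by linarith) (sq_nonneg (U - C))]
  have h4 : (U + C) ^ 3 * θ ≤ 4 * (U ^ 3 + C ^ 3) * θ := mul_le_mul_of_nonneg_right h3 hθ.le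
  have hU3 : η ^ 3 < U ^ 3 := pow_lt_pow_left₀ hUη hη.le (by norm_num)
  have h5 : 4 * θ * U ^ 3 ≤ I / 2 * U ^ 3 := mul_le_mul_of_nonneg_right hθ1 (by
    have : 0 < U := by linarith
    positivity)
  have h6 := mul_lt_mul_of_pos_left hU3 (half_pos hIpos)
  nlinarith

/-! ### Abstract nonlinearity and the local analysis near a vortex -/

/-- The properties of the nonlinearity which are used. -/
structure NL (F F' : ℝ → ℝ) (c B η0 δ : ℝ) : Prop where
  c_pos : 0 < c
  B_pos : 0 < B
  η0_pos : 0 < η0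
  δ_pos : 0 < δ
  zero : F 0 = 0
  neg : ∀ t < 0, 0 < F t
  pos : ∀ t, 0 < t → F t < 0
  der : ∀ t, HasDerivAt F (F' t) t
  bd : ∀ t, |F' t| ≤ B
  conv : ∀ t, |t| ≤ η0 → F' t ≤ -c
  mono : ∀ s ∈ Icc δ (3 * δ), ∀ t ≤ η0, 0 < 2 * F t - s * F' t
  ann : ∀ s ∈ Icc δ (3 * δ), ∀ t, |t| ≤ η0 → δ * c / 2 ≤ 2 * F t - s * F' t

lemma NL.lip {F F' : ℝ → ℝ} {c B η0 δ : ℝ} (h : NL F F' c B η0 δ) (t : ℝ) : |F t| ≤ B * |t| := by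
  have := Convex.norm_image_sub_le_of_norm_hasDerivWithin_le (f := F) (f' := F') (C := B)
    (s := univ) (x := 0) (y := t) (fun x _ => (h.der x).hasDerivWithinAt)
    (fun x _ => h.bd x) convex_univ (mem_univ _) (mem_univ _)
  simpa [h.zero] using this

lemma NL.up {F F' : ℝ → ℝ} {c B η0 δ : ℝ} (h : NL F F' c B η0 δ) {t : ℝ} (h0 : 0 < t)
    (h1 : t ≤ η0) : F t ≤ -c * t := by
  have := Convex.image_sub_le_mul_sub_of_deriv_le (f := F) (convex_Icc 0 t) (C := -c)
    (fun x _ => (h.der x).continuousAt.continuousWithinAt)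
    (fun x _ => (h.der x).differentiableAt.differentiableWithinAt)
    (fun x hx => by
      rw [interior_Icc] at hx
      rw [(h.der x).deriv]
      exact h.conv x (by rw [abs_of_pos hx.1]; linarith [hx.2])) 0 ⟨le_refl _, h0.le⟩ t ⟨h0.le, le_refl _⟩ h0.le
  rw [h.zero] at this
  linarith

lemma NL.down {F F' : ℝ → ℝ} {c B η0 δ : ℝ} (h : NL F F' c B η0 δ) {t : ℝ} (h0 : 0 < t)
    (h1 : t ≤ η0) : - F (-t) ≤ -c * t := by
  have := Convex.image_sub_le_mul_sub_of_deriv_le (f := F) (convex_Icc (-t) 0) (C := -c)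
    (fun x _ => (h.der x).continuousAt.continuousWithinAt)
    (fun x _ => (h.der x).differentiableAt.differentiableWithinAt)
    (fun x hx => by
      rw [interior_Icc] at hx
      rw [(h.der x).deriv]
      exact h.conv x (by rw [abs_of_neg hx.2]; linarith [hx.1])) (-t) ⟨le_refl _, by linarith⟩ 0
      ⟨by linarith, le_refl _⟩ (by linarith)
  rw [h.zero] at this
  linarith

lemma LogSing.neg {u : Pl → ℝ} {z : Pl} {a : ℝ} (h : LogSing u z a) :
    LogSing (fun x => - u x) z (-a) := by
  obtain ⟨r, hr, v, hv, h⟩ := h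
  refine ⟨r, hr, fun x => - v x, hv.neg, fun x hx hne => ?_⟩
  simp only [h x hx hne]; ring

lemma ASol.neg {Z : Set Pl} {A k : ℝ} {F : ℝ → ℝ} {u : Pl → ℝ} (hu : ASol Z A F k u) :
    ASol Z A (fun t => - F (-t)) k (fun x => - u x) where
  per x v hv := by simp only [hu.per x v hv]
  sm x hx := (hu.sm x hx).neg
  pde x hx := by rw [lap_neg, hu.pde x hx]; simp
  sing z hz := by
    obtain ⟨a, h1, h2⟩ := hu.sing z hz
    exact ⟨-a, by rwa [abs_neg], h2.neg⟩

/-- The hypotheses of the local analysis near a vortex of nonnegative strength. -/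
structure Loc (Z : Set Pl) (ρ0 A : ℝ) (F F' : ℝ → ℝ) (c B η0 δ k : ℝ) (u : Pl → ℝ) (z : Pl)
    (a R η : ℝ) : Prop where
  gz : GoodZ Z ρ0
  sol : ASol Z A F k u
  nl : NL F F' c B η0 δ
  k_pos : 0 < k
  zmem : z ∈ Z
  ls : LogSing u z a
  a_nn : 0 ≤ a
  R_pos : 0 < R
  hRρ : 4 * R ≤ ρ0
  η_pos : 0 < η
  hηη0 : η ≤ η0
  hηδ : 4 * η ≤ δ
  small : ∀ x, R / 8 ≤ dist x z → dist x z ≤ 3 * R → |u x| ≤ η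
  hηR : 2 * R * (2 * η / (R / 8) + (4 * B * η / (c * (R / 8) ^ 2) + η) * (R / 8) / 2) ≤ δ / 2

/-- radial derivative -/
def rad (u : Pl → ℝ) (z x : Pl) : ℝ := (x 0 - z 0) * pd u 0 x + (x 1 - z 1) * pd u 1 x

section
variable {Z : Set Pl} {ρ0 A : ℝ} {F F' : ℝ → ℝ} {c B η0 δ k : ℝ} {u : Pl → ℝ} {z : Pl} {a R η : ℝ}

lemma Loc.notMem (L : Loc Z ρ0 A F F' c B η0 δ k u z a R η) {x : Pl} (h1 : x ≠ z)
    (h2 : dist x z ≤ 3 * R) : x ∉ Z :=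
  L.gz.notMem L.zmem h1 (by linarith [L.hRρ, L.R_pos])

lemma ne_of_dist {x z : Pl} {r : ℝ} (hr : 0 < r) (h : r ≤ dist x z) : x ≠ z := by
  rintro rfl; rw [dist_self] at h; linarith

lemma Loc.upper (L : Loc Z ρ0 A F F' c B η0 δ k u z a R η) {x : Pl} (h1 : x ≠ z)
    (h2 : dist x z ≤ R) : u x ≤ η := by
  have hR := L.R_pos
  have := L.sol.neg.lower L.gz L.k_pos (fun t ht => by
    have := L.nl.pos (-t) (by linarith); linarith) L.zmem L.ls.neg (ρ := R) (S := η)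
    (by linarith [L.hRρ]) L.η_pos.le (fun y hy => by
      have := L.small y (by linarith) (by linarith)
      linarith [le_abs_self (u y)]) x h1 h2
  rw [max_eq_right (by linarith [L.a_nn])] at this
  simp at this
  linarith

lemma Loc.decay (L : Loc Z ρ0 A F F' c B η0 δ k u z a R η) {x : Pl} (h1 : R / 4 ≤ dist x z)
    (h2 : dist x z ≤ 2 * R) : |u x| ≤ 4 * η / (k * c * (R / 8) ^ 2) := by
  have hR := L.R_pos
  have hd : ∀ y ∈ closedBall x (R / 8), R / 8 ≤ dist y z ∧ dist y z ≤ 3 * R := by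
    intro y hy
    rw [mem_closedBall] at hy
    have t1 := dist_triangle y x z
    have t2 := dist_triangle x y z
    rw [dist_comm x y] at t2
    constructor <;> linarith
  have hnm : ∀ y ∈ closedBall x (R / 8), y ∉ Z := fun y hy =>
    L.notMem (ne_of_dist (by positivity) (hd y hy).1) (hd y hy).2
  have hsm : ∀ y ∈ closedBall x (R / 8), |u y| ≤ η := fun y hy =>
    L.small y (hd y hy).1 (hd y hy).2
  rw [abs_le']
  constructor
  · exact _root_.decay L.k_pos L.nl.c_pos (fun t h h' => L.nl.up h h') L.η_pos L.hηη0
      (by positivity) (fun y hy => top_c2 (L.sol.sm y (hnm y hy))) (fun y hy => L.sol.pde y (hnm y hy))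
      (fun y hy => (le_abs_self _).trans (hsm y hy))
  · exact _root_.decay (F := fun t => - F (-t)) (u := fun y => - u y) L.k_pos L.nl.c_pos
      (fun t h h' => L.nl.down h h') L.η_pos L.hηη0
      (by positivity) (fun y hy => top_c2 (L.sol.neg.sm y (hnm y hy)))
      (fun y hy => L.sol.neg.pde y (hnm y hy))
      (fun y hy => (neg_le_abs _).trans (hsm y hy))

lemma coord_le (x z : Pl) (i : Fin 2) : |x i - z i| ≤ dist x z := by
  rw [dist_eq_norm]
  exact PiLp.norm_apply_le (x - z) i

lemma Loc.rad_small (L : Loc Z ρ0 A F F' c B η0 δ k u z a R η) {x : Pl} (h1 : R / 2 ≤ dist x z)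
    (h2 : dist x z ≤ R) : |rad u z x| ≤ δ / 2 := by
  have hR := L.R_pos
  have hη := L.η_pos
  have hB := L.nl.B_pos
  have hc := L.nl.c_pos
  have hk := L.k_pos
  have hd : ∀ y ∈ closedBall x (2 * (R / 8)), R / 4 ≤ dist y z ∧ dist y z ≤ 2 * R := by
    intro y hy
    rw [mem_closedBall] at hy
    have t1 := dist_triangle y x z
    have t2 := dist_triangle x y z
    rw [dist_comm x y] at t2
    constructor <;> linarith
  have hnm : ∀ y ∈ closedBall x (2 * (R / 8)), y ∉ Z := fun y hy =>
    L.notMem (ne_of_dist (by positivity) (hd y hy).1) (by linarith [(hd y hy).2])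
  have hg : ∀ i, |pd u i x| ≤ 2 * η / (R / 8) + (4 * B * η / (c * (R / 8) ^ 2) + η) * (R / 8) / 2 := by
    intro i
    refine grad_bound i (by positivity) hη.le (fun y hy => top_c2 (L.sol.sm y (hnm y hy)))
      (fun y hy => L.small y (by linarith [(hd y hy).1]) (by linarith [(hd y hy).2])) ?_
    intro y hy
    rw [L.sol.pde y (hnm y hy), abs_neg, abs_mul, abs_of_pos hk]
    have e1 := L.decay (hd y hy).1 (hd y hy).2
    have e2 := L.nl.lip (u y)
    have e3 : k * |F (u y)| ≤ k * (B * (4 * η / (k * c * (R / 8) ^ 2))) :=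
      mul_le_mul_of_nonneg_left (e2.trans (mul_le_mul_of_nonneg_left e1 hB.le)) hk.le
    have e4 : k * (B * (4 * η / (k * c * (R / 8) ^ 2))) = 4 * B * η / (c * (R / 8) ^ 2) := by
      field_simp
    linarith
  set G := 2 * η / (R / 8) + (4 * B * η / (c * (R / 8) ^ 2) + η) * (R / 8) / 2 with hG
  have hm : ∀ i, |(x i - z i) * pd u i x| ≤ R * G := by
    intro i
    rw [abs_mul]
    exact mul_le_mul ((coord_le x z i).trans h2) (hg i) (abs_nonneg _) hR.le
  have hR2 := L.hηR
  rw [← hG] at hR2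
  unfold rad
  refine (abs_add_le _ _).trans ?_
  have := hm 0
  have := hm 1
  linarith

lemma dist_scale (z x : Pl) {s : ℝ} (hs : 0 ≤ s) : dist (z + s • (x - z)) z = s * dist x z := by
  rw [dist_eq_norm, add_sub_cancel_left, norm_smul, Real.norm_eq_abs, abs_of_nonneg hs, dist_eq_norm]

lemma hasDerivAt_ray {f : Pl → ℝ} {z x : Pl} {s : ℝ}
    (hf : DifferentiableAt ℝ f (z + Real.exp (-s) • (x - z))) :
    HasDerivAt (fun s : ℝ => f (z + Real.exp (-s) • (x - z)))
      (- rad f z (z + Real.exp (-s) • (x - z))) s := by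
  have h1 : HasDerivAt (fun s : ℝ => z + Real.exp (-s) • (x - z)) ((-Real.exp (-s)) • (x - z)) s := by
    have := ((hasDerivAt_neg s).exp.smul_const (x - z)).const_add z
    simpa using this
  have h2 := hf.hasFDerivAt.comp_hasDerivAt s h1
  refine (show HasDerivAt (fun s : ℝ => f (z + Real.exp (-s) • (x - z))) _ s from h2).congr_deriv ?_
  have hy : x - z = (x 0 - z 0) • ee 0 + (x 1 - z 1) • ee 1 := by
    ext j; fin_cases j <;> simp
  have : fderiv ℝ f (z + Real.exp (-s) • (x - z)) ((-Real.exp (-s)) • (x - z)) =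
      fderiv ℝ f (z + Real.exp (-s) • (x - z)) ((-Real.exp (-s)) • ((x 0 - z 0) • ee 0 + (x 1 - z 1) • ee 1)) := by
    rw [← hy]
  rw [this, map_smul, map_add, map_smul, map_smul]
  unfold rad
  rw [pd_eq_fderiv hf, pd_eq_fderiv hf]
  simp
  ring

lemma NL.sweep_lt {F F' : ℝ → ℝ} {c B η0 δ : ℝ} (h : NL F F' c B η0 δ) {t s : ℝ} (ht : t ≤ η0)
    (hs : 0 < s) : F t < Real.exp (2 * s) * F (t - δ * s) := by
  have hδ := h.δ_pos
  set g : ℝ → ℝ := fun s => Real.exp (2 * s) * F (t - δ * s) with hg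
  have hd : ∀ s, HasDerivAt g (Real.exp (2 * s) * (2 * F (t - δ * s) - δ * F' (t - δ * s))) s := by
    intro s
    have h1 : HasDerivAt (fun s : ℝ => t - δ * s) (-δ) s := by
      simpa using ((hasDerivAt_id s).const_mul δ).const_sub t
    have h2 : HasDerivAt (fun s : ℝ => Real.exp (2 * s)) (Real.exp (2 * s) * 2) s := by
      simpa using ((hasDerivAt_id s).const_mul 2).exp
    have h3 := h2.mul ((h.der (t - δ * s)).comp s h1)
    refine (show HasDerivAt g _ s from h3).congr_deriv ?_
    simp; ring
  have hm : StrictMonoOn g (Icc 0 s) := by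
    apply strictMonoOn_of_deriv_pos (convex_Icc 0 s)
    · exact fun x _ => (hd x).continuousAt.continuousWithinAt
    · intro x hx
      rw [interior_Icc] at hx
      rw [(hd x).deriv]
      have := h.mono δ ⟨le_refl _, by linarith⟩ (t - δ * x) (by nlinarith [hx.1])
      positivity
  have := hm ⟨le_refl _, hs.le⟩ ⟨hs.le, le_refl _⟩ hs
  simpa [hg] using this

end

section
variable {Z : Set Pl} {ρ0 A : ℝ} {F F' : ℝ → ℝ} {c B η0 δ k : ℝ} {u : Pl → ℝ} {z : Pl} {a R η : ℝ}

lemma log_scale (z x : Pl) (hx : x ≠ z) (s : ℝ) :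
    Real.log ‖z + Real.exp (-s) • (x - z) - z‖ = Real.log ‖x - z‖ - s := by
  rw [add_sub_cancel_left, norm_smul, Real.norm_eq_abs, abs_of_pos (Real.exp_pos _),
    Real.log_mul (Real.exp_pos _).ne' (norm_ne_zero_iff.2 (sub_ne_zero.2 hx)), Real.log_exp]
  ring

lemma scale_ne {z x : Pl} (hx : x ≠ z) (s : ℝ) : z + Real.exp (-s) • (x - z) ≠ z := by
  intro h
  have h1 : Real.exp (-s) • (x - z) = 0 := by simpa using h
  rcases smul_eq_zero.1 h1 with h2 | h2
  · exact (Real.exp_pos _).ne' h2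
  · exact hx (sub_eq_zero.1 h2)

lemma Loc.bdry (L : Loc Z ρ0 A F F' c B η0 δ k u z a R η) {x : Pl} (hx : dist x z = R) {s : ℝ}
    (hs : 0 < s) : 0 < δ * s + u x - u (z + Real.exp (-s) • (x - z)) := by
  have hR := L.R_pos
  have hδ := L.nl.δ_pos
  have hη := L.η_pos
  have hxz : x ≠ z := ne_of_dist hR hx.ge
  have hdd : ∀ t : ℝ, dist (z + Real.exp (-t) • (x - z)) z = Real.exp (-t) * R := by
    intro t; rw [dist_scale _ _ (Real.exp_pos _).le, hx]
  have hle : ∀ t : ℝ, 0 ≤ t → Real.exp (-t) ≤ 1 := fun t ht => Real.exp_le_one_iff.2 (by linarith)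
  rcases le_or_gt s (Real.log 2) with h | h
  · have hhalf : ∀ t ∈ Icc 0 s, 1 / 2 ≤ Real.exp (-t) := by
      intro t ht
      have h1 : Real.exp (-Real.log 2) ≤ Real.exp (-t) := Real.exp_le_exp.2 (by linarith [ht.2])
      rw [Real.exp_neg, Real.exp_log two_pos] at h1
      linarith
    have := Convex.norm_image_sub_le_of_norm_hasDerivWithin_le
      (f := fun t : ℝ => u (z + Real.exp (-t) • (x - z)))
      (f' := fun t => - rad u z (z + Real.exp (-t) • (x - z))) (C := δ / 2)
      (s := Icc 0 s) (x := 0) (y := s) (fun t ht => by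
        refine (hasDerivAt_ray ?_).hasDerivWithinAt
        refine (L.sol.sm _ (L.notMem (scale_ne hxz t) ?_)).differentiableAt (by simp)
        rw [hdd]; nlinarith [hle t ht.1])
      (fun t ht => by
        rw [norm_neg, Real.norm_eq_abs]
        apply L.rad_small
        · rw [hdd]; nlinarith [hhalf t ht]
        · rw [hdd]; nlinarith [hle t ht.1])
      (convex_Icc 0 s) ⟨le_refl _, hs.le⟩ ⟨hs.le, le_refl _⟩
    simp only [Real.norm_eq_abs, neg_zero, Real.exp_zero, one_smul, sub_zero, abs_of_pos hs,
      add_sub_cancel] at this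
    have h2 := le_abs_self (u (z + Real.exp (-s) • (x - z)) - u x)
    have := mul_pos hδ hs
    linarith
  · have h1 := L.upper (scale_ne hxz s) (by rw [hdd]; nlinarith [hle s hs.le])
    have h2 := L.small x (by linarith) (by linarith)
    have h3 := neg_abs_le (u x)
    have h4 := L.hηδ
    have h5 : δ * (1 / 2) < δ * s := mul_lt_mul_of_pos_left (by
      have := Real.log_two_gt_d9; linarith) hδ
    linarith

lemma Loc.sweep (L : Loc Z ρ0 A F F' c B η0 δ k u z a R η) {v : Pl → ℝ}
    (hv : ∀ x, dist x z < ρ0 → ContDiffAt ℝ (⊤ : ℕ∞) v x)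
    (huv : ∀ x, x ≠ z → u x = 2 * a * Real.log ‖x - z‖ + v x) {x : Pl} (hx : dist x z ≤ R) {s : ℝ}
    (hs : 0 < s) : 0 ≤ (2 * a + δ) * s + v x - v (z + Real.exp (-s) • (x - z)) := by
  have hR := L.R_pos
  have hδ := L.nl.δ_pos
  have hη := L.η_pos
  have ha := L.a_nn
  have hRρ := L.hRρ
  by_contra hneg
  push Not at hneg
  set W : ℝ × Pl → ℝ := fun p =>
    (2 * a + δ) * p.1 + v p.2 - v (z + Real.exp (-p.1) • (p.2 - z)) with hW
  have hWu : ∀ t y, y ≠ z → W (t, y) = δ * t + u y - u (z + Real.exp (-t) • (y - z)) := by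
    intro t y hy
    rw [huv y hy, huv _ (scale_ne hy t), log_scale z y hy]
    simp only [hW]; ring
  have hsc : ∀ t : ℝ, 0 ≤ t → ∀ y ∈ closedBall z R, z + Real.exp (-t) • (y - z) ∈ closedBall z R := by
    intro t ht y hy
    rw [mem_closedBall] at hy ⊢
    rw [dist_scale _ _ (Real.exp_pos _).le]
    have := Real.exp_le_one_iff.2 (show -t ≤ 0 by linarith)
    have := Real.exp_pos (-t)
    nlinarith [dist_nonneg (x := y) (y := z)]
  have hvc : ContinuousOn v (closedBall z R) := fun y hy =>
    (hv y (by rw [mem_closedBall] at hy; linarith)).continuousAt.continuousWithinAt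
  obtain ⟨M, hM⟩ := (isCompact_closedBall z R).exists_bound_of_continuousOn hvc
  set S : ℝ := 2 * M / δ + 1 with hS
  have hlarge : ∀ t : ℝ, 0 ≤ t → S ≤ t → ∀ y ∈ closedBall z R, 0 < W (t, y) := by
    intro t ht0 ht y hy
    have h1 := hM y hy
    have h2 := hM _ (hsc t ht0 y hy)
    rw [Real.norm_eq_abs] at h1 h2
    have h3 := neg_abs_le (v y)
    have h4 := le_abs_self (v (z + Real.exp (-t) • (y - z)))
    have h5 : δ * S ≤ δ * t := mul_le_mul_of_nonneg_left ht hδ.le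
    have h6 : δ * S = 2 * M + δ := by rw [hS]; field_simp
    have h7 : 0 ≤ 2 * a * t := by positivity
    simp only [hW]; linarith
  have hWc : ContinuousOn W (Icc s S ×ˢ closedBall z R) := by
    have g1 : ContinuousOn (fun p : ℝ × Pl => v p.2) (Icc s S ×ˢ closedBall z R) :=
      hvc.comp continuousOn_snd fun p hp => hp.2
    have g2 : ContinuousOn (fun p : ℝ × Pl => v (z + Real.exp (-p.1) • (p.2 - z)))
        (Icc s S ×ˢ closedBall z R) :=
      hvc.comp (Continuous.continuousOn (by fun_prop)) fun p hp =>
        hsc p.1 (hs.le.trans hp.1.1) p.2 hp.2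
    exact ((continuousOn_const.mul continuousOn_fst).add g1).sub g2
  set K : Set (ℝ × Pl) := (Icc s S ×ˢ closedBall z R) ∩ W ⁻¹' Iic 0 with hK
  have hKc : IsCompact K := by
    have h1 : IsCompact (Icc s S ×ˢ closedBall z R) := isCompact_Icc.prod (isCompact_closedBall z R)
    exact h1.of_isClosed_subset (hWc.preimage_isClosed_of_isClosed h1.isClosed isClosed_Iic)
      inter_subset_left
  have hsS : s ≤ S := by
    by_contra h
    push Not at h
    have := hlarge s hs.le h.le x hx
    simp only [hW] at this
    linarith
  have hne : (s, x) ∈ K := ⟨⟨⟨le_refl _, hsS⟩, hx⟩, hneg.le⟩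
  obtain ⟨⟨t, y⟩, hty, hmax⟩ := hKc.exists_isMaxOn ⟨_, hne⟩ (f := Prod.fst) continuousOn_fst
  have hts : s ≤ t := hty.1.1.1
  have ht0 : 0 < t := hs.trans_le hts
  have hyR : dist y z ≤ R := hty.1.2
  have htS : t < S := by
    rcases hty.1.1.2.lt_or_eq with h | h
    · exact h
    · have h1 := hlarge t ht0.le (le_of_eq h.symm) y hty.1.2
      have h2 : W (t, y) ≤ 0 := hty.2
      linarith
  have hpos : ∀ t' > t, ∀ y' ∈ closedBall z R, 0 < W (t', y') := by
    intro t' ht' y' hy'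
    rcases le_or_gt S t' with h | h
    · exact hlarge t' (by linarith) h y' hy'
    · by_contra hcon
      push Not at hcon
      have : (t', y') ∈ K := ⟨⟨⟨by linarith, h.le⟩, hy'⟩, hcon⟩
      have : t' ≤ t := hmax this
      linarith
  have hnn : ∀ y' ∈ closedBall z R, 0 ≤ W (t, y') := by
    intro y' hy'
    have hcont : ContinuousWithinAt (fun t' : ℝ => W (t', y')) (Ici t) t := by
      have g1 : ContinuousAt (fun t' : ℝ => v (z + Real.exp (-t') • (y' - z))) t := by
        have g3 : ContinuousAt v (z + Real.exp (-t) • (y' - z)) :=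
          (hv _ (by
            have := hsc t ht0.le y' hy'
            rw [mem_closedBall] at this; linarith)).continuousAt
        exact ContinuousAt.comp (f := fun t' : ℝ => z + Real.exp (-t') • (y' - z)) g3
          (Continuous.continuousAt (by fun_prop))
      have g2 : ContinuousAt (fun t' : ℝ => W (t', y')) t :=
        (ContinuousAt.add (by fun_prop) continuousAt_const).sub g1
      exact g2.continuousWithinAt
    have h2 : Tendsto (fun t' : ℝ => W (t', y')) (𝓝[>] t) (𝓝 (W (t, y'))) :=
      hcont.mono_left (nhdsWithin_mono _ Ioi_subset_Ici_self)
    refine ge_of_tendsto h2 ?_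
    filter_upwards [self_mem_nhdsWithin] with t' ht' using (hpos t' ht' y' hy').le
  have hW0 : W (t, y) = 0 := le_antisymm hty.2 (hnn y hty.1.2)
  have hyz : y ≠ z := by
    intro h
    have : W (t, y) = (2 * a + δ) * t := by simp [hW, h]
    have h2 : 0 < (2 * a + δ) * t := by positivity
    linarith
  have hyR' : dist y z < R := by
    rcases hyR.lt_or_eq with h | h
    · exact h
    · have := L.bdry h ht0
      rw [← hWu t y hyz] at this
      linarith
  -- local minimum in y
  set q := Real.exp (-t) with hq
  set y' := z + q • (y - z) with hy'
  have hy'z : y' ≠ z := scale_ne hyz t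
  have hy'R : dist y' z ≤ R := hsc t ht0.le y hty.1.2
  have hyZ : y ∉ Z := L.notMem hyz (by linarith)
  have hy'Z : y' ∉ Z := L.notMem hy'z (by linarith)
  have hu2 : ContDiffAt ℝ 2 u y := top_c2 (L.sol.sm y hyZ)
  have hu3 : ContDiffAt ℝ 2 (fun x : Pl => u (z + q • (x - z))) y := by
    have h1 : ContDiffAt ℝ 2 u (z + q • (y - z)) := top_c2 (L.sol.sm _ hy'Z)
    have h2 : ContDiff ℝ 2 (fun x : Pl => z + q • (x - z)) := by fun_prop
    exact ContDiffAt.comp y h1 h2.contDiffAt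
  have hmin : IsLocalMin (fun x : Pl => u x - u (z + q • (x - z))) y := by
    have hb : ball z R ∩ {z}ᶜ ∈ 𝓝 y :=
      (isOpen_ball.inter isOpen_compl_singleton).mem_nhds ⟨hyR', hyz⟩
    filter_upwards [hb] with x hx
    have h1 := hnn x (ball_subset_closedBall hx.1)
    rw [hWu t x hx.2] at h1
    rw [hWu t y hyz] at hW0
    linarith
  have hlap := lap_min (hu2.sub hu3).continuousAt hmin
  rw [lap_sub hu2 hu3, lap_scale, L.sol.pde y hyZ, L.sol.pde _ hy'Z] at hlap
  rw [hWu t y hyz] at hW0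
  have huy : u y = u y' - δ * t := by linarith
  have hkey := L.nl.sweep_lt (t := u y') (s := t) ((L.upper hy'z hy'R).trans L.hηη0) ht0
  have hq2 : q ^ 2 * Real.exp (2 * t) = 1 := by
    rw [hq, ← Real.exp_nat_mul, ← Real.exp_add]; simp
  have hq0 : 0 < q := Real.exp_pos _
  have h9 : q ^ 2 * F (u y') < q ^ 2 * (Real.exp (2 * t) * F (u y' - δ * t)) :=
    mul_lt_mul_of_pos_left hkey (by positivity)
  rw [← mul_assoc, hq2, one_mul, ← huy] at h9
  have h10 := mul_lt_mul_of_pos_left h9 L.k_pos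
  linarith

lemma Loc.rad_lower (L : Loc Z ρ0 A F F' c B η0 δ k u z a R η) {v : Pl → ℝ}
    (hv : ∀ x, dist x z < ρ0 → ContDiffAt ℝ (⊤ : ℕ∞) v x)
    (huv : ∀ x, x ≠ z → u x = 2 * a * Real.log ‖x - z‖ + v x) {x : Pl} (hx : dist x z ≤ R) :
    0 ≤ 2 * a + δ + rad v z x := by
  have hR := L.R_pos
  have hd : DifferentiableAt ℝ v (z + Real.exp (-0) • (x - z)) := by
    refine (hv _ ?_).differentiableAt (by simp)
    simp; linarith [L.hRρ]
  have h1 := hasDerivAt_ray hd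
  have h2 : HasDerivAt (fun s : ℝ => (2 * a + δ) * s + v x - v (z + Real.exp (-s) • (x - z)))
      (2 * a + δ + rad v z x) 0 := by
    have h3 : HasDerivAt (fun s : ℝ => (2 * a + δ) * s + v x) (2 * a + δ) 0 := by
      simpa using ((hasDerivAt_id (0:ℝ)).const_mul (2 * a + δ)).add_const (v x)
    refine (h3.fun_sub h1).congr_deriv ?_
    simp
  exact deriv_nonneg_of_nonneg one_pos h2 (by simp) fun t ht _ => L.sweep hv huv hx ht

end

section
variable {Z : Set Pl} {ρ0 A : ℝ} {F F' : ℝ → ℝ} {c B η0 δ k : ℝ} {u : Pl → ℝ} {z : Pl} {a R η : ℝ}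

lemma rad_smooth {f : Pl → ℝ} {z x : Pl} (hf : ContDiffAt ℝ (⊤ : ℕ∞) f x) :
    ContDiffAt ℝ (⊤ : ℕ∞) (rad f z) x := by
  have h0 := hf.pd' (m := (⊤ : ℕ∞)) (by simp) 0
  have h1 := hf.pd' (m := (⊤ : ℕ∞)) (by simp) 1
  exact ((diff_coord 0 _).contDiffAt.mul h0).add ((diff_coord 1 _).contDiffAt.mul h1)

lemma top1 : ((1 : ℕ∞) : WithTop ℕ∞) ≤ ((⊤ : ℕ∞) : WithTop ℕ∞) := WithTop.coe_le_coe.2 le_top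

lemma lap_coord (i : Fin 2) (x : Pl) (c : ℝ) : lap (fun y : Pl => y i - c) x = 0 := by
  have h : ∀ j, pd (fun y : Pl => y i - c) j = fun _ => if j = i then (1:ℝ) else 0 := by
    intro j; funext y; rw [pd_coord]
  unfold lap
  rw [h, h, pd_const, pd_const, add_zero]

lemma lap_pd {f : Pl → ℝ} {x : Pl} (hf : ContDiffAt ℝ (⊤ : ℕ∞) f x) (i : Fin 2) :
    lap (pd f i) x = pd (lap f) i x := by
  have e : ∀ j, pd (pd (pd f i) j) j x = pd (pd (pd f j) j) i x := by
    intro j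
    have h1 : pd (pd f i) j =ᶠ[𝓝 x] pd (pd f j) i := by
      filter_upwards [(top_c2 hf).eventually (by simp)] with y hy using pd_comm hy i j
    rw [pd_congr h1 j]
    exact pd_comm (top_c2 (hf.pd' (m := (⊤ : ℕ∞)) (by simp) j)) i j
  have hd : ∀ j, DifferentiableAt ℝ (pd (pd f j) j) x := fun j =>
    ((hf.pd' (m := (⊤ : ℕ∞)) (by simp) j).pd' (m := (⊤ : ℕ∞)) (by simp) j).differentiableAt (by simp)
  have h2 : lap f = fun y => pd (pd f 0) 0 y + pd (pd f 1) 1 y := rfl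
  rw [h2, pd_add (hd 0) (hd 1)]
  unfold lap
  rw [e 0, e 1]

lemma lap_rad {f : Pl → ℝ} {x : Pl} (hf : ContDiffAt ℝ (⊤ : ℕ∞) f x) (z : Pl) :
    lap (rad f z) x = 2 * lap f x + rad (lap f) z x := by
  have h : ∀ i, ContDiffAt ℝ 2 (pd f i) x := fun i => top_c2 (hf.pd' (m := (⊤ : ℕ∞)) (by simp) i)
  have hc : ∀ i, ContDiffAt ℝ 2 (fun y : Pl => y i - z i) x := fun i =>
    top_c2 (diff_coord i (z i)).contDiffAt
  have e : rad f z = fun y => (fun y : Pl => (y 0 - z 0) * pd f 0 y) y +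
    (fun y : Pl => (y 1 - z 1) * pd f 1 y) y := rfl
  rw [e, lap_add ((hc 0).mul (h 0)) ((hc 1).mul (h 1)), lap_mul (hc 0) (h 0), lap_mul (hc 1) (h 1),
    lap_coord, lap_coord, lap_pd hf, lap_pd hf]
  simp only [pd_coord]
  simp [rad, lap]
  ring

/-- The supersolution. -/
def Phi (v : Pl → ℝ) (z : Pl) (a R δ : ℝ) (x : Pl) : ℝ :=
  2 * a + rad v z x + δ * (3 - nsq z x / R ^ 2)

lemma Phi_smooth {v : Pl → ℝ} {z x : Pl} {a R δ : ℝ} (hv : ContDiffAt ℝ (⊤ : ℕ∞) v x) :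
    ContDiffAt ℝ (⊤ : ℕ∞) (Phi v z a R δ) x :=
  (contDiffAt_const.add (rad_smooth hv)).add
    (contDiffAt_const.mul (contDiffAt_const.sub ((nsq_smooth z).contDiffAt.div_const _)))

lemma Phi_eq {v : Pl → ℝ} (huv : ∀ x, x ≠ z → u x = 2 * a * Real.log ‖x - z‖ + v x) {x : Pl}
    (hx : x ≠ z) (hv : ContDiffAt ℝ (⊤ : ℕ∞) v x) :
    Phi v z a R δ x = rad u z x + δ * (3 - nsq z x / R ^ 2) := by
  have h1 : ∀ i, pd u i x = 2 * a * ((x i - z i) * (nsq z x)⁻¹) + pd v i x := by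
    intro i
    have e : u =ᶠ[𝓝 x] fun y => (2 * a) * Real.log ‖y - z‖ + v y := by
      filter_upwards [isOpen_ne.mem_nhds hx] with y hy using huv y hy
    have hl := (log_smooth hx).differentiableAt (by simp)
    rw [pd_congr e, pd_add (hl.const_mul _) (hv.differentiableAt (by simp)),
      pd_const_mul _ hl, pd_log hx]
  have hn := nsq_pos hx
  unfold Phi rad
  rw [h1, h1]
  have : 2 * a = 2 * a * (nsq z x * (nsq z x)⁻¹) := by rw [mul_inv_cancel₀ hn.ne', mul_one]
  nth_rewrite 1 [this]
  nth_rewrite 1 [nsq]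
  ring

lemma Loc.Phi_ge (L : Loc Z ρ0 A F F' c B η0 δ k u z a R η) {v : Pl → ℝ}
    (hv : ∀ x, dist x z < ρ0 → ContDiffAt ℝ (⊤ : ℕ∞) v x)
    (huv : ∀ x, x ≠ z → u x = 2 * a * Real.log ‖x - z‖ + v x) {x : Pl} (hx : dist x z ≤ R) :
    δ ≤ Phi v z a R δ x := by
  have h1 := L.rad_lower hv huv hx
  have hδ := L.nl.δ_pos
  have hR := L.R_pos
  have h2 : nsq z x / R ^ 2 ≤ 1 := by
    rw [nsq_eq, ← dist_eq_norm, div_le_one (by positivity)]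
    exact pow_le_pow_left₀ dist_nonneg hx 2
  unfold Phi
  nlinarith

lemma Loc.h_mem (L : Loc Z ρ0 A F F' c B η0 δ k u z a R η) {x : Pl} (hx : dist x z ≤ R) :
    δ * (3 - nsq z x / R ^ 2) ∈ Icc δ (3 * δ) := by
  have hδ := L.nl.δ_pos
  have hR := L.R_pos
  have h2 : nsq z x / R ^ 2 ≤ 1 := by
    rw [nsq_eq, ← dist_eq_norm, div_le_one (by positivity)]
    exact pow_le_pow_left₀ dist_nonneg hx 2
  have h3 : 0 ≤ nsq z x / R ^ 2 := by rw [nsq_eq]; positivity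
  constructor <;> nlinarith

lemma Loc.Phi_pde (L : Loc Z ρ0 A F F' c B η0 δ k u z a R η) {v : Pl → ℝ}
    (hv : ∀ x, dist x z < ρ0 → ContDiffAt ℝ (⊤ : ℕ∞) v x)
    (huv : ∀ x, x ≠ z → u x = 2 * a * Real.log ‖x - z‖ + v x) {x : Pl} (hx : dist x z ≤ R)
    (hxz : x ≠ z) :
    - lap (Phi v z a R δ) x - k * F' (u x) * Phi v z a R δ x =
      k * (2 * F (u x) - (δ * (3 - nsq z x / R ^ 2)) * F' (u x)) + 4 * δ / R ^ 2 := by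
  have hR := L.R_pos
  have hRρ := L.hRρ
  have hxZ := L.notMem hxz (by linarith)
  have hus := L.sol.sm x hxZ
  have hev : ∀ᶠ y in 𝓝 x, y ≠ z ∧ dist y z < ρ0 :=
    (isOpen_ne.inter isOpen_ball).mem_nhds ⟨hxz, by rw [mem_ball]; linarith⟩
  have e1 : Phi v z a R δ =ᶠ[𝓝 x] fun y => rad u z y + (3 * δ - (δ / R ^ 2) * nsq z y) := by
    filter_upwards [hev] with y hy
    rw [Phi_eq huv hy.1 (hv y hy.2)]; ring
  have hn2 : ContDiffAt ℝ 2 (nsq z) x := top_c2 (nsq_smooth z).contDiffAt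
  have e2 : lap u =ᶠ[𝓝 x] fun y => - (k * F (u y)) := by
    filter_upwards [hev] with y hy
    exact L.sol.pde y (L.gz.notMem L.zmem hy.1 hy.2)
  have hud : DifferentiableAt ℝ u x := hus.differentiableAt (by simp)
  have e3 : ∀ i, pd (lap u) i x = - (k * F' (u x)) * pd u i x := by
    intro i
    rw [pd_congr e2]
    have := pd_comp (f := u) (β := fun t => - (k * F t)) (b := - (k * F' (u x)))
      (((L.nl.der (u x)).const_mul k).neg) hud i
    exact this
  have e4 : lap (fun y => 3 * δ - (δ / R ^ 2) * nsq z y) x = - (4 * δ / R ^ 2) := by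
    rw [lap_sub contDiffAt_const (contDiffAt_const.mul hn2), lap_const, lap_const_mul _ hn2, lap_nsq]
    ring
  rw [lap_congr e1, lap_add (top_c2 (rad_smooth hus)) (contDiffAt_const.sub (contDiffAt_const.mul hn2)),
    e4, lap_rad hus, Phi_eq huv hxz (hv x (by linarith)), L.sol.pde x hxZ]
  unfold rad
  rw [e3, e3]
  ring

end

/-! ### The cut-off vector field -/

section
variable {Z : Set Pl} {ρ0 A : ℝ} {F F' : ℝ → ℝ} {c B η0 δ k : ℝ} {u : Pl → ℝ} {z : Pl} {a R η : ℝ}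

/-- An angle-type cut-off function. -/
structure Cut (θ : Pl → ℝ) (z : Pl) (R G : ℝ) : Prop where
  sm : ContDiff ℝ (⊤ : ℕ∞) θ
  inn : ∀ x, dist x z ≤ R / 2 → θ x = π / 2
  out : ∀ x, 3 * R / 4 ≤ dist x z → θ x = 0
  grad : ∀ x, gradSq θ x ≤ G

lemma cut_zero {R : ℝ} (hR : 0 < R) : ∃ θ : Pl → ℝ, ∃ G, Cut θ 0 R G := by
  let b : ContDiffBump (0 : Pl) := ⟨R / 2, 3 * R / 4, by linarith, by linarith⟩
  have hb : ContDiff ℝ (⊤ : ℕ∞) (fun x => (π / 2) * b x) := contDiff_const.mul b.contDiff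
  have hcs : HasCompactSupport (fun x => (π / 2) * b x) := b.hasCompactSupport.mul_left
  have hcont : ∀ i, Continuous (fun x => pd (fun x => (π / 2) * b x) i x) := fun i =>
    continuous_iff_continuousAt.2 fun x =>
      (hb.contDiffAt.pd' (m := (⊤ : ℕ∞)) (by simp) i).continuousAt
  have hgc : Continuous (gradSq (fun x => (π / 2) * b x)) := ((hcont 0).pow 2).add ((hcont 1).pow 2)
  obtain ⟨C, hC⟩ := (isCompact_closedBall (0 : Pl) R).bddAbove_image hgc.continuousOn
  refine ⟨_, max C 0, hb, fun x hx => ?_, fun x hx => ?_, fun x => ?_⟩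
  · rw [b.one_of_mem_closedBall (by simpa [b] using hx), mul_one]
  · rw [b.zero_of_le_dist (by simpa [b] using hx), mul_zero]
  · by_cases hx : dist x 0 ≤ R
    · exact (hC ⟨x, hx, rfl⟩).trans (le_max_left _ _)
    · have e : (fun x => (π / 2) * b x) =ᶠ[𝓝 x] fun _ => (0:ℝ) := by
        have : ∀ᶠ y in 𝓝 x, R < dist y 0 :=
          (isOpen_lt continuous_const (continuous_id.dist continuous_const)).mem_nhds (not_le.1 hx)
        filter_upwards [this] with y hy
        rw [b.zero_of_le_dist (by show 3 * R / 4 ≤ _; linarith), mul_zero]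
      have h0 : gradSq (fun x => (π / 2) * b x) x = 0 := by
        unfold gradSq
        rw [pd_congr e, pd_congr e, pd_const, pd_const]; simp
      rw [h0]; exact le_max_right _ _

lemma Cut.trans {θ : Pl → ℝ} {R G : ℝ} (h : Cut θ 0 R G) (z : Pl) :
    Cut (fun x => θ (x + (-z))) z R G where
  sm := h.sm.comp (contDiff_id.add contDiff_const)
  inn x hx := h.inn _ (by rwa [dist_zero_right, ← sub_eq_add_neg, ← dist_eq_norm])
  out x hx := h.out _ (by rwa [dist_zero_right, ← sub_eq_add_neg, ← dist_eq_norm])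
  grad x := by
    unfold gradSq
    rw [pd_trans, pd_trans]; exact h.grad _

lemma alg_bound (s co t0 t1 g0 g1 : ℝ) (h : s ^ 2 + co ^ 2 = 1) :
    (2 * s * co * t0) * g0 + (2 * s * co * t1) * g1 - s ^ 2 * (g0 ^ 2 + g1 ^ 2)
      + (s ^ 2 * g0) ^ 2 + (s ^ 2 * g1) ^ 2 ≤ t0 ^ 2 + t1 ^ 2 := by
  have e : s ^ 2 = 1 - co ^ 2 := by linarith
  have h1 : (s ^ 2 * g0) ^ 2 = s ^ 2 * g0 ^ 2 - (s * co * g0) ^ 2 := by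
    have : (s ^ 2 * g0) ^ 2 = s ^ 2 * g0 ^ 2 * (s ^ 2) := by ring
    rw [this]; nth_rewrite 2 [e]; ring
  have h2 : (s ^ 2 * g1) ^ 2 = s ^ 2 * g1 ^ 2 - (s * co * g1) ^ 2 := by
    have : (s ^ 2 * g1) ^ 2 = s ^ 2 * g1 ^ 2 * (s ^ 2) := by ring
    rw [this]; nth_rewrite 2 [e]; ring
  rw [h1, h2]
  nlinarith [sq_nonneg (s * co * g0 - t0), sq_nonneg (s * co * g1 - t1)]

lemma Loc.field (L : Loc Z ρ0 A F F' c B η0 δ k u z a R η) {θ : Pl → ℝ} {G : ℝ}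
    (hθ : Cut θ z R G) (hk : G + 1 ≤ k * c / 8) :
    ∃ μ > 0, ∃ Y : Fin 2 → Pl → ℝ, (∀ i, ContDiff ℝ 1 (Y i)) ∧
      (∀ i x, 3 * R / 4 ≤ dist x z → Y i x = 0) ∧
      ∀ x, x ≠ z → dist x z < R →
        μ ≤ -(pd (Y 0) 0 x + pd (Y 1) 1 x + (Y 0 x) ^ 2 + (Y 1 x) ^ 2) - k * F' (u x) := by
  have hR := L.R_pos
  have hRρ := L.hRρ
  have hδ := L.nl.δ_pos
  obtain ⟨v, hv, huv⟩ := L.sol.ext L.gz L.zmem L.ls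
  set Φ := Phi v z a R δ with hΦ
  have hsm : ∀ x, dist x z ≤ R → ContDiffAt ℝ (⊤ : ℕ∞) Φ x := fun x hx =>
    Phi_smooth (hv x (by linarith))
  have hpos : ∀ x, dist x z ≤ R → 0 < Φ x := fun x hx => hδ.trans_le (L.Phi_ge hv huv hx)
  obtain ⟨M, hM⟩ := (isCompact_closedBall z R).bddAbove_image (f := Φ)
    (fun x hx => (hsm x hx).continuousAt.continuousWithinAt)
  have hM' : ∀ x, dist x z ≤ R → Φ x ≤ M := fun x hx => hM ⟨x, hx, rfl⟩
  have hMp : 0 < M := (hpos z (by simp [hR.le])).trans_le (hM' z (by simp [hR.le]))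
  let χ : Pl → ℝ := fun x => sin (θ x) ^ 2
  have hχs : ContDiff ℝ (⊤ : ℕ∞) χ := (contDiff_sin.comp hθ.sm).pow 2
  have hχd : ∀ i x, pd χ i x = 2 * sin (θ x) * cos (θ x) * pd θ i x := by
    intro i x
    have h := pd_comp (f := θ) (β := fun t => sin t ^ 2) (b := 2 * sin (θ x) * cos (θ x))
      (by have := (hasDerivAt_sin (θ x)).fun_pow 2; simpa using this)
      (hθ.sm.contDiffAt.differentiableAt (by simp)) i
    exact h
  refine ⟨min 1 (4 * δ / R ^ 2 / M), by positivity, fun i x => χ x * (pd Φ i x * (Φ x)⁻¹), ?_, ?_, ?_⟩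
  · intro i
    rw [contDiff_iff_contDiffAt]
    intro x
    by_cases hx : dist x z < R
    · have hg : ContDiffAt ℝ (⊤ : ℕ∞) (fun x => χ x * (pd Φ i x * (Φ x)⁻¹)) x :=
        hχs.contDiffAt.mul (((hsm x hx.le).pd' (m := (⊤ : ℕ∞)) (by simp) i).mul
          ((hsm x hx.le).inv (hpos x hx.le).ne'))
      exact hg.of_le top1
    · have : ∀ᶠ y in 𝓝 x, 3 * R / 4 < dist y z :=
        (isOpen_lt continuous_const (continuous_id.dist continuous_const)).mem_nhds
          (by show 3 * R / 4 < dist x z; linarith)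
      refine (contDiffAt_const (c := (0:ℝ))).congr_of_eventuallyEq ?_
      filter_upwards [this] with y hy
      simp [χ, hθ.out y hy.le]
  · intro i x hx
    simp [χ, hθ.out x hx]
  · intro x hxz hx
    have hp := hpos x hx.le
    have hs := hsm x hx.le
    have hd : ∀ i, pd (fun x => χ x * (pd Φ i x * (Φ x)⁻¹)) i x =
        pd χ i x * (pd Φ i x * (Φ x)⁻¹) + χ x * (pd (pd Φ i) i x * (Φ x)⁻¹
          - (pd Φ i x * (Φ x)⁻¹) ^ 2) := by
      intro i
      have hΦd : DifferentiableAt ℝ Φ x := hs.differentiableAt (by simp)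
      have hpd : DifferentiableAt ℝ (pd Φ i) x :=
        (hs.pd' (m := (⊤ : ℕ∞)) (by simp) i).differentiableAt (by simp)
      have hi : pd (fun x => (Φ x)⁻¹) i x = - ((Φ x) ^ 2)⁻¹ * pd Φ i x :=
        pd_comp (f := Φ) (β := fun t => t⁻¹) (hasDerivAt_inv hp.ne') hΦd i
      have hid : DifferentiableAt ℝ (fun x => (Φ x)⁻¹) x := hΦd.inv hp.ne'
      rw [pd_mul (hχs.contDiffAt.differentiableAt (by simp)) (hpd.fun_mul hid), pd_mul hpd hid, hi]
      field_simp
      try ring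
    have hpde := L.Phi_pde hv huv hx.le hxz
    rw [← hΦ] at hpde
    set s := δ * (3 - nsq z x / R ^ 2) with hs_def
    have hsm' := L.h_mem hx.le
    rw [← hs_def] at hsm'
    set W := k * (2 * F (u x) - s * F' (u x)) + 4 * δ / R ^ 2 with hW
    have hlap : lap Φ x * (Φ x)⁻¹ = - (W * (Φ x)⁻¹) - k * F' (u x) := by
      have : lap Φ x = - W - k * F' (u x) * Φ x := by linarith
      rw [this, sub_mul, mul_assoc, mul_inv_cancel₀ hp.ne']; ring
    have hal := alg_bound (sin (θ x)) (cos (θ x)) (pd θ 0 x) (pd θ 1 x)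
      (pd Φ 0 x * (Φ x)⁻¹) (pd Φ 1 x * (Φ x)⁻¹) (sin_sq_add_cos_sq _)
    have key : (1 - χ x) * (- (k * F' (u x))) + χ x * (W * (Φ x)⁻¹) - gradSq θ x ≤
        -(pd (fun x => χ x * (pd Φ 0 x * (Φ x)⁻¹)) 0 x + pd (fun x => χ x * (pd Φ 1 x * (Φ x)⁻¹)) 1 x
          + (χ x * (pd Φ 0 x * (Φ x)⁻¹)) ^ 2 + (χ x * (pd Φ 1 x * (Φ x)⁻¹)) ^ 2) - k * F' (u x) := by
      rw [hd, hd, hχd, hχd]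
      have e : χ x * (W * (Φ x)⁻¹) = - χ x * (lap Φ x * (Φ x)⁻¹) - χ x * (k * F' (u x)) := by
        rw [hlap]; ring
      rw [e]
      unfold lap gradSq
      have hc : χ x = sin (θ x) ^ 2 := rfl
      rw [hc]
      nlinarith [hal]
    refine le_trans ?_ key
    by_cases hx2 : dist x z < R / 2
    · have hχ1 : χ x = 1 := by simp [χ, hθ.inn x hx2.le]
      have e : θ =ᶠ[𝓝 x] fun _ => π / 2 := by
        filter_upwards [isOpen_ball.mem_nhds (mem_ball.2 hx2)] with y hy
        exact hθ.inn y (mem_ball.1 hy).le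
      have h0 : gradSq θ x = 0 := by
        unfold gradSq
        rw [pd_congr e, pd_congr e, pd_const, pd_const]; simp
      rw [hχ1, h0]
      have hm := L.nl.mono s hsm' (u x) ((L.upper hxz hx.le).trans L.hηη0)
      have hW1 : 4 * δ / R ^ 2 ≤ W := by
        have := mul_pos L.k_pos hm
        rw [hW]; linarith
      have : 4 * δ / R ^ 2 / M ≤ W * (Φ x)⁻¹ := by
        rw [← div_eq_mul_inv]
        exact div_le_div₀ ((by positivity : (0:ℝ) ≤ 4 * δ / R ^ 2).trans hW1) hW1 hp (hM' x hx.le)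
      have := min_le_right 1 (4 * δ / R ^ 2 / M)
      linarith
    · have hsmall : |u x| ≤ η0 := (L.small x (by linarith) (by linarith)).trans L.hηη0
      have hcv := L.nl.conv _ hsmall
      have han := L.nl.ann s hsm' _ hsmall
      have hr := L.rad_small (x := x) (by linarith) hx.le
      have hΦ4 : Φ x ≤ 4 * δ := by
        rw [hΦ, Phi_eq huv hxz (hv x (by linarith)), ← hs_def]
        have := le_abs_self (rad u z x)
        linarith [hsm'.2]
      have hkp := L.k_pos
      have hcp := L.nl.c_pos
      have hW1 : k * (δ * c / 2) ≤ W := by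
        have h1 := mul_le_mul_of_nonneg_left han hkp.le
        have : 0 ≤ 4 * δ / R ^ 2 := by positivity
        rw [hW]; linarith
      have hW2 : k * c / 8 ≤ W * (Φ x)⁻¹ := by
        rw [← div_eq_mul_inv, le_div_iff₀ hp]
        have : k * c / 8 * Φ x ≤ k * c / 8 * (4 * δ) :=
          mul_le_mul_of_nonneg_left hΦ4 (by positivity)
        linarith
      have hkc : k * c / 8 ≤ - (k * F' (u x)) := by
        have := mul_le_mul_of_nonneg_left hcv hkp.le
        nlinarith [mul_pos hkp hcp]
      have hχ0 : 0 ≤ χ x := sq_nonneg _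
      have hχ1 : χ x ≤ 1 := sin_sq_le_one _
      have := min_le_left 1 (4 * δ / R ^ 2 / M)
      have h1 := mul_le_mul_of_nonneg_left hkc (by linarith : 0 ≤ 1 - χ x)
      have h2 := mul_le_mul_of_nonneg_left hW2 hχ0
      have := hθ.grad x
      linarith

end

/-! ### The concrete nonlinearity -/

lemma NL.build {F F' : ℝ → ℝ} {c B η1 δ : ℝ} (hc : 0 < c) (hB : 0 < B) (hη : 0 < η1) (hδ : 0 < δ)
    (h0 : F 0 = 0) (hn : ∀ t < 0, 0 < F t) (hp : ∀ t, 0 < t → F t < 0)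
    (hd : ∀ t, HasDerivAt F (F' t) t) (hb : ∀ t, |F' t| ≤ B)
    (hcv : ∀ t, |t| ≤ η1 → F' t ≤ -c)
    (hm : ∀ s ∈ Icc δ (3 * δ), ∀ t ≤ 0, 0 < 2 * F t - s * F' t) :
    NL F F' c B (min η1 (δ * c / (4 * B))) δ := by
  have hlip : ∀ t, |F t| ≤ B * |t| := by
    intro t
    have := Convex.norm_image_sub_le_of_norm_hasDerivWithin_le (f := F) (f' := F') (C := B)
      (s := univ) (x := 0) (y := t) (fun x _ => (hd x).hasDerivWithinAt)
      (fun x _ => hb x) convex_univ (mem_univ _) (mem_univ _)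
    simpa [h0] using this
  have han : ∀ s ∈ Icc δ (3 * δ), ∀ t, |t| ≤ min η1 (δ * c / (4 * B)) →
      δ * c / 2 ≤ 2 * F t - s * F' t := by
    intro s hs t ht
    have h1 := hcv t (ht.trans (min_le_left _ _))
    have h2 := ht.trans (min_le_right _ _)
    rw [le_div_iff₀ (by positivity)] at h2
    have h3 := hlip t
    have h4 := neg_abs_le (F t)
    have h5 : δ * c ≤ s * (- F' t) := mul_le_mul hs.1 (by linarith) hc.le (hδ.le.trans hs.1)
    nlinarith
  refine ⟨hc, hB, by positivity, hδ, h0, hn, hp, hd, hb,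
    fun t ht => hcv t (ht.trans (min_le_left _ _)), fun s hs t ht => ?_, han⟩
  by_cases h : t ≤ 0
  · exact hm s hs t h
  · have := han s hs t (by rwa [abs_of_pos (not_le.1 h)])
    have : 0 < δ * c := by positivity
    linarith

lemma fτ_deriv {τ : ℝ} (hτ : 0 < τ) (t : ℝ) : HasDerivAt (fτ τ) (fτ' τ t) t := by
  have hx := exp_pos t
  have h1 := Real.hasDerivAt_exp t
  have h2 := (h1.fun_mul (h1.const_sub 1)).fun_div ((h1.const_add τ).fun_pow 3) (by positivity)
  unfold fτ
  refine h2.congr_deriv ?_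
  unfold fτ'
  have e : exp (2 * t) = exp t ^ 2 := by rw [two_mul, exp_add, sq]
  rw [e]
  have : τ + exp t ≠ 0 := by positivity
  field_simp
  push_cast
  ring

lemma fτ'_cont {τ : ℝ} (hτ : 0 < τ) : Continuous (fτ' τ) := by
  unfold fτ'
  refine Continuous.div (by fun_prop) (by fun_prop) (fun t => ?_)
  have := exp_pos t
  positivity

lemma fτ'_bd {τ : ℝ} (hτ : 0 < τ) (t : ℝ) : |fτ' τ t| ≤ (2 * τ + 3) / τ ^ 2 + 1 / τ := by
  unfold fτ'
  have e : exp (2 * t) = exp t ^ 2 := by rw [two_mul, exp_add, sq]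
  rw [e]
  have hx := exp_pos t
  set x := exp t
  have hy : 0 < τ + x := by positivity
  rw [abs_div, abs_of_pos (by positivity : 0 < (τ + x) ^ 4), abs_mul, abs_of_pos hx]
  have h1 : |τ - 2 * (τ + 1) * x + x ^ 2| ≤ (2 * τ + 3) * (τ + x) + (τ + x) ^ 2 := by
    rw [abs_le]; constructor <;> nlinarith [mul_pos hτ hx, sq_nonneg x, sq_nonneg τ]
  have h2 : x * |τ - 2 * (τ + 1) * x + x ^ 2| ≤ (τ + x) * ((2 * τ + 3) * (τ + x) + (τ + x) ^ 2) :=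
    mul_le_mul (by linarith) h1 (abs_nonneg _) hy.le
  calc _ ≤ (τ + x) * ((2 * τ + 3) * (τ + x) + (τ + x) ^ 2) / (τ + x) ^ 4 := by gcongr
    _ = (2 * τ + 3) / (τ + x) ^ 2 + 1 / (τ + x) := by field_simp
    _ ≤ _ := by gcongr <;> linarith

theorem nl_exists {τ : ℝ} (hτ : 0 < τ) : ∃ c B η0 δ, NL (fτ τ) (fτ' τ) c B η0 δ ∧
    NL (fun t => - fτ τ (-t)) (fun t => fτ' τ (-t)) c B η0 δ := by
  have hf0 : fτ' τ 0 = - (1 / (τ + 1) ^ 3) := by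
    unfold fτ'
    simp
    field_simp
    ring
  have hcv : ∀ᶠ t in 𝓝 (0:ℝ), fτ' τ t < - (1 / (τ + 1) ^ 3 / 2) := by
    refine (fτ'_cont hτ).continuousAt.eventually_lt continuousAt_const ?_
    rw [hf0]
    have : 0 < 1 / (τ + 1) ^ 3 := by positivity
    linarith
  obtain ⟨r, hr, hball⟩ := Metric.eventually_nhds_iff.1 hcv
  have hcv1 : ∀ t, |t| ≤ r / 2 → fτ' τ t ≤ - (1 / (τ + 1) ^ 3 / 2) := fun t ht =>
    (hball (by rw [dist_zero_right, Real.norm_eq_abs]; linarith)).le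
  have hB : 0 < (2 * τ + 3) / τ ^ 2 + 1 / τ := by positivity
  have hneg : ∀ t < 0, 0 < fτ τ t := by
    intro t ht
    have := exp_pos t
    have : exp t < 1 := by rwa [exp_lt_one_iff]
    unfold fτ
    have : 0 < 1 - exp t := by linarith
    positivity
  have hpos : ∀ t, 0 < t → fτ τ t < 0 := by
    intro t ht
    have h1 := exp_pos t
    have : 1 < exp t := by rwa [one_lt_exp_iff]
    unfold fτ
    exact div_neg_of_neg_of_pos (mul_neg_of_pos_of_neg h1 (by linarith)) (by positivity)
  have hz : fτ τ 0 = 0 := by simp [fτ]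
  have hδ : 0 < τ / (3 * (2 * τ + 1)) := by positivity
  have hs3 : ∀ s ∈ Icc (τ / (3 * (2 * τ + 1))) (3 * (τ / (3 * (2 * τ + 1)))),
      0 < s ∧ s * (2 * τ + 1) ≤ τ ∧ s ≤ 1 := by
    intro s hs
    have h1 := hδ.trans_le hs.1
    have h2 : s * (2 * τ + 1) ≤ τ := by
      have := hs.2
      have e : 3 * (τ / (3 * (2 * τ + 1))) = τ / (2 * τ + 1) := by field_simp
      rw [e, le_div_iff₀ (by positivity)] at this
      exact this
    exact ⟨h1, h2, by nlinarith⟩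
  refine ⟨1 / (τ + 1) ^ 3 / 2, _, _, τ / (3 * (2 * τ + 1)),
    NL.build (η1 := r / 2) (by positivity) hB (by positivity) hδ hz hneg hpos (fτ_deriv hτ)
      (fτ'_bd hτ) hcv1 ?_,
    NL.build (η1 := r / 2) (by positivity) hB (by positivity) hδ (by simp [hz])
      (fun t ht => by have := hpos (-t) (by linarith); linarith)
      (fun t ht => by have := hneg (-t) (by linarith); linarith) ?_
      (fun t => fτ'_bd hτ _) (fun t ht => hcv1 _ (by rwa [abs_neg])) ?_⟩
  · intro s hs t ht
    obtain ⟨h1, h2, h3⟩ := hs3 s hs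
    have hx := exp_pos t
    have hx1 : exp t ≤ 1 := by rwa [exp_le_one_iff]
    have e : exp (2 * t) = exp t ^ 2 := by rw [two_mul, exp_add, sq]
    unfold fτ fτ'
    rw [e]
    set x := exp t
    have hy : 0 < τ + x := by positivity
    have : 2 * (x * (1 - x) / (τ + x) ^ 3) - s * (x * (τ - 2 * (τ + 1) * x + x ^ 2) / (τ + x) ^ 4)
        = x / (τ + x) ^ 4 * ((1 - x) * (2 * (τ + x) - s * (2 * τ + 1 - x)) + s * (τ + 1)) := by
      field_simp
      ring
    rw [this]
    have h4 : 0 ≤ (1 - x) * (2 * (τ + x) - s * (2 * τ + 1 - x)) :=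
      mul_nonneg (by linarith) (by nlinarith)
    positivity
  · intro t
    have := ((fτ_deriv hτ (-t)).comp t (hasDerivAt_neg t)).fun_neg
    exact this.congr_deriv (by ring)
  · intro s hs t ht
    obtain ⟨h1, h2, h3⟩ := hs3 s hs
    have hx := exp_pos (-t)
    have hx1 : 1 ≤ exp (-t) := by rw [one_le_exp_iff]; linarith
    have e : exp (2 * (-t)) = exp (-t) ^ 2 := by rw [two_mul, exp_add, sq]
    unfold fτ fτ'
    rw [e]
    set x := exp (-t)
    have hy : 0 < τ + x := by positivity
    have : 2 * -(x * (1 - x) / (τ + x) ^ 3) - s * (x * (τ - 2 * (τ + 1) * x + x ^ 2) / (τ + x) ^ 4)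
        = x / (τ + x) ^ 4 * ((x - 1) * (2 * (τ + x) - s * (x - 2 * τ - 1)) + s * (τ + 1)) := by
      field_simp
      ring
    rw [this]
    have h4 : 0 ≤ (x - 1) * (2 * (τ + x) - s * (x - 2 * τ - 1)) :=
      mul_nonneg (by linarith) (by nlinarith)
    positivity

/-! ### Fundamental domains -/

/-- The lattice as an additive subgroup. -/
def latG : AddSubgroup Pl where
  carrier := unitLattice
  add_mem' := lat_add
  zero_mem' := lat_zero
  neg_mem' := lat_neg

instance : Countable latG := lat_countable.to_subtype

/-- The half open unit square with lower left corner `c`. -/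
def sq_at (c : Pl) : Set Pl := {x | x 0 - c 0 ∈ Ico (0:ℝ) 1 ∧ x 1 - c 1 ∈ Ico (0:ℝ) 1}

lemma sq_at_meas (c : Pl) : MeasurableSet (sq_at c) := by
  have h0 : Measurable fun x : Pl => x 0 - c 0 := Continuous.measurable (by fun_prop)
  have h1 : Measurable fun x : Pl => x 1 - c 1 := Continuous.measurable (by fun_prop)
  exact (h0 measurableSet_Ico).inter (h1 measurableSet_Ico)

lemma fund_eq : fund = sq_at 0 := by
  ext x; simp [fund, sq_at]

lemma lat_coord {v : Pl} (hv : v ∈ unitLattice) (i : Fin 2) : ∃ n : ℤ, v i = n := by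
  obtain ⟨a, b, rfl⟩ := hv
  fin_cases i
  · exact ⟨a, by simp⟩
  · exact ⟨b, by simp⟩

lemma pl_ext {x y : Pl} (h0 : x 0 = y 0) (h1 : x 1 = y 1) : x = y := by
  ext i; fin_cases i
  · exact h0
  · exact h1

lemma sq_at_fd (c : Pl) : IsAddFundamentalDomain latG (sq_at c) volume := by
  refine IsAddFundamentalDomain.mk' (sq_at_meas c).nullMeasurableSet fun x => ?_
  obtain ⟨v, hv, h⟩ := exists_fund (x - c)
  refine ⟨⟨v, hv⟩, ?_, ?_⟩
  · show v + x ∈ sq_at c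
    obtain ⟨h0, h1⟩ := h
    simp only [PiLp.add_apply, PiLp.sub_apply] at h0 h1
    refine ⟨?_, ?_⟩
    · rw [PiLp.add_apply, show v 0 + x 0 - c 0 = x 0 - c 0 + v 0 by ring]; exact h0
    · rw [PiLp.add_apply, show v 1 + x 1 - c 1 = x 1 - c 1 + v 1 by ring]; exact h1
  · rintro ⟨w, hw⟩ hwx
    have hwx : w + x ∈ sq_at c := hwx
    obtain ⟨h0, h1⟩ := h
    obtain ⟨k0, k1⟩ := hwx
    simp only [PiLp.add_apply, PiLp.sub_apply] at h0 h1 k0 k1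
    have key : ∀ i : Fin 2, x i - c i + v i ∈ Ico (0:ℝ) 1 → w i + x i - c i ∈ Ico (0:ℝ) 1 →
        w i = v i := by
      intro i a b
      obtain ⟨m, hm⟩ := lat_coord hv i
      obtain ⟨n, hn⟩ := lat_coord hw i
      rw [hm] at a ⊢
      rw [hn] at b ⊢
      have e1 : (n : ℝ) - m < 1 := by linarith [a.1, b.2]
      have e2 : (m : ℝ) - n < 1 := by linarith [a.2, b.1]
      have e1' : n - m < 1 := by exact_mod_cast e1
      have e2' : m - n < 1 := by exact_mod_cast e2
      have : n = m := by omega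
      rw [this]
    exact Subtype.ext (pl_ext (key 0 h0 k0) (key 1 h1 k1))

lemma fund_meas : MeasurableSet fund := fund_eq ▸ sq_at_meas 0

lemma fund_integral_eq {g : Pl → ℝ} (hg : Periodic2 g) (c : Pl) :
    ∫ x in fund, g x = ∫ x in sq_at c, g x := by
  rw [fund_eq]
  refine (sq_at_fd 0).setIntegral_eq (sq_at_fd c) fun v x => ?_
  show g ((v : Pl) + x) = g x
  rw [add_comm]; exact hg x v v.2

/-- The union of the balls around the translates of `p`. -/
def perBall (p : Pl) (R : ℝ) : Set Pl := {x | ∃ v ∈ unitLattice, dist x (p + v) < R}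

lemma perBall_meas (p : Pl) (R : ℝ) : MeasurableSet (perBall p R) := by
  have : perBall p R = ⋃ v ∈ unitLattice, ball (p + v) R := by
    ext x; simp [perBall]
  rw [this]
  exact (isOpen_biUnion fun v _ => isOpen_ball).measurableSet

lemma perBall_per {p x v : Pl} {R : ℝ} (hv : v ∈ unitLattice) (hx : x ∈ perBall p R) :
    x + v ∈ perBall p R := by
  obtain ⟨w, hw, h⟩ := hx
  refine ⟨w + v, lat_add hw hv, ?_⟩
  rwa [← add_assoc, dist_add_right]

lemma coord_abs_le (x : Pl) (i : Fin 2) : |x i| ≤ ‖x‖ := by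
  simpa using PiLp.norm_apply_le x i

lemma fund_ball {g : Pl → ℝ} (hg : Periodic2 g) (p : Pl) {R : ℝ} (hR : 0 < R) (hR2 : R ≤ 1 / 2) :
    ∫ x in fund, (perBall p R).indicator g x = ∫ x in ball p R, g x := by
  have hp : Periodic2 ((perBall p R).indicator g) := by
    intro x v hv
    by_cases h : x ∈ perBall p R
    · rw [indicator_of_mem h, indicator_of_mem (perBall_per hv h), hg x v hv]
    · have h' : x + v ∉ perBall p R := by
        intro h1
        have := perBall_per (lat_neg hv) h1
        rw [add_neg_cancel_right] at this
        exact h this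
      rw [indicator_of_notMem h, indicator_of_notMem h']
  let c : Pl := p - ((1 / 2 : ℝ) • ee 0 + (1 / 2 : ℝ) • ee 1)
  have hc0 : c 0 = p 0 - 1 / 2 := by simp [c, ee_apply]
  have hc1 : c 1 = p 1 - 1 / 2 := by simp [c, ee_apply]
  rw [fund_integral_eq hp c, setIntegral_indicator (perBall_meas p R)]
  congr 2
  ext x
  constructor
  · rintro ⟨⟨h0, h1⟩, v, hv, hd⟩
    rw [hc0] at h0
    rw [hc1] at h1
    have key : ∀ i : Fin 2, x i - (p i - 1 / 2) ∈ Ico (0:ℝ) 1 → v i = 0 := by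
      intro i h
      obtain ⟨n, hn⟩ := lat_coord hv i
      have h2 := coord_abs_le (x - (p + v)) i
      rw [← dist_eq_norm] at h2
      have h3 := abs_lt.1 (h2.trans_lt hd)
      simp only [PiLp.add_apply, PiLp.sub_apply, hn] at h3
      have e1 : (n : ℝ) < 1 := by linarith [h.1, h.2, h3.1]
      have e2 : (-1 : ℝ) < n := by linarith [h.1, h.2, h3.2]
      have e1' : n < 1 := by exact_mod_cast e1
      have e2' : -1 < n := by exact_mod_cast e2
      have : n = 0 := by omega
      rw [hn, this]; simp
    have : v = 0 := pl_ext (key 0 h0) (key 1 h1)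
    rw [this, add_zero] at hd
    exact hd
  · intro hx
    have hx : dist x p < R := hx
    refine ⟨⟨?_, ?_⟩, 0, lat_zero, by rwa [add_zero]⟩
    · have h2 := coord_abs_le (x - p) 0
      rw [← dist_eq_norm] at h2
      have h3 := abs_lt.1 (h2.trans_lt hx)
      simp only [PiLp.sub_apply] at h3
      rw [hc0]
      constructor <;> linarith [h3.1, h3.2]
    · have h2 := coord_abs_le (x - p) 1
      rw [← dist_eq_norm] at h2
      have h3 := abs_lt.1 (h2.trans_lt hx)
      simp only [PiLp.sub_apply] at h3
      rw [hc1]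
      constructor <;> linarith [h3.1, h3.2]

/-! ### Integration on a ball -/

lemma pd_contin {f : Pl → ℝ} (hf : ContDiff ℝ 1 f) (i : Fin 2) : Continuous (pd f i) :=
  continuous_iff_continuousAt.2 fun x =>
    (hf.contDiffAt.pd' (m := 0) (by simp) i).continuousAt

lemma ball_nonneg {p : Pl} {R μ : ℝ} (hR : 0 < R) {Y : Fin 2 → Pl → ℝ} {w φ : Pl → ℝ}
    (hY : ∀ i, ContDiff ℝ 1 (Y i)) (hY0 : ∀ i x, 3 * R / 4 ≤ dist x p → Y i x = 0)
    (hw : ∀ x, x ≠ p → dist x p < R →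
      μ ≤ -(pd (Y 0) 0 x + pd (Y 1) 1 x + (Y 0 x) ^ 2 + (Y 1 x) ^ 2) + w x)
    (hφ : ContDiff ℝ (⊤ : ℕ∞) φ)
    (hIntg : IntegrableOn (fun x => gradSq φ x + w x * φ x ^ 2 - μ * φ x ^ 2) (ball p R)) :
    0 ≤ ∫ x in ball p R, (gradSq φ x + w x * φ x ^ 2 - μ * φ x ^ 2) := by
  have hφ2 : ContDiff ℝ 1 (fun x => φ x ^ 2) := (hφ.of_le top1).pow 2
  have hsupp : ∀ i, HasCompactSupport (Y i) := fun i =>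
    HasCompactSupport.intro (isCompact_closedBall p R) fun x hx => hY0 i x (by
      rw [mem_closedBall] at hx; push Not at hx; linarith)
  have hYd : ∀ i, Differentiable ℝ (Y i) := fun i => (hY i).differentiable (by simp)
  have hφd : Differentiable ℝ (fun x => φ x ^ 2) := hφ2.differentiable (by simp)
  have hi := fun i => ibp i (hYd i) hφd (pd_contin (hY i) i) (pd_contin hφ2 i) (hsupp i)
  have hpd0 : ∀ i x, R ≤ dist x p → pd (Y i) i x = 0 := by
    intro i x hx
    have : ∀ᶠ y in 𝓝 x, 3 * R / 4 < dist y p :=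
      (isOpen_lt continuous_const (continuous_id.dist continuous_const)).mem_nhds
        (by show 3 * R / 4 < dist x p; linarith)
    have e : Y i =ᶠ[𝓝 x] fun _ => (0:ℝ) := by
      filter_upwards [this] with y hy using hY0 i y hy.le
    rw [pd_congr e, pd_const]
  have hsupp' : ∀ i, HasCompactSupport (pd (Y i) i) := fun i =>
    HasCompactSupport.intro (isCompact_closedBall p R) fun x hx => hpd0 i x (by
      rw [mem_closedBall] at hx; push Not at hx; linarith)
  have int1 : ∀ i, Integrable (fun x => Y i x * pd (fun x => φ x ^ 2) i x) := fun i =>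
    ((hY i).continuous.mul (pd_contin hφ2 i)).integrable_of_hasCompactSupport (hsupp i).mul_right
  have int2 : ∀ i, Integrable (fun x => pd (Y i) i x * φ x ^ 2) := fun i =>
    ((pd_contin (hY i) i).mul hφ2.continuous).integrable_of_hasCompactSupport (hsupp' i).mul_right
  have int3 : ∀ i, Integrable (fun x => Y i x * pd (fun x => φ x ^ 2) i x + pd (Y i) i x * φ x ^ 2) :=
    fun i => (int1 i).add (int2 i)
  let T : Pl → ℝ := fun x => (Y 0 x * pd (fun x => φ x ^ 2) 0 x + pd (Y 0) 0 x * φ x ^ 2) +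
    (Y 1 x * pd (fun x => φ x ^ 2) 1 x + pd (Y 1) 1 x * φ x ^ 2)
  have hTi : Integrable T := ((int1 0).add (int2 0)).add ((int1 1).add (int2 1))
  have hT0 : ∫ x, T x = 0 := by
    show ∫ x, ((Y 0 x * pd (fun x => φ x ^ 2) 0 x + pd (Y 0) 0 x * φ x ^ 2) +
      (Y 1 x * pd (fun x => φ x ^ 2) 1 x + pd (Y 1) 1 x * φ x ^ 2)) = 0
    rw [integral_add (int3 0) (int3 1),
      integral_add (int1 0) (int2 0), integral_add (int1 1) (int2 1), hi 0, hi 1]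
    ring
  have hTb : ∫ x in ball p R, T x = 0 := by
    rw [setIntegral_eq_integral_of_forall_compl_eq_zero, hT0]
    intro x hx
    rw [mem_ball] at hx; push Not at hx
    simp only [T, hpd0 0 x hx, hpd0 1 x hx, hY0 0 x (by linarith), hY0 1 x (by linarith)]
    ring
  rw [← hTb]
  refine setIntegral_mono_ae_restrict hTi.integrableOn hIntg ?_
  have hne : ∀ᵐ x ∂(volume.restrict (ball p R)), x ≠ p :=
    ae_restrict_of_ae (by
      have := (measure_singleton (μ := (volume : Measure Pl)) p)
      rw [ae_iff]; simpa using this)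
  filter_upwards [hne, ae_restrict_mem measurableSet_ball] with x hxp hxb
  have h := hw x hxp hxb
  have hφx : ∀ i, pd (fun x => φ x ^ 2) i x = 2 * φ x * pd φ i x := by
    intro i
    have := pd_comp (f := φ) (β := fun t => t ^ 2) (b := 2 * φ x)
      (by simpa using hasDerivAt_pow 2 (φ x)) (hφ.contDiffAt.differentiableAt (by simp)) i
    exact this
  simp only [T, hφx, gradSq]
  have h2 := mul_le_mul_of_nonneg_right h (sq_nonneg (φ x))
  nlinarith [sq_nonneg (pd φ 0 x - φ x * Y 0 x), sq_nonneg (pd φ 1 x - φ x * Y 1 x)]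

lemma fin_pos {ι : Type*} [Finite ι] (r : ι → ℝ) (hr : ∀ i, 0 < r i) : ∃ ρ > 0, ∀ i, ρ ≤ r i := by
  obtain ⟨M, hM⟩ := Finite.exists_le (fun i => (r i)⁻¹)
  refine ⟨(max M 1)⁻¹, by positivity, fun i => ?_⟩
  exact inv_le_of_inv_le₀ (hr i) ((hM i).trans (le_max_left _ _))

lemma pd_per {φ : Pl → ℝ} (h : Periodic2 φ) (i : Fin 2) : Periodic2 (pd φ i) := by
  intro x v hv
  rw [← pd_trans]
  congr 1
  funext y; exact h y v hv

/-- Strict positivity of the quadratic form from local positivity. -/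
theorem glue {ι : Type*} [Fintype ι] (p : ι → Pl) {R : ℝ} (hR : 0 < R) (hR2 : R ≤ 1 / 2)
    (hsep : ∀ i j, i ≠ j → ∀ v ∈ unitLattice, 2 * R ≤ dist (p i) (p j + v))
    {w : Pl → ℝ} (hwp : Periodic2 w) (hwm : AEStronglyMeasurable w volume) {C : ℝ}
    (hwC : ∀ x, |w x| ≤ C)
    {m0 : ℝ} (hm0 : 0 < m0) (hoff : ∀ x, (∀ i, x ∉ perBall (p i) R) → m0 ≤ w x)
    (hloc : ∀ i, ∃ μ > 0, ∃ Y : Fin 2 → Pl → ℝ, (∀ l, ContDiff ℝ 1 (Y l)) ∧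
      (∀ l x, 3 * R / 4 ≤ dist x (p i) → Y l x = 0) ∧
      ∀ x, x ≠ p i → dist x (p i) < R →
        μ ≤ -(pd (Y 0) 0 x + pd (Y 1) 1 x + (Y 0 x) ^ 2 + (Y 1 x) ^ 2) + w x) :
    ∃ μ > 0, ∀ φ : Pl → ℝ, ContDiff ℝ (⊤ : ℕ∞) φ → Periodic2 φ →
      μ * (∫ x in fund, (φ x) ^ 2) ≤ ∫ x in fund, (gradSq φ x + w x * φ x ^ 2) := by
  choose μi hμi Y hY hY0 hYw using hloc
  obtain ⟨μ1, hμ1, hμle⟩ := fin_pos μi hμi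
  refine ⟨min μ1 m0, by positivity, fun φ hφ hφp => ?_⟩
  set μ := min μ1 m0 with hμ
  set Q : Pl → ℝ := fun x => gradSq φ x + w x * φ x ^ 2 - μ * φ x ^ 2 with hQ
  have hgc : Continuous (gradSq φ) :=
    ((pd_contin (hφ.of_le top1) 0).pow 2).add ((pd_contin (hφ.of_le top1) 1).pow 2)
  have hφsqc : Continuous fun x => φ x ^ 2 := hφ.continuous.pow 2
  have int_w : ∀ K : Set Pl, IsCompact K → IntegrableOn (fun x => w x * φ x ^ 2) K := by
    intro K hK
    refine Integrable.bdd_mul (c := C) (hφsqc.continuousOn.integrableOn_compact hK) hwm.restrict ?_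
    exact ae_of_all _ fun x => hwC x
  have int_A : ∀ K : Set Pl, IsCompact K → IntegrableOn (fun x => gradSq φ x + w x * φ x ^ 2) K :=
    fun K hK => (hgc.continuousOn.integrableOn_compact hK).add (int_w K hK)
  have int_B : ∀ K : Set Pl, IsCompact K → IntegrableOn (fun x => μ * φ x ^ 2) K :=
    fun K hK => (continuous_const.mul hφsqc).continuousOn.integrableOn_compact hK
  have int_Q : ∀ K : Set Pl, IsCompact K → IntegrableOn Q K :=
    fun K hK => (int_A K hK).sub (int_B K hK)
  have hQp : Periodic2 Q := by
    intro x v hv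
    simp only [hQ, gradSq, pd_per hφp 0 x v hv, pd_per hφp 1 x v hv, hφp x v hv, hwp x v hv]
  suffices h : 0 ≤ ∫ x in fund, Q x by
    have e : ∫ x in fund, Q x = (∫ x in fund, (gradSq φ x + w x * φ x ^ 2)) -
        ∫ x in fund, μ * φ x ^ 2 :=
      integral_sub ((int_A cbox cbox_compact).mono_set fund_sub)
        ((int_B cbox cbox_compact).mono_set fund_sub)
    rw [integral_const_mul] at e
    linarith
  have hQf : IntegrableOn Q fund := (int_Q cbox cbox_compact).mono_set fund_sub
  have hle : ∀ x, ∑ i, (perBall (p i) R).indicator Q x ≤ Q x := by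
    intro x
    by_cases hx : ∃ i, x ∈ perBall (p i) R
    · obtain ⟨i, hi⟩ := hx
      rw [Finset.sum_eq_single i]
      · rw [indicator_of_mem hi]
      · intro j _ hj
        refine indicator_of_notMem ?_ _
        rintro ⟨v, hv, hd⟩
        obtain ⟨v', hv', hd'⟩ := hi
        have h1 := hsep i j hj.symm (v + -v') (lat_add hv (lat_neg hv'))
        have h2 := dist_triangle_left (p i + v') (p j + v) x
        have h3 : dist (p i + v') (p j + v) = dist (p i) (p j + (v + -v')) := by
          rw [dist_eq_norm, dist_eq_norm]; congr 1; abel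
        linarith
      · simp
    · push Not at hx
      rw [Finset.sum_eq_zero fun i _ => indicator_of_notMem (hx i) _]
      have h1 := hoff x hx
      have h2 := mul_le_mul_of_nonneg_right h1 (sq_nonneg (φ x))
      have h3 := mul_le_mul_of_nonneg_right (min_le_right μ1 m0) (sq_nonneg (φ x))
      have h4 : 0 ≤ gradSq φ x := add_nonneg (sq_nonneg _) (sq_nonneg _)
      simp only [hQ]
      linarith
  have hsum : ∫ x in fund, ∑ i, (perBall (p i) R).indicator Q x =
      ∑ i, ∫ x in ball (p i) R, Q x := by
    rw [integral_finsetSum]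
    · exact Finset.sum_congr rfl fun i _ => fund_ball hQp (p i) hR hR2
    · intro i _
      exact hQf.indicator (perBall_meas _ _)
  have hnn : 0 ≤ ∑ i, ∫ x in ball (p i) R, Q x := by
    refine Finset.sum_nonneg fun i _ => ?_
    refine ball_nonneg (Y := Y i) hR (hY i) (hY0 i) (fun x hx hd => ?_) hφ
      ((int_Q _ (isCompact_closedBall (p i) R)).mono_set ball_subset_closedBall)
    exact ((min_le_left μ1 m0).trans (hμle i)).trans (hYw i x hx hd)
  refine hnn.trans (hsum ▸ ?_)
  refine integral_mono ?_ hQf hle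
  exact integrable_finsetSum _ fun i _ => hQf.indicator (perBall_meas _ _)

/-! ### Vortex data -/

lemma coord_sep (t : ℝ) : ∃ r > 0, ∀ n : ℤ, t ≠ n → r ≤ |t - n| := by
  by_cases h : t = round t
  · refine ⟨1, one_pos, fun n hn => ?_⟩
    rw [h] at hn ⊢
    have h1 : round t ≠ n := fun e => hn (by rw [e])
    have h2 : 1 ≤ |round t - n| := Int.one_le_abs (sub_ne_zero.2 h1)
    exact_mod_cast h2
  · exact ⟨|t - round t|, abs_pos.2 (sub_ne_zero.2 h), fun n _ => round_le t n⟩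

lemma lat_sep (w : Pl) : ∃ r > 0, ∀ v ∈ unitLattice, w ≠ v → r ≤ ‖w - v‖ := by
  obtain ⟨r0, h0, H0⟩ := coord_sep (w 0)
  obtain ⟨r1, h1, H1⟩ := coord_sep (w 1)
  refine ⟨min r0 r1, by positivity, fun v hv hne => ?_⟩
  obtain ⟨n0, e0⟩ := lat_coord hv 0
  obtain ⟨n1, e1⟩ := lat_coord hv 1
  by_cases h : w 0 = v 0
  · have h' : w 1 ≠ v 1 := fun h' => hne (pl_ext h h')
    have := H1 n1 (e1 ▸ h')
    rw [← e1] at this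
    exact (min_le_right _ _).trans (this.trans (coord_abs_le (w - v) 1))
  · have := H0 n0 (e0 ▸ h)
    rw [← e0] at this
    exact (min_le_left _ _).trans (this.trans (coord_abs_le (w - v) 0))

lemma LogSing.trans {u : Pl → ℝ} (hu : Periodic2 u) {p v : Pl} {a : ℝ} (hv : v ∈ unitLattice)
    (h : LogSing u p a) : LogSing u (p + v) a := by
  obtain ⟨r, hr, f, hf, h⟩ := h
  have hm : ∀ x, x ∈ ball (p + v) r → x - v ∈ ball p r := by
    intro x hx
    rw [mem_ball, dist_eq_norm] at hx ⊢
    rwa [show x - v - p = x - (p + v) by abel]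
  refine ⟨r, hr, fun x => f (x - v), hf.comp (contDiff_id.sub contDiff_const).contDiffOn hm,
    fun x hx hne => ?_⟩
  have h1 := h (x - v) (hm x hx) (fun e => hne (by rw [← e]; abel))
  have h2 := hu (x - v) v hv
  rw [sub_add_cancel] at h2
  rw [h2, h1, show x - v - p = x - (p + v) by abel]

namespace VortexData
variable (V : VortexData)

/-- All vortex points. -/
def pp (i : Fin V.d₁ ⊕ Fin V.d₂) : Pl := Sum.elim V.p₁ V.p₂ i

/-- All (signed) multiplicities. -/
def mm (i : Fin V.d₁ ⊕ Fin V.d₂) : ℝ := Sum.elim V.m₁ (fun j => - V.m₂ j) i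

lemma mem_Z_iff (x : Pl) : x ∈ V.Z ↔ ∃ i, ∃ v ∈ unitLattice, x = V.pp i + v := by
  constructor
  · rintro (⟨j, v, hv, rfl⟩ | ⟨j, v, hv, rfl⟩)
    · exact ⟨Sum.inl j, v, hv, rfl⟩
    · exact ⟨Sum.inr j, v, hv, rfl⟩
  · rintro ⟨j | j, v, hv, rfl⟩
    · exact Or.inl ⟨j, v, hv, rfl⟩
    · exact Or.inr ⟨j, v, hv, rfl⟩

lemma Z_countable : V.Z.Countable := by
  have : V.Z = ⋃ i, (fun v => V.pp i + v) '' unitLattice := by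
    ext x
    rw [V.mem_Z_iff, mem_iUnion]
    exact exists_congr fun i => ⟨fun ⟨v, hv, e⟩ => ⟨v, hv, e.symm⟩, fun ⟨v, hv, e⟩ => ⟨v, hv, e.symm⟩⟩
  rw [this]
  exact countable_iUnion fun i => lat_countable.image _

lemma pp_mem (i : Fin V.d₁ ⊕ Fin V.d₂) : V.pp i ∈ V.Z :=
  (V.mem_Z_iff _).2 ⟨i, 0, lat_zero, by simp⟩

lemma goodZ : ∃ ρ0, GoodZ V.Z ρ0 := by
  choose r hr H using fun q : (Fin V.d₁ ⊕ Fin V.d₂) × (Fin V.d₁ ⊕ Fin V.d₂) =>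
    lat_sep (V.pp q.1 - V.pp q.2)
  obtain ⟨ρ, hρ, hle⟩ := fin_pos r hr
  refine ⟨ρ, hρ, fun x hx v hv => ?_, fun z hz z' hz' hne => ?_⟩
  · rw [V.mem_Z_iff] at hx ⊢
    obtain ⟨i, w, hw, rfl⟩ := hx
    exact ⟨i, w + v, lat_add hw hv, by abel⟩
  · obtain ⟨i, v, hv, rfl⟩ := (V.mem_Z_iff z).1 hz
    obtain ⟨j, v', hv', rfl⟩ := (V.mem_Z_iff z').1 hz'
    have := H (i, j) (v' + -v) (lat_add hv' (lat_neg hv)) (fun e => hne (by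
      have : V.pp i = V.pp j + (v' + -v) := by rw [← e]; simp
      rw [this]; abel))
    refine (hle (i, j)).trans (this.trans (le_of_eq ?_))
    rw [dist_eq_norm]; congr 1
    simp only
    abel

lemma pp_ne {i j : Fin V.d₁ ⊕ Fin V.d₂} (h : i ≠ j) {v : Pl} (hv : v ∈ unitLattice) :
    V.pp i ≠ V.pp j + v := V.distinct i j h v hv

end VortexData

lemma IsSolution.sing {V : VortexData} {τ ε : ℝ} {u : Pl → ℝ} (hu : IsSolution V τ ε u)
    (i : Fin V.d₁ ⊕ Fin V.d₂) : LogSing u (V.pp i) (V.mm i) := by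
  rcases i with j | j
  · exact hu.sing₁ j
  · exact hu.sing₂ j

lemma IsSolution.asol {V : VortexData} {τ ε : ℝ} {u : Pl → ℝ} {A ρ0 : ℝ} (hZ : GoodZ V.Z ρ0)
    (hA : ∀ i, |V.mm i| ≤ A) (hu : IsSolution V τ ε u) : ASol V.Z A (fτ τ) ((ε ^ 2)⁻¹) u where
  per := hu.periodic
  sm x hx := by
    refine hu.smooth.contDiffAt ?_
    by_cases hd : ∃ z ∈ V.Z, dist x z < ρ0 / 2
    · obtain ⟨z, hz, hd⟩ := hd
      have hxz : x ≠ z := fun e => hx (e ▸ hz)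
      filter_upwards [isOpen_ne.mem_nhds hxz, isOpen_ball.mem_nhds (mem_ball.2 hd)] with y h1 h2
      exact hZ.notMem hz h1 (by rw [mem_ball] at h2; linarith [hZ.pos])
    · push Not at hd
      filter_upwards [ball_mem_nhds x (half_pos hZ.pos)] with y hy hyZ
      have := hd y hyZ
      rw [mem_ball, dist_comm] at hy
      linarith
  pde x hx := by have := hu.pde x hx; linarith
  sing z hz := by
    obtain ⟨i, v, hv, rfl⟩ := (V.mem_Z_iff z).1 hz
    exact ⟨V.mm i, hA i, (hu.sing i).trans hu.periodic hv⟩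

lemma htop_ext {V : VortexData} {ρ0 : ℝ} (hZ : GoodZ V.Z ρ0) {u : ℕ → Pl → ℝ}
    (hp : ∀ n, Periodic2 (u n))
    (htop : ∀ᵐ x : Pl, x ∈ fund \ V.Z → Tendsto (fun n => u n x) atTop (nhds 0)) :
    ∀ᵐ x : Pl, Tendsto (fun n => u n x) atTop (𝓝 0) := by
  have h1 : ∀ᵐ x : Pl, ∀ v ∈ unitLattice,
      (x + v ∈ fund \ V.Z → Tendsto (fun n => u n (x + v)) atTop (nhds 0)) := by
    rw [ae_ball_iff lat_countable]
    intro v _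
    exact (measurePreserving_add_right volume v).quasiMeasurePreserving.ae htop
  have h2 : ∀ᵐ x : Pl, x ∉ V.Z := measure_eq_zero_iff_ae_notMem.1 (V.Z_countable.measure_zero _)
  filter_upwards [h1, h2] with x hx hxZ
  obtain ⟨v, hv, hf⟩ := exists_fund x
  have hn : x + v ∉ V.Z := fun h => hxZ (by
    have := hZ.per _ h _ (lat_neg hv)
    rwa [add_neg_cancel_right] at this)
  have := hx v hv ⟨hf, hn⟩
  simpa only [fun n => hp n x v hv] using this

theorem main_aux
    (V : VortexData) (τ : ℝ) (hτ : 0 < τ)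
    (ε : ℕ → ℝ) (hε : ∀ n, 0 < ε n) (hε0 : Tendsto ε atTop (nhds 0))
    (u : ℕ → Pl → ℝ) (hu : ∀ n, IsSolution V τ (ε n) (u n))
    (htop : ∀ᵐ x : Pl, x ∈ fund \ V.Z → Tendsto (fun n => u n x) atTop (nhds 0)) :
    ∀ᶠ n in atTop, StrictlyStable τ (ε n) (u n) := by
  obtain ⟨c, B, η0, δ, nl1, nl2⟩ := nl_exists hτ
  obtain ⟨ρ0, hZ⟩ := V.goodZ
  have hρ := hZ.pos
  obtain ⟨A, hA0, hA⟩ : ∃ A, 0 ≤ A ∧ ∀ i, |V.mm i| ≤ A := by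
    obtain ⟨M, hM⟩ := Finite.exists_le (fun i => |V.mm i|)
    exact ⟨max M 0, le_max_right _ _, fun i => (hM i).trans (le_max_left _ _)⟩
  have hsol := fun n => (hu n).asol hZ hA
  have htop' := htop_ext hZ (fun n => (hu n).periodic) htop
  have hk : ∀ n, 0 < (ε n ^ 2)⁻¹ := fun n => by have := hε n; positivity
  obtain ⟨R, hR, hR8, hR4⟩ : ∃ R > 0, 8 * R ≤ ρ0 ∧ R ≤ 1 / 4 :=
    ⟨min (ρ0 / 8) (1 / 4), by positivity, by linarith [min_le_left (ρ0 / 8) (1 / 4)],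
      min_le_right _ _⟩
  obtain ⟨θ, G, hθ⟩ := cut_zero hR
  have hc := nl1.c_pos
  have hB := nl1.B_pos
  have hδ := nl1.δ_pos
  have hη0 := nl1.η0_pos
  obtain ⟨η, hη, hη1, hη2, hη3⟩ : ∃ η > 0, η ≤ η0 ∧ 4 * η ≤ δ ∧
      2 * R * (2 * η / (R / 8) + (4 * B * η / (c * (R / 8) ^ 2) + η) * (R / 8) / 2) ≤ δ / 2 := by
    set K := 2 * R * (2 / (R / 8) + (4 * B / (c * (R / 8) ^ 2) + 1) * (R / 8) / 2) with hK
    have hKp : 0 < K := by positivity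
    refine ⟨min η0 (min (δ / 4) (δ / 2 / K)), by positivity, min_le_left _ _, ?_, ?_⟩
    · have := (min_le_right η0 (min (δ / 4) (δ / 2 / K))).trans (min_le_left _ _)
      linarith
    · have := (min_le_right η0 (min (δ / 4) (δ / 2 / K))).trans (min_le_right _ _)
      set η := min η0 (min (δ / 4) (δ / 2 / K))
      rw [le_div_iff₀ hKp] at this
      refine le_trans (le_of_eq ?_) this
      rw [hK]; ring
  have low := unif_lower hZ V.Z_countable hA0 hk nl1.neg hsol htop' (r := R / 8) (by positivity)
    (by linarith) (by linarith) hη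
  have up := unif_lower hZ V.Z_countable hA0 hk nl2.neg (fun n => (hsol n).neg)
    (by filter_upwards [htop'] with x hx using by simpa using hx.neg) (r := R / 8) (by positivity)
    (by linarith) (by linarith) hη
  have hkt : Tendsto (fun n => (ε n ^ 2)⁻¹) atTop atTop := by
    have h1 : Tendsto (fun n => ε n ^ 2) atTop (𝓝[>] 0) := by
      refine tendsto_nhdsWithin_iff.2 ⟨by simpa using hε0.pow 2, Eventually.of_forall fun n => ?_⟩
      have := hε n
      show 0 < ε n ^ 2
      positivity
    exact tendsto_inv_nhdsGT_zero.comp h1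
  filter_upwards [low, up, hkt.eventually_ge_atTop ((G + 1) * 8 / c)] with n hl hup hkn
  set k := (ε n ^ 2)⁻¹ with hk_def
  have hkG : G + 1 ≤ k * c / 8 := by
    rw [div_le_iff₀ hc] at hkn
    linarith
  have hkp : 0 < k := hk n
  have habs : ∀ x ∈ Dr V.Z (R / 8), |u n x| ≤ η := fun x hx =>
    abs_le.2 ⟨hl x hx, by have := hup x hx; linarith⟩
  have hDr : ∀ z ∈ V.Z, ∀ x, R / 8 ≤ dist x z → dist x z ≤ 3 * R → x ∈ Dr V.Z (R / 8) := by
    intro z hz x h1 h2 z' hz'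
    by_cases h : z = z'
    · rwa [← h]
    · have h3 := hZ.sep z hz z' hz' h
      have h4 := dist_triangle_left z z' x
      linarith
  obtain ⟨μ, hμ, H⟩ := glue V.pp hR (by linarith)
    (fun i j hij v hv => by
      have := hZ.sep (V.pp i) (V.pp_mem i) (V.pp j + v) ((V.mem_Z_iff _).2 ⟨j, v, hv, rfl⟩)
        (V.pp_ne hij hv)
      linarith)
    (w := fun x => - (k * fτ' τ (u n x)))
    (fun x v hv => by simp only [(hu n).periodic x v hv])
    (((fτ'_cont hτ).comp_aestronglyMeasurable ((hsol n).aesm V.Z_countable)).const_mul k).neg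
    (C := k * B)
    (fun x => by
      rw [abs_neg, abs_mul, abs_of_pos hkp]
      exact mul_le_mul_of_nonneg_left (nl1.bd _) hkp.le)
    (m0 := k * c) (by positivity)
    (fun x hx => by
      have hxD : x ∈ Dr V.Z (R / 8) := by
        intro z hz
        obtain ⟨i, v, hv, rfl⟩ := (V.mem_Z_iff z).1 hz
        by_contra hlt
        push Not at hlt
        exact hx i ⟨v, hv, by linarith⟩
      have h1 := nl1.conv _ ((habs x hxD).trans hη1)
      have h2 := mul_le_mul_of_nonneg_left h1 hkp.le
      linarith)
    (fun i => by
      rcases i with j | j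
      · have L : Loc V.Z ρ0 A (fτ τ) (fτ' τ) c B η0 δ k (u n) (V.pp (Sum.inl j)) (V.m₁ j) R η :=
          ⟨hZ, hsol n, nl1, hkp, V.pp_mem _, (hu n).sing₁ j, V.m₁_nonneg j, hR, by linarith, hη, hη1,
            hη2, fun x h1 h2 => habs x (hDr _ (V.pp_mem _) x h1 h2), hη3⟩
        obtain ⟨μ, hμ, Y, h1, h2, h3⟩ := L.field (hθ.trans _) hkG
        exact ⟨μ, hμ, Y, h1, h2, fun x hx hd => by have := h3 x hx hd; linarith⟩
      · have L : Loc V.Z ρ0 A (fun t => - fτ τ (-t)) (fun t => fτ' τ (-t)) c B η0 δ k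
            (fun x => - u n x) (V.pp (Sum.inr j)) (V.m₂ j) R η :=
          ⟨hZ, (hsol n).neg, nl2, hkp, V.pp_mem _, by simpa [VortexData.pp] using ((hu n).sing₂ j).neg,
            V.m₂_nonneg j, hR, by linarith, hη, hη1,
            hη2, fun x h1 h2 => by rw [abs_neg]; exact habs x (hDr _ (V.pp_mem _) x h1 h2), hη3⟩
        obtain ⟨μ, hμ, Y, h1, h2, h3⟩ := L.field (hθ.trans _) hkG
        refine ⟨μ, hμ, Y, h1, h2, fun x hx hd => ?_⟩
        have := h3 x hx hd
        simp only [neg_neg] at this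
        linarith)
  refine ⟨μ, hμ, fun φ h1 h2 => (H φ h1 h2).trans (le_of_eq ?_)⟩
  unfold QuadForm
  congr 1
  funext x
  ring

/-- If a sequence `u_ε` of solutions of `(E_ε)` with `ε → 0` satisfies
`u_ε → 0` a.e. in `Ω ∖ Z` (topological sequence), then `u_ε` is strictly stable for all
sufficiently small `ε > 0`. -/
theorem topological_implies_strictly_stable
    (V : VortexData) (τ : ℝ) (hτ : 0 < τ)
    (ε : ℕ → ℝ) (hε : ∀ n, 0 < ε n) (hε0 : Tendsto ε atTop (nhds 0))
    (u : ℕ → Pl → ℝ) (hu : ∀ n, IsSolution V τ (ε n) (u n))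
    (htop : ∀ᵐ x : Pl, x ∈ fund \ V.Z → Tendsto (fun n => u n x) atTop (nhds 0)) :
    ∀ᶠ n in atTop, StrictlyStable τ (ε n) (u n) := by
  exact main_aux V τ hτ ε hε hε0 u hu htop
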